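/- Suppose MDZH holds with some constant C > 4, i.e., for every number field K ≠ ℚ (with d = [K:ℚ] and Δ the absolute value of its discriminant), ζ_K has no zero ρ = β + iγ with 0 < β < 1 satisfying both |γ| ≥ (1 + 4·log Δ)^{-1} and β ≥ 1 − ((log(d·log(3Δ)))^C · log(|γ|+2))^{-1}, and no real zero in (0,1) ∩ (1 − (log(d·log(3Δ)))^{-C}, 1). Then MRH holds with the same constant C: there is a constant c > 0 such that for every irreducible polynomial f ∈ ℤ[x] of degree d ≥ 2 all of whose coefficients have absolute value at most 2^σ (σ a positive integer), and for every real x ≥ exp(c·(log(d²σ + d³))^{2+C²}), one has π_f(x) ≥ x·(1/(d·log x) − exp(−(log x)^{1/C} / (log(d²σ + d³))^C)), where π_f(x) is the number of primes p ≤ x such that the reduction of f modulo p has a root in 𝔽_p. -/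

import Mathlib

open scoped Classical

noncomputable section

/-- `zeta` is the (unique) analytic continuation of the Dedekind zeta function of the
number field `K`: it is analytic away from `s = 1` and agrees with the Dirichlet series
`∑_𝔞 (N𝔞)^{-s}` (sum over nonzero integral ideals) for `Re s > 1`. -/
def IsDedekindZeta (K : Type) [Field K] [NumberField K] (zeta : ℂ → ℂ) : Prop :=
  DifferentiableOn ℂ zeta {s : ℂ | s ≠ 1} ∧
    ∀ s : ℂ, 1 < s.re →
      zeta s = ∑' I : {I : Ideal (NumberField.RingOfIntegers K) // I ≠ ⊥},
        (Ideal.absNorm (I : Ideal (NumberField.RingOfIntegers K)) : ℂ) ^ (-s)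

/-- MDZH with constant `C`: for every number field `K ≠ ℚ` (i.e. of degree `> 1`),
with `d = [K:ℚ]` and `Δ` the absolute value of its discriminant, `ζ_K` has no
non-trivial zero `ρ = β + iγ` with `|γ| ≥ (1 + 4 log Δ)⁻¹` and
`β ≥ 1 - ((log (d log (3Δ)))^C · log (|γ| + 2))⁻¹`, and no real zero in
`(0,1) ∩ (1 - (log (d log (3Δ)))^{-C}, 1)`. -/
def MDZH (C : ℝ) : Prop :=
  ∀ (K : Type) [Field K] [NumberField K],
    1 < Module.finrank ℚ K →
    ∀ zeta : ℂ → ℂ, IsDedekindZeta K zeta →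
      (∀ ρ : ℂ, zeta ρ = 0 → 0 < ρ.re → ρ.re < 1 →
        ¬ ((1 + 4 * Real.log ((NumberField.discr K).natAbs))⁻¹ ≤ |ρ.im| ∧
            1 - ((Real.log ((Module.finrank ℚ K : ℝ) *
                    Real.log (3 * ((NumberField.discr K).natAbs : ℝ)))) ^ C *
                  Real.log (|ρ.im| + 2))⁻¹ ≤ ρ.re)) ∧
      (∀ β : ℝ, zeta (β : ℂ) = 0 → 0 < β → β < 1 →
        ¬ (1 - (Real.log ((Module.finrank ℚ K : ℝ) *
              Real.log (3 * ((NumberField.discr K).natAbs : ℝ)))) ^ (-C) < β))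

/-- `piPoly f x` is the number of primes `p ≤ x` such that the reduction of `f` mod `p`
has a root in `𝔽_p`. -/
def piPoly (f : Polynomial ℤ) (x : ℝ) : ℕ :=
  ((Finset.range (⌊x⌋₊ + 1)).filter
    (fun p => p.Prime ∧ ∃ a : ZMod p, Polynomial.aeval a f = 0)).card
section
notation "bl" => (by linarith)
notation "bp" => (by positivity)
notation "bn" => (by norm_num)
notation "bf" => (by fun_prop)
notation "dg" => Module.finrank ℚ
notation:65 c:66 "~~" t:66 => (c : ℂ) + t * Complex.I
notation:max "dsc" K:max => (Int.natAbs (NumberField.discr K) : ℝ)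
notation:max "FrI" K:max => (FractionalIdeal (nonZeroDivisors (NumberField.RingOfIntegers K)) K)ˣ
open MeasureTheory Real
open Complex (I)
open Matrix (toLin')
lemma zpi_summable (ι : Type*) [Fintype ι] :
    Summable (fun m : ι → ℤ => ((1 + ‖m‖) ^ (Fintype.card ι + 1))⁻¹) := by
  classical
  set L := Submodule.span ℤ (Set.range (Pi.basisFun ℝ ι)) with hL
  have hr : Module.finrank ℤ L = Fintype.card ι := by
    rw [ZLattice.rank ℝ L]; simp
  have h1 := ZLattice.summable_norm_pow_inv L (Fintype.card ι + 1) (by omega)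
  have hmem : ∀ m : ι → ℤ, (fun i => (m i : ℝ)) ∈ L := by
    intro m
    rw [hL, (Pi.basisFun ℝ ι).mem_span_iff_repr_mem ℤ]
    intro i; exact ⟨m i, by simp⟩
  let j : (ι → ℤ) → L := fun m => ⟨_, hmem m⟩
  have hj : Function.Injective j := by
    intro a b h
    have := congrArg Subtype.val h
    funext i
    have h2 : (a i : ℝ) = b i := congrFun this i
    exact_mod_cast h2
  have h2 := h1.comp_injective hj
  rw [← (Set.finite_singleton (0 : ι → ℤ)).summable_compl_iff] at h2 ⊢
  refine Summable.of_nonneg_of_le (fun _ => by dsimp; positivity) ?_ h2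
  rintro ⟨m, hm⟩
  have hm : m ≠ 0 := hm
  have e : ‖j m‖ = ‖m‖ := by
    rfl
  simp only [Function.comp, e]
  rw [← inv_pow]
  have : 0 < ‖m‖ := norm_pos_iff.mpr hm
  rw [inv_pow, inv_pow]
  gcongr
  linarith
section
variable {ι : Type*} [Fintype ι] [DecidableEq ι]
def nrmA (A : Matrix ι ι ℝ) (v : ι → ℝ) : ℝ := ∑ i, (A.mulVec v i) ^ 2
lemma nrmA_lower (A : Matrix ι ι ℝ) (hA : A.det ≠ 0) :
    ∃ c > 0, ∀ v, c * ‖v‖ ^ 2 ≤ nrmA A v := by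
  obtain ⟨M, hM0, hM⟩ := (LinearMap.toContinuousLinearMap (toLin' A⁻¹)).bound
  refine ⟨(M ^ 2)⁻¹, by positivity, fun v => ?_⟩
  have h := hM (A.mulVec v)
  simp only [LinearMap.coe_toContinuousLinearMap', Matrix.toLin'_apply, Matrix.mulVec_mulVec] at h
  rw [Matrix.nonsing_inv_mul _ (isUnit_iff_ne_zero.mpr hA), Matrix.one_mulVec] at h
  have h2 : ‖A.mulVec v‖ ≤ √(nrmA A v) := by
    refine (pi_norm_le_iff_of_nonneg (sqrt_nonneg _)).mpr fun i => ?_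
    apply abs_le_sqrt
    exact Finset.single_le_sum (f := fun i => (A.mulVec v i) ^ 2)
      (fun _ _ => sq_nonneg _) (Finset.mem_univ i)
  have h3 : ‖v‖ ≤ M * √(nrmA A v) := h.trans (by gcongr)
  have h4 : ‖v‖ ^ 2 ≤ (M * √(nrmA A v)) ^ 2 := by gcongr
  rw [mul_pow, sq_sqrt (show 0 ≤ nrmA A v from Finset.sum_nonneg fun _ _ => sq_nonneg _)] at h4
  rw [inv_mul_le_iff₀ bp]
  exact h4
lemma gauss_bd (A : Matrix ι ι ℝ) (hA : A.det ≠ 0) (R : ℝ) (hR : 0 ≤ R) :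
    ∃ K, 0 ≤ K ∧ ∀ (x : ι → ℝ) (m : ι → ℤ), ‖x‖ ≤ R →
      Real.exp (-π * nrmA A (x + fun i => (m i : ℝ))) ≤
        K * ((1 + ‖m‖) ^ (Fintype.card ι + 1))⁻¹ := by
  obtain ⟨c, hc, h⟩ := nrmA_lower A hA
  set p := Fintype.card ι + 1 with hp
  refine ⟨p.factorial * Real.exp (1 + 1 / (4 * (π * c))) * (1 + R) ^ p, by positivity,
    fun x m hx => ?_⟩
  set v := x + fun i => (m i : ℝ) with hv
  rw [← div_eq_mul_inv, le_div_iff₀ bp]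
  have e : ‖m‖ = ‖(fun i => (m i : ℝ))‖ := by aesop
  have h1 : 1 + ‖m‖ ≤ (1 + ‖v‖) * (1 + R) := by
    have : ‖(fun i => (m i : ℝ))‖ ≤ ‖v‖ + ‖x‖ := by
      have := norm_sub_le v x
      simpa [hv] using this
    nlinarith [norm_nonneg v]
  have hpi := pi_pos
  have h2 : (1 + ‖v‖) ^ p ≤ p.factorial * Real.exp (1 + ‖v‖) := by
    have := pow_div_factorial_le_exp (1 + ‖v‖) bp p
    rwa [div_le_iff₀' bp] at this
  have h3 : Real.exp (-π * nrmA A v) * Real.exp (1 + ‖v‖) ≤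
      Real.exp (1 + 1 / (4 * (π * c))) := by
    rw [← exp_add]
    apply exp_le_exp.mpr
    have h5 := mul_le_mul_of_nonneg_left (h v) hpi.le
    have h6 : ‖v‖ - (π * c) * ‖v‖ ^ 2 ≤ 1 / (4 * (π * c)) := by
      rw [le_div_iff₀ bp]
      nlinarith [sq_nonneg (2 * (π * c) * ‖v‖ - 1)]
    nlinarith
  calc Real.exp (-π * nrmA A v) * (1 + ‖m‖) ^ p
      ≤ Real.exp (-π * nrmA A v) * ((1 + ‖v‖) * (1 + R)) ^ p := by gcongr
    _ = Real.exp (-π * nrmA A v) * (1 + ‖v‖) ^ p * (1 + R) ^ p := by rw [mul_pow]; ring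
    _ ≤ Real.exp (-π * nrmA A v) * (p.factorial * Real.exp (1 + ‖v‖)) * (1 + R) ^ p := by gcongr
    _ = p.factorial * (Real.exp (-π * nrmA A v) * Real.exp (1 + ‖v‖)) * (1 + R) ^ p := by ring
    _ ≤ _ := by gcongr
lemma gauss_summable (A : Matrix ι ι ℝ) (hA : A.det ≠ 0) :
    Summable (fun m : ι → ℤ => Real.exp (-π * nrmA A (fun i => (m i : ℝ)))) := by
  obtain ⟨K, _, h⟩ := gauss_bd A hA 0 le_rfl
  refine Summable.of_nonneg_of_le (fun _ => by positivity) (fun m => ?_)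
    ((zpi_summable ι).mul_left K)
  simpa using h 0 m (by simp)
lemma gauss_integrable (A : Matrix ι ι ℝ) (hA : A.det ≠ 0) (k : ι → ℝ) :
    Integrable (fun x : ι → ℝ => Complex.exp (-(π : ℂ) * (nrmA A x : ℂ)
      + -(2 * π * I) * ∑ i, k i * x i)) ∧
    ∫ x : ι → ℝ, Complex.exp (-(π : ℂ) * (nrmA A x : ℂ)
      + -(2 * π * I) * ∑ i, k i * x i)
      = ((|A.det|⁻¹ : ℝ) : ℂ) * (Real.exp (-π * nrmA (A⁻¹).transpose k) : ℝ) := by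
  set c : ι → ℂ := fun i => -(2 * π * I) * ((A⁻¹).transpose.mulVec k i : ℂ) with hc
  set G : (ι → ℝ) → ℂ := fun v => Complex.exp (-(π : ℂ) * ∑ i, (v i : ℂ) ^ 2 + ∑ i, c i * v i)
  have hG : Integrable G := GaussianFourier.integrable_cexp_neg_mul_sum_add
    (b := (π : ℂ)) (by simpa using pi_pos) c
  have hGi : ∫ v, G v = _ := GaussianFourier.integral_cexp_neg_mul_sum_add
    (b := (π : ℂ)) (by simpa using pi_pos) c
  have hk : ∀ x : ι → ℝ, ∑ i, k i * x i = ∑ i, (A⁻¹).transpose.mulVec k i * (A.mulVec x) i := by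
    intro x
    change k ⬝ᵥ x = ((A⁻¹).transpose.mulVec k) ⬝ᵥ (A.mulVec x)
    rw [Matrix.mulVec_transpose, Matrix.dotProduct_mulVec, Matrix.vecMul_vecMul,
      Matrix.nonsing_inv_mul _ (isUnit_iff_ne_zero.mpr hA), Matrix.vecMul_one]
  have hcomp : (fun x : ι → ℝ => Complex.exp (-(π : ℂ) * (nrmA A x : ℂ)
      + -(2 * π * I) * ∑ i, k i * x i)) = fun x => G (toLin' A x) := by
    funext x
    simp only [G, Matrix.toLin'_apply, hc]
    congr 2
    · simp [nrmA]
    · rw [hk x]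
      push_cast
      rw [Finset.mul_sum]
      exact Finset.sum_congr rfl fun i _ => by ring
  have hmap := map_matrix_volume_pi_eq_smul_volume_pi hA
  rw [hcomp]
  let e : (ι → ℝ) ≃L[ℝ] (ι → ℝ) :=
    (LinearEquiv.ofIsUnitDet (f := toLin' A) (v := Pi.basisFun ℝ ι) (v' := Pi.basisFun ℝ ι)
      (by rw [LinearMap.toMatrix_eq_toMatrix', LinearMap.toMatrix'_toLin']
          exact isUnit_iff_ne_zero.mpr hA)).toContinuousLinearEquiv
  have hmeas : MeasurableEmbedding (fun x => toLin' A x) :=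
    e.toHomeomorph.measurableEmbedding
  have hint : Integrable G (Measure.map (toLin' A) volume) := by
    rw [hmap]; exact hG.smul_measure ENNReal.ofReal_ne_top
  refine ⟨(hmeas.integrable_map_iff).mp hint, ?_⟩
  rw [← hmeas.integral_map, hmap, integral_smul_measure, hGi]
  rw [div_self (by simp), Complex.one_cpow, one_mul]
  rw [ENNReal.toReal_ofReal (abs_nonneg _), abs_inv, Complex.real_smul]
  congr 1
  rw [Complex.ofReal_exp]
  congr 1
  simp only [hc, nrmA]
  push_cast
  rw [Finset.sum_div, Finset.mul_sum]
  field_simp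
  rw [Complex.I_sq]; ring
end
end
section
open MeasureTheory Real
open Fintype (card)
open Set (Ioc univ)
open UnitAddTorus (mFourier mFourierCoeff)
section
variable {ι : Type*} [Fintype ι] [DecidableEq ι]
def icast (m : ι → ℤ) : ι → ℝ := fun i => (m i : ℝ)
lemma cube_tile (h : (ι → ℝ) → ℂ) (hi : Integrable h) :
    HasSum (fun m : ι → ℤ => ∫ x in {x : ι → ℝ | ∀ i, x i ∈ Ioc ((0 : ι → ℝ) i) ((0 : ι → ℝ) i + 1)}, h (x + icast m))
      (∫ x, h x) := by
  set S : (ι → ℤ) → Set (ι → ℝ) := fun m => {x | ∀ i, x i ∈ Ioc (m i : ℝ) (m i + 1)} with hS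
  have hm : ∀ m, MeasurableSet (S m) := by
    intro m
    have : S m = univ.pi fun i => Ioc (m i : ℝ) (m i + 1) := by ext; simp [S]
    rw [this]; exact MeasurableSet.univ_pi fun i => measurableSet_Ioc
  have hmem : ∀ m x, x ∈ S m ↔ ∀ i, ⌈x i⌉ = m i + 1 := by
    intro m x
    refine forall_congr' fun i => ?_
    rw [Int.ceil_eq_iff]; simp
  have hd : Pairwise (Function.onFun Disjoint S) := by
    intro a b hab
    rw [Function.onFun, Set.disjoint_left]
    intro x ha hb
    apply hab
    funext i
    have h1 := (hmem a x).1 ha i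
    have h2 := (hmem b x).1 hb i
    omega
  have hu : ⋃ m, S m = univ := by
    rw [Set.eq_univ_iff_forall]
    intro x
    rw [Set.mem_iUnion]
    exact ⟨fun i => ⌈x i⌉ - 1, (hmem _ _).2 fun i => by ring⟩
  have := hasSum_integral_iUnion (μ := volume) hm hd (f := h) hi.integrableOn
  rw [hu, Measure.restrict_univ] at this
  suffices hf : ∀ m, ∫ x in {x : ι → ℝ | ∀ i, x i ∈ Ioc ((0 : ι → ℝ) i) ((0 : ι → ℝ) i + 1)}, h (x + icast m) = ∫ x in S m, h x by
    rw [funext hf]; exact this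
  intro m
  have hmp : MeasurePreserving (fun x : ι → ℝ => x + icast m) volume volume :=
    measurePreserving_add_right volume _
  rw [← hmp.setIntegral_preimage_emb (measurableEmbedding_addRight _) h (S m)]
  congr 2
  ext x
  simp [S, icast, Set.mem_Ioc, add_comm (1 : ℝ), add_comm (x _)]
lemma poisson_gauss (A : Matrix ι ι ℝ) (hA : A.det ≠ 0) :
    ∑' m : ι → ℤ, exp (-π * nrmA A (icast m)) =
      |A.det|⁻¹ * ∑' m : ι → ℤ, exp (-π * nrmA (A⁻¹).transpose (icast m)) := by
  have hA' : (A⁻¹).transpose.det ≠ 0 := by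
    simp [*]
  set g : (ι → ℝ) → ℂ := fun x => ((exp (-π * nrmA A x) : ℝ) : ℂ) with hg
  have hgc : Continuous g := by
    simp only [hg, nrmA, Matrix.mulVec, dotProduct]
    fun_prop
  have hgn : ∀ x, ‖g x‖ = exp (-π * nrmA A x) := fun x => by
    rw [Complex.norm_real, norm_eq_abs, abs_of_pos (exp_pos _)]
  set F : (ι → ℝ) → ℂ := fun x => ∑' m : ι → ℤ, g (x + icast m) with hF
  have hFc : Continuous F := by
    rw [continuous_iff_continuousAt]
    intro x0
    obtain ⟨K, _, hK⟩ := gauss_bd A hA (‖x0‖ + 1) bp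
    have : ContinuousOn F (Metric.ball 0 (‖x0‖ + 1)) := by
      refine continuousOn_tsum (u := fun m : ι → ℤ => K * ((1 + ‖m‖) ^ (card ι + 1))⁻¹)
        (fun m => ?_) ((zpi_summable ι).mul_left K) ?_
      · fun_prop
      · intro m x hx
        rw [hgn]
        exact hK x m (by simpa using (mem_ball_zero_iff.mp hx).le)
    exact this.continuousAt (Metric.isOpen_ball.mem_nhds (by simp))
  have hFp : ∀ x (n : ι → ℤ), F (x + icast n) = F x := by
    intro x n
    simp only [hF]
    rw [← (Equiv.addLeft n).tsum_eq (fun m => g (x + icast m))]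
    refine tsum_congr fun m => ?_
    congr 1
    funext i
    simp [icast]; ring
  set Q : (ι → ℝ) → UnitAddTorus ι := fun x i => (x i : UnitAddCircle) with hQ
  have hQo : IsOpenQuotientMap Q :=
    IsOpenQuotientMap.piMap (f := fun (_ : ι) (x : ℝ) => (x : UnitAddCircle))
      (fun _ => QuotientAddGroup.isOpenQuotientMap_mk)
  set Fl : UnitAddTorus ι → ℂ := fun t => F (fun i => (t i).out) with hFl
  have hlift : ∀ x, Fl (Q x) = F x := by
    intro x
    have : ∀ i, ∃ n : ℤ, (Quotient.out (Q x i) : ℝ) = x i + n := by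
      intro i
      have h1 : ((Quotient.out (Q x i) : ℝ) : UnitAddCircle) = (x i : UnitAddCircle) :=
        Quotient.out_eq (Q x i)
      rw [eq_comm, QuotientAddGroup.eq] at h1
      obtain ⟨n, hn⟩ := h1
      refine ⟨n, ?_⟩
      simp at hn
      linarith
    choose n hn using this
    rw [← hFp x n]
    simp only [hFl]
    congr 1
    funext i
    exact hn i
  have hFlc : Continuous Fl := by
    rw [← hQo.continuous_comp_iff]
    have : Fl ∘ Q = F := funext hlift
    rw [this]; exact hFc
  have hcoef : ∀ n : ι → ℤ, mFourierCoeff Fl n =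
      ((|A.det|⁻¹ : ℝ) : ℂ) * (exp (-π * nrmA (A⁻¹).transpose (icast n)) : ℝ) := by
    intro n
    rw [UnitAddTorus.mFourierCoeff_eq_integral Fl n 0]
    obtain ⟨hi, hint⟩ := gauss_integrable A hA (icast n)
    rw [← hint, ← (cube_tile _ hi).tsum_eq]
    have hmf : ∀ x : ι → ℝ, mFourier (-n) (fun i => (x i : UnitAddCircle)) =
        Complex.exp (-(2 * π * Complex.I) * (∑ i, icast n i * x i : ℝ)) := by
      intro x
      simp only [mFourier, ContinuousMap.coe_mk, fourier_coe_apply]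
      rw [← Complex.exp_sum]
      push_cast
      rw [Finset.mul_sum]
      simp [icast]; ring
    have hper : ∀ (x : ι → ℝ) (m : ι → ℤ),
        mFourier (-n) (fun i => ((x + icast m) i : UnitAddCircle)) =
        mFourier (-n) (fun i => (x i : UnitAddCircle)) := by
      simp [icast]
    have hterm : ∀ x : ι → ℝ, Complex.exp (-(π : ℂ) * (nrmA A x : ℂ)
      + -(2 * π * Complex.I) * (∑ i, icast n i * x i : ℝ)) =
        mFourier (-n) (fun i => (x i : UnitAddCircle)) * g x := by
      intro x
      rw [hmf, Complex.exp_add, mul_comm]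
      simp [hg]
    simp_rw [hterm, hper]
    set S : Set (ι → ℝ) := {x : ι → ℝ | ∀ i, x i ∈ Ioc ((0 : ι → ℝ) i) ((0 : ι → ℝ) i + 1)} with hS
    have hSm : MeasurableSet S := by
      have : S = univ.pi fun i => Ioc (0 : ℝ) (0 + 1) := by ext; simp [S]
      rw [this]; exact MeasurableSet.univ_pi fun i => measurableSet_Ioc
    have hSv : volume S = 1 := by
      have : S = univ.pi fun i => Ioc (0 : ℝ) (0 + 1) := by ext; simp [S]
      rw [this, volume_pi_Ioc]; simp
    have hSb : ∀ x ∈ S, ‖x‖ ≤ 1 := by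
      intro x hx
      refine (pi_norm_le_iff_of_nonneg zero_le_one).mpr fun i => ?_
      have := hx i
      simp at this
      rw [norm_eq_abs, abs_le]; constructor <;> linarith
    obtain ⟨K, hK0, hK⟩ := gauss_bd A hA 1 zero_le_one
    have hb : ∀ (m : ι → ℤ), ∀ x ∈ S, ‖mFourier (-n) (fun i => (x i : UnitAddCircle)) * g (x + icast m)‖ ≤ K * ((1 + ‖m‖) ^ (card ι + 1))⁻¹ := by
      intro m x hx
      rw [norm_mul, hgn]
      have h1 := ((mFourier (-n)).norm_coe_le_norm (fun i => (x i : UnitAddCircle)))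
      rw [UnitAddTorus.mFourier_norm] at h1
      have := hK x m (hSb x hx)
      calc _ ≤ 1 * exp (-π * nrmA A (x + icast m)) := by gcongr
        _ ≤ _ := by rw [one_mul]; exact this
    have hcont : ∀ m : ι → ℤ, Continuous fun x : ι → ℝ =>
        mFourier (-n) (fun i => (x i : UnitAddCircle)) * g (x + icast m) := by
      fun_prop
    rw [(hasSum_integral_of_summable_integral_norm (μ := volume.restrict S)
      (F := fun (m : ι → ℤ) (x : ι → ℝ) =>
        mFourier (-n) (fun i => (x i : UnitAddCircle)) * g (x + icast m)) ?_ ?_).tsum_eq]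
    · refine setIntegral_congr_fun hSm fun x _ => ?_
      rw [tsum_mul_left]
      rw [hlift]; rfl
    · intro m
      refine Measure.integrableOn_of_bounded (by simp [hSv])
        ((hcont m).aestronglyMeasurable) (ae_restrict_of_forall_mem hSm (hb m))
    · refine Summable.of_nonneg_of_le (fun m => integral_nonneg fun _ => norm_nonneg _) (fun m => ?_)
        ((zpi_summable ι).mul_left K)
      have := norm_setIntegral_le_of_norm_le_const (μ := volume) (s := S)
        (f := fun x : ι → ℝ => ‖mFourier (-n) (fun i => (x i : UnitAddCircle)) * g (x + icast m)‖)
        (C := K * ((1 + ‖m‖) ^ (card ι + 1))⁻¹) (by simp [hSv])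
        (fun x hx => by rw [norm_norm]; exact hb m x hx)
      rw [Measure.real, hSv] at this
      simp only [ENNReal.toReal_one, mul_one] at this
      exact (le_abs_self _).trans this
  have hs := (gauss_summable (A⁻¹).transpose hA')
  have hsum : Summable (mFourierCoeff (⟨Fl, hFlc⟩ : C(UnitAddTorus ι, ℂ))) := by
    have : (mFourierCoeff (⟨Fl, hFlc⟩ : C(UnitAddTorus ι, ℂ))) = _ := funext hcoef
    rw [this]
    exact (Complex.summable_ofReal.mpr hs).mul_left _
  have key := (UnitAddTorus.hasSum_mFourier_series_apply_of_summable hsum (Q 0)).tsum_eq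
  have hz : ∀ n : ι → ℤ, mFourier n (Q 0) = 1 := by
    simp [mFourier, Q]
  have k2 : (⟨Fl, hFlc⟩ : C(UnitAddTorus ι, ℂ)) (Q 0) = F 0 := hlift 0
  rw [k2] at key
  simp only [hz, smul_eq_mul, mul_one] at key
  have k3 : ∑' i, mFourierCoeff Fl i = F 0 := key
  simp_rw [hcoef] at k3
  rw [tsum_mul_left, ← Complex.ofReal_tsum] at k3
  simp only [hF, hg, zero_add] at k3
  exact_mod_cast k3.symm
end
end
section
open MeasureTheory Real Matrix NumberField
open scoped MatrixOrder Matrix.Norms.L2Operator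
open Algebra (discr embeddingsMatrixReindex)
open Finset (sum_congr univ)
open InfinitePlace (mk)
section
variable {ι : Type*} [Fintype ι] [DecidableEq ι]
lemma nrmA_eq (A : Matrix ι ι ℝ) (v : ι → ℝ) : nrmA A v = v ⬝ᵥ (Aᵀ * A).mulVec v := by
  rw [← mulVec_mulVec, dotProduct_mulVec, vecMul_transpose]
  simp [nrmA, dotProduct, pow_two]
lemma poisson_P (P P' : Matrix ι ι ℝ) (hP : P.PosSemidef) (h : P * P' = 1) :
    Summable (fun m : ι → ℤ => exp (-π * (icast m ⬝ᵥ P.mulVec (icast m)))) ∧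
    ∑' m : ι → ℤ, exp (-π * (icast m ⬝ᵥ P.mulVec (icast m))) =
      (√ P.det)⁻¹ * ∑' m : ι → ℤ, exp (-π * (icast m ⬝ᵥ P'.mulVec (icast m))) := by
  have hdP : P.det ≠ 0 := by
    intro h0
    have := congrArg det h
    rw [det_mul, h0] at this; simp at this
  obtain ⟨A, hA⟩ : ∃ A : Matrix ι ι ℝ, P = Aᵀ * A := by
    obtain ⟨B, hB⟩ := (CStarAlgebra.nonneg_iff_eq_star_mul_self (a := P)).mp hP.nonneg
    exact ⟨B, by rw [hB, star_eq_conjTranspose, conjTranspose_eq_transpose_of_trivial]⟩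
  have hdet : P.det = A.det ^ 2 := by rw [hA, det_mul, det_transpose]; ring
  have hAd : A.det ≠ 0 := by
    aesop
  have hP' : P' = (A⁻¹).transposeᵀ * (A⁻¹)ᵀ := by
    rw [transpose_transpose, ← inv_eq_right_inv h, hA, Matrix.mul_inv_rev,
      transpose_nonsing_inv]
  have h1 := poisson_gauss A hAd
  have h0 := gauss_summable A hAd
  simp_rw [nrmA_eq] at h1 h0
  rw [← hP', ← hA] at h1
  rw [← hA] at h0
  refine ⟨h0, ?_⟩
  rw [h1, hdet, sqrt_sq_eq_abs]
end
section
variable {K : Type*} [Field K] [NumberField K]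
def plc (φ : K →ₐ[ℚ] ℂ) : InfinitePlace K := mk (φ : K →+* ℂ)
def Qf (y : InfinitePlace K → ℝ) (a : K) : ℝ := ∑ w, w.mult * y w * (w a) ^ 2
lemma sum_plc {E : Type*} [AddCommMonoid E] (f : InfinitePlace K → E) :
    ∑ φ : K →ₐ[ℚ] ℂ, f (plc φ) = ∑ w, w.mult • f w := by
  classical
  have : ∑ φ : K →ₐ[ℚ] ℂ, f (plc φ) = ∑ φ : K →+* ℂ, f (mk φ) :=
    Fintype.sum_equiv (RingHom.equivRatAlgHom (R := K) (S := ℂ)).symm _ _ (fun φ => rfl)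
  rw [this, ← Finset.sum_fiberwise (s := univ) (g := fun φ : K →+* ℂ => mk φ)]
  refine sum_congr rfl fun w _ => ?_
  rw [sum_congr rfl (g := fun _ => f w) (by aesop), Finset.sum_const,
    InfinitePlace.card_filter_mk_eq]
lemma prod_plc (f : InfinitePlace K → ℝ) :
    ∏ φ : K →ₐ[ℚ] ℂ, f (plc φ) = ∏ w, f w ^ w.mult :=
  sum_plc (E := Additive ℝ) f
def cj : (K →ₐ[ℚ] ℂ) ≃ (K →ₐ[ℚ] ℂ) :=
  Function.Involutive.toPerm (fun φ => ((Complex.conjAe.restrictScalars ℚ).toAlgHom).comp φ)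
    (fun φ => by ext x; simp)
lemma cj_apply (φ : K →ₐ[ℚ] ℂ) (x : K) : cj φ x = starRingEnd ℂ (φ x) := rfl
lemma plc_cj (φ : K →ₐ[ℚ] ℂ) : plc (cj φ) = plc φ :=
  InfinitePlace.mk_conjugate_eq (φ : K →+* ℂ)
lemma plc_apply (φ : K →ₐ[ℚ] ℂ) (x : K) : plc φ x = ‖φ x‖ := rfl
lemma real_form (y : InfinitePlace K → ℝ) (a b : K) :
    (((∑ φ : K →ₐ[ℚ] ℂ, (y (plc φ) : ℂ) * (φ a * starRingEnd ℂ (φ b))).re : ℝ) : ℂ) =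
    ∑ φ : K →ₐ[ℚ] ℂ, (y (plc φ) : ℂ) * (φ a * starRingEnd ℂ (φ b)) := by
  rw [← Complex.conj_eq_iff_re, map_sum, ← Equiv.sum_comp cj]
  simp [plc_cj, cj_apply]
variable {ι : Type*} [Fintype ι] [DecidableEq ι]
def gramY (y : InfinitePlace K → ℝ) (b : ι → K) : Matrix ι ι ℝ :=
  of fun i j => (∑ φ : K →ₐ[ℚ] ℂ, (y (plc φ) : ℂ) * (φ (b i) * starRingEnd ℂ (φ (b j)))).re
lemma gram_quad (y : InfinitePlace K → ℝ) (b : ι → K) (v : ι → ℝ) :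
    v ⬝ᵥ (gramY y b).mulVec v = ∑ φ : K →ₐ[ℚ] ℂ, y (plc φ) * ‖∑ i, (v i : ℂ) * φ (b i)‖ ^ 2 := by
  have : ((v ⬝ᵥ (gramY y b).mulVec v : ℝ) : ℂ) =
      ((∑ φ : K →ₐ[ℚ] ℂ, y (plc φ) * ‖∑ i, (v i : ℂ) * φ (b i)‖ ^ 2 : ℝ) : ℂ) := by
    simp only [dotProduct, mulVec, gramY, of_apply]
    push_cast
    simp_rw [real_form, ← Complex.mul_conj', map_sum, map_mul, Complex.conj_ofReal,
      Finset.sum_mul, Finset.mul_sum]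
    rw [Finset.sum_comm' (t' := univ) (s' := fun _ => univ) (by simp)]
    simp_rw [Finset.sum_comm (s := univ (α := ι)) (t := univ (α := K →ₐ[ℚ] ℂ))]
    refine sum_congr rfl fun φ _ => ?_
    rw [Finset.sum_comm]
    refine sum_congr rfl fun i _ => sum_congr rfl fun j _ => by ring
  exact_mod_cast this
lemma gram_psd (y : InfinitePlace K → ℝ) (hy : ∀ w, 0 < y w) (b : ι → K) :
    (gramY y b).PosSemidef := by
  refine PosSemidef.of_dotProduct_mulVec_nonneg ?_ ?_
  · ext i j
    simp only [conjTranspose_apply, gramY, of_apply, star_trivial]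
    simp [mul_comm]
  · intro v
    rw [star_trivial, gram_quad]
    exact Finset.sum_nonneg fun φ _ => mul_nonneg (hy _).le bp
lemma gram_int (y : InfinitePlace K → ℝ) (b : ι → K) (m : ι → ℤ) :
    icast m ⬝ᵥ (gramY y b).mulVec (icast m) = Qf y (∑ i, m i • b i) := by
  rw [gram_quad, Qf]
  have := sum_plc (fun w : InfinitePlace K => y w * (w (∑ i, m i • b i)) ^ 2)
  simp only [nsmul_eq_mul] at this
  simp_rw [mul_assoc]
  rw [← this]
  refine sum_congr rfl fun φ _ => ?_
  rw [plc_apply]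
  simp [icast]
lemma gram_factor (y : InfinitePlace K → ℝ) (b : ι → K) (e : ι ≃ (K →ₐ[ℚ] ℂ)) :
    (gramY y b).map (algebraMap ℝ ℂ) = (embeddingsMatrixReindex ℚ ℂ b e) *
      diagonal (fun i => (y (plc (e i)) : ℂ)) *
      ((embeddingsMatrixReindex ℚ ℂ b e).map (starRingEnd ℂ))ᵀ := by
  ext i j
  simp only [map_apply, gramY, of_apply, Complex.coe_algebraMap, real_form,
    mul_diagonal, transpose_apply, embeddingsMatrixReindex,
    Algebra.embeddingsMatrix, reindex_apply, submatrix_apply]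
  rw [← Equiv.sum_comp e]
  refine sum_congr rfl fun k _ => ?_
  simp; ring
lemma theta_basis (y : InfinitePlace K → ℝ) (hy : ∀ w, 0 < y w) (b b' : Module.Basis ι ℚ K)
    (hb : ∀ i j, Algebra.trace ℚ K (b i * b' j) = if i = j then 1 else 0) :
    Summable (fun m : ι → ℤ => exp (-π * Qf y (∑ i, m i • b i))) ∧
    ∑' m : ι → ℤ, exp (-π * Qf y (∑ i, m i • b i)) =
      (√ (|(discr ℚ b : ℝ)| * ∏ w, y w ^ w.mult))⁻¹ *
        ∑' m : ι → ℤ, exp (-π * Qf y⁻¹ (∑ i, m i • b' i)) := by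
  have e : ι ≃ (K →ₐ[ℚ] ℂ) := Fintype.equivOfCardEq (by
    rw [AlgHom.card, Module.finrank_eq_card_basis b])
  set M := embeddingsMatrixReindex ℚ ℂ b e with hM
  set M' := embeddingsMatrixReindex ℚ ℂ b' e with hM'
  have hMM : M * M'ᵀ = 1 := by
    ext i j
    rw [mul_apply, one_apply]
    have := congrArg (algebraMap ℚ ℂ) (hb i j)
    rw [trace_eq_sum_embeddings ℂ, ← Equiv.sum_comp e] at this
    simp only [map_mul] at this
    rw [apply_ite (algebraMap ℚ ℂ), map_one, map_zero] at this
    rw [← this]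
    rfl
  have hMM2 : Mᵀ * M' = 1 := by
    have := mul_eq_one_comm.mp hMM
    have := congrArg transpose this
    simpa using this
  have hinj : Function.Injective (fun A : Matrix ι ι ℝ => A.map (algebraMap ℝ ℂ)) :=
    map_injective Complex.ofReal_injective
  have hPP : gramY y b * gramY y⁻¹ b' = 1 := by
    apply hinj
    simp only
    rw [Matrix.map_mul, Matrix.map_one _ (map_zero _) (map_one _)]
    have h1 : (gramY y⁻¹ b').map (algebraMap ℝ ℂ) = (M'.map (starRingEnd ℂ)) *
      diagonal (fun i => (y⁻¹ (plc (e i)) : ℂ)) * M'ᵀ := by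
      have := (gram_psd y⁻¹ (fun w => inv_pos.mpr (hy w)) b').1
      have h2 : (gramY y⁻¹ b')ᵀ = gramY y⁻¹ b' := by
        rwa [IsHermitian, conjTranspose_eq_transpose_of_trivial] at this
      rw [← h2, transpose_map, gram_factor _ _ e, transpose_mul,
        transpose_mul, transpose_transpose, diagonal_transpose,
        mul_assoc]
    rw [h1, gram_factor _ _ e]
    have h3 : (M.map (starRingEnd ℂ))ᵀ * M'.map (starRingEnd ℂ) = 1 := by
      rw [← transpose_map, ← Matrix.map_mul, hMM2, Matrix.map_one _ (map_zero _) (map_one _)]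
    have h4 : diagonal (fun i => (y (plc (e i)) : ℂ)) *
        diagonal (fun i => (y⁻¹ (plc (e i)) : ℂ)) = 1 := by
      rw [diagonal_mul_diagonal, ← diagonal_one]
      congr 1
      funext i
      have := (hy (plc (e i))).ne'
      simp [this]
    calc _ = M * diagonal (fun i => (y (plc (e i)) : ℂ)) *
        ((M.map (starRingEnd ℂ))ᵀ * M'.map (starRingEnd ℂ)) *
        diagonal (fun i => (y⁻¹ (plc (e i)) : ℂ)) * M'ᵀ := by
          simp only [mul_assoc]; rfl
      _ = M * (diagonal (fun i => (y (plc (e i)) : ℂ)) *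
         diagonal (fun i => (y⁻¹ (plc (e i)) : ℂ))) * M'ᵀ := by
          rw [h3, mul_one, mul_assoc M]
      _ = 1 := by aesop
  have hdet : (gramY y b).det = |(discr ℚ b : ℝ)| * ∏ w, y w ^ w.mult := by
    have h1 : (((gramY y b).det : ℝ) : ℂ) = M.det * (∏ i, (y (plc (e i)) : ℂ)) *
        starRingEnd ℂ M.det := by
      have := congrArg det (gram_factor y b e)
      rw [det_mul, det_mul, det_diagonal, det_transpose] at this
      rw [RingHom.map_det (starRingEnd ℂ)]
      rw [← RingHom.mapMatrix_apply, ← RingHom.mapMatrix_apply, ← RingHom.map_det] at this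
      exact this
    have h2 : ((|(discr ℚ b : ℝ)| : ℝ) : ℂ) = M.det * starRingEnd ℂ M.det := by
      have h3 := Algebra.discr_eq_det_embeddingsMatrixReindex_pow_two ℚ ℂ b e
      have h4 := congrArg norm h3
      rw [norm_pow] at h4
      rw [Complex.mul_conj', ← Complex.ofReal_pow, hM, ← h4]
      simp
    rw [← prod_plc, ← Equiv.prod_comp e]
    have : (((gramY y b).det : ℝ) : ℂ) =
      ((|(discr ℚ b : ℝ)| * ∏ i, y (plc (e i)) : ℝ) : ℂ) := by
      rw [h1]; push_cast; rw [h2]; ring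
    exact_mod_cast this
  have := poisson_P (gramY y b) (gramY y⁻¹ b') (gram_psd y hy b) hPP
  simp_rw [gram_int] at this
  rwa [hdet] at this
end
end
section
open MeasureTheory Real Matrix NumberField Module
open scoped nonZeroDivisors
open Algebra (discr)
open FractionalIdeal (absNorm)
section
variable {K : Type*} [Field K] [NumberField K]
lemma basis_tsum {ι : Type*} [Fintype ι] (b : Basis ι ℚ K) (S : Set K)
    (hS : ∀ x, x ∈ Submodule.span ℤ (Set.range b) ↔ x ∈ S) :
    ∃ e : (ι → ℤ) ≃ S, ∀ m, (e m : K) = ∑ i, m i • b i := by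
  have hli : LinearIndependent ℤ b := b.linearIndependent.restrict_scalars' ℤ
  refine ⟨Equiv.ofBijective (fun m => ⟨∑ i, m i • b i, (hS _).1 ?_⟩) ⟨?_, ?_⟩, fun m => rfl⟩
  · exact Submodule.sum_mem _ fun i _ => Submodule.smul_mem _ _ (Submodule.subset_span ⟨i, rfl⟩)
  · intro m m' h
    have h := congrArg Subtype.val h
    rw [← sub_eq_zero, ← Finset.sum_sub_distrib] at h
    simp_rw [← sub_smul] at h
    have := Fintype.linearIndependent_iff.mp hli _ h
    funext i
    linarith [this i]
  · rintro ⟨x, hx⟩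
    obtain ⟨c, hc⟩ := (Submodule.mem_span_range_iff_exists_fun ℤ).mp ((hS x).2 hx)
    exact ⟨c, Subtype.ext hc⟩
lemma discr_fracIdeal (I : FrI K) :
    |discr ℚ (basisOfFractionalIdeal K I)| =
      (absNorm I.1) ^ 2 * (discr K).natAbs := by
  have e : (Free.ChooseBasisIndex ℤ (𝓞 K)) ≃ (Free.ChooseBasisIndex ℤ I) :=
    Fintype.equivOfCardEq (by
      rw [← finrank_eq_card_basis (integralBasis K),
        finrank_eq_card_basis (basisOfFractionalIdeal K I)])
  rw [← det_basisOfFractionalIdeal_eq_absNorm K I e]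
  have h1 : discr ℚ (basisOfFractionalIdeal K I) =
      discr ℚ ((basisOfFractionalIdeal K I).reindex e.symm) := by
    rw [Basis.coe_reindex, Equiv.symm_symm]
    exact (Algebra.discr_reindex ℚ (basisOfFractionalIdeal K I) e.symm).symm
  have h2 : discr ℚ ((basisOfFractionalIdeal K I).reindex e.symm) =
      ((integralBasis K).det ((basisOfFractionalIdeal K I).reindex e.symm)) ^ 2 * discr K := by
    rw [coe_discr, Basis.det_apply, ← Algebra.discr_of_matrix_vecMul, Basis.toMatrix_map_vecMul]
  rw [h1, h2, abs_mul, abs_pow, sq_abs]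
  rw [Nat.cast_natAbs, Int.cast_abs]
def dualU (I : FrI K) : FrI K :=
  Units.mk0 (FractionalIdeal.dual ℤ ℚ I.1) (FractionalIdeal.dual_ne_zero ℤ ℚ I.ne_zero)
lemma dualU_dualU (I : FrI K) : dualU (dualU I) = I := by
  simp [dualU, FractionalIdeal.dual_dual]
lemma absNorm_dualU (I : FrI K) :
    absNorm (dualU I).1 * (absNorm I.1 * (discr K).natAbs) = 1 := by
  have h1 : (dualU I).1 * (I.1 * (differentIdeal ℤ (𝓞 K) : FractionalIdeal (𝓞 K)⁰ K)) = 1 := by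
    simp only [dualU, Units.val_mk0]
    rw [← mul_assoc, FractionalIdeal.dual_mul_self ℤ ℚ I.ne_zero,
      coeIdeal_differentIdeal ℤ ℚ K (𝓞 K)]
    exact mul_inv_cancel₀ (FractionalIdeal.dual_ne_zero ℤ ℚ one_ne_zero)
  have h2 := congrArg absNorm h1
  rw [map_mul, map_mul, map_one, FractionalIdeal.coeIdeal_absNorm, absNorm_differentIdeal K] at h2
  exact h2
lemma theta_ideal (I : FrI K) (y : InfinitePlace K → ℝ) (hy : ∀ w, 0 < y w) :
    Summable (fun a : (I.1 : Set K) => exp (-π * Qf y a)) ∧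
    ∑' a : (I.1 : Set K), exp (-π * Qf y a) =
      (√ (((absNorm I.1 : ℚ) : ℝ) ^ 2 * (discr K).natAbs * ∏ w, y w ^ w.mult))⁻¹ *
        ∑' a : ((dualU I).1 : Set K), exp (-π * Qf y⁻¹ a) := by
  classical
  set b := basisOfFractionalIdeal K I
  set b' := (Algebra.traceForm ℚ K).dualBasis (traceForm_nondegenerate ℚ K) b with hb'
  have h := theta_basis y hy b b' (by
    intro i j
    have := LinearMap.BilinForm.apply_dualBasis_left (B := Algebra.traceForm ℚ K) (traceForm_nondegenerate ℚ K) b j i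
    rw [Algebra.traceForm_apply, mul_comm] at this
    rw [this])
  obtain ⟨e, he⟩ := basis_tsum b (I.1 : Set K) (fun x => mem_span_basisOfFractionalIdeal K)
  obtain ⟨e', he'⟩ := basis_tsum b' ((dualU I).1 : Set K) (fun x => by
    rw [hb', ← LinearMap.BilinForm.dualSubmodule_span_of_basis]
    have h3 : Submodule.span ℤ (Set.range b) = ((I.1 : Submodule (𝓞 K) K)).restrictScalars ℤ := by
      ext x; exact mem_span_basisOfFractionalIdeal K
    rw [h3, ← Submodule.restrictScalars_traceDual]
    rw [Submodule.restrictScalars_mem, ← FractionalIdeal.coe_dual ℤ ℚ I.ne_zero]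
    rfl)
  have hd : |(discr ℚ b : ℝ)| =
      ((absNorm I.1 : ℚ) : ℝ) ^ 2 * (discr K).natAbs := by
    exact_mod_cast congrArg (fun q : ℚ => (q : ℝ)) (discr_fracIdeal I)
  rw [hd] at h
  simp_rw [← he, ← he'] at h
  rw [e.tsum_eq (fun a : (I.1 : Set K) => exp (-π * Qf y a)),
    e'.tsum_eq (fun a : ((dualU I).1 : Set K) => exp (-π * Qf y⁻¹ a))] at h
  refine ⟨?_, h.2⟩
  exact (e.summable_iff (f := fun a : (I.1 : Set K) => exp (-π * Qf y a))).mp h.1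
end
end
section
open MeasureTheory Real NumberField Module
open scoped nonZeroDivisors
open ClassGroup (mk)
open FractionalIdeal (spanSingleton)
open Function (Bijective)
open Units (ext val_mul)
section
variable {K : Type*} [Field K] [NumberField K]
abbrev NzI (K : Type*) [Field K] [NumberField K] := {J : Ideal (𝓞 K) // J ≠ ⊥}
lemma classify (I : ClassGroup (𝓞 K) → FrI K)
    (hI : Bijective fun κ => mk K (I κ)) :
    ∃ (k : NzI K → ClassGroup (𝓞 K)) (α : NzI K → K), (∀ J, α J ≠ 0) ∧
      (∀ J, |Algebra.norm ℚ (α J)| = (Ideal.absNorm J.1 : ℚ) * FractionalIdeal.absNorm (I (k J)).1) ∧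
      ∀ G : ClassGroup (𝓞 K) → K → ENNReal,
        ∑' κ, ∑' a : {a : K // a ∈ (I κ).1 ∧ a ≠ 0}, G κ a =
          ∑' J, ∑' ε : (𝓞 K)ˣ, G (k J) (((ε : 𝓞 K) : K) * α J) := by
  have hU : ∀ J : NzI K, (J.1 : FractionalIdeal (𝓞 K)⁰ K) ≠ 0 := fun J =>
    FractionalIdeal.coeIdeal_ne_zero.mpr J.2
  set U : NzI K → FrI K := fun J => Units.mk0 _ (hU J) with hUdef
  have hk : ∀ J : NzI K, ∃ κ, mk K (I κ) = (mk K (U J))⁻¹ := fun J => hI.2 _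
  choose k hk using hk
  have hα : ∀ J : NzI K, ∃ a : K, spanSingleton (𝓞 K)⁰ a = (U J).1 * (I (k J)).1 := by
    intro J
    have h : mk K (U J * I (k J)) = 1 := by simp [*]
    rw [ClassGroup.mk_eq_one_iff] at h
    obtain ⟨a, ha⟩ := h
    refine ⟨a, ?_⟩
    apply FractionalIdeal.coeToSubmodule_injective
    simp only
    rw [FractionalIdeal.coe_spanSingleton, ← val_mul]
    exact ha.symm
  choose α hα using hα
  have hα0 : ∀ J, α J ≠ 0 := by
    intro J h
    have := hα J
    rw [h, FractionalIdeal.spanSingleton_zero] at this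
    exact ((U J) * I (k J)).ne_zero (by simp [*])
  refine ⟨k, α, hα0, ?_, ?_⟩
  · intro J
    rw [← FractionalIdeal.absNorm_span_singleton (𝓞 K), hα, map_mul, ← FractionalIdeal.coeIdeal_absNorm (R := 𝓞 K) (K := K)]
    rfl
  intro G
  have hmem : ∀ (J : NzI K) (ε : (𝓞 K)ˣ), ((ε : 𝓞 K) : K) * α J ∈ (I (k J)).1 := by
    intro J ε
    have h1 : (U J).1 * (I (k J)).1 ≤ (I (k J)).1 := by
      calc (U J).1 * (I (k J)).1 ≤ 1 * (I (k J)).1 := mul_le_mul_left FractionalIdeal.coeIdeal_le_one _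
        _ = _ := one_mul _
    apply h1
    rw [← hα, FractionalIdeal.mem_spanSingleton]
    exact ⟨ε, by rw [Algebra.smul_def]⟩
  let e : NzI K × (𝓞 K)ˣ → Σ κ, {a : K // a ∈ (I κ).1 ∧ a ≠ 0} := fun p =>
    ⟨k p.1, ((p.2 : 𝓞 K) : K) * α p.1, hmem _ _, mul_ne_zero (by simp) (hα0 _)⟩
  have hspan : ∀ (J : NzI K) (ε : (𝓞 K)ˣ), spanSingleton (𝓞 K)⁰ (((ε : 𝓞 K) : K) * α J) =
      (U J).1 * (I (k J)).1 := by
    intro J ε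
    rw [← hα]
    exact FractionalIdeal.spanSingleton_eq_spanSingleton.mpr ⟨ε⁻¹, by
      rw [Units.smul_def, Algebra.smul_def, ← mul_assoc, ← map_mul]; simp⟩
  have hinj : Function.Injective e := by
    rintro ⟨J, ε⟩ ⟨J', ε'⟩ h
    have hkk : k J = k J' := congrArg Sigma.fst h
    have hv : ((ε : 𝓞 K) : K) * α J = ((ε' : 𝓞 K) : K) * α J' :=
      congrArg (fun x : Σ κ, {a : K // a ∈ (I κ).1 ∧ a ≠ 0} => x.2.1) h
    have h2 : (U J).1 * (I (k J)).1 = (U J').1 * (I (k J')).1 := by rw [← hspan J ε, hv, hspan]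
    rw [hkk] at h2
    have h3 : U J = U J' := ext (mul_right_cancel₀ (I (k J')).ne_zero h2)
    have h4 : J = J' := Subtype.ext (FractionalIdeal.coeIdeal_injective (congrArg Units.val h3))
    subst h4
    have := mul_right_cancel₀ (hα0 J) hv
    have h5 : ε = ε' := ext (FaithfulSMul.algebraMap_injective (𝓞 K) K this)
    rw [h5]
  have hsurj : Function.Surjective e := by
    rintro ⟨κ, a, ha, ha0⟩
    have hs0 : spanSingleton (𝓞 K)⁰ a ≠ 0 := FractionalIdeal.spanSingleton_ne_zero_iff.mpr ha0
    have hle : spanSingleton (𝓞 K)⁰ a * (I κ)⁻¹.1 ≤ 1 := by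
      calc _ ≤ (I κ).1 * (I κ)⁻¹.1 := mul_le_mul_left ((FractionalIdeal.spanSingleton_le_iff_mem).mpr ha) _
        _ = 1 := Units.mul_inv _
    obtain ⟨J, hJ⟩ := FractionalIdeal.le_one_iff_exists_coeIdeal.mp hle
    have hJ0 : J ≠ ⊥ := by
      rw [← FractionalIdeal.coeIdeal_ne_zero (K := K), hJ]
      exact mul_ne_zero hs0 (Units.ne_zero _)
    have hJI : (U ⟨J, hJ0⟩).1 * (I κ).1 = spanSingleton (𝓞 K)⁰ a := by
      simp [*]
    have hκ : k ⟨J, hJ0⟩ = κ := by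
      apply hI.1
      simp only
      rw [hk, inv_eq_iff_mul_eq_one, ← map_mul, ClassGroup.mk_eq_one_iff, val_mul, hJI,
        FractionalIdeal.coe_spanSingleton]
      exact ⟨a, rfl⟩
    subst hκ
    rw [← hα] at hJI
    obtain ⟨z, hz⟩ := FractionalIdeal.spanSingleton_eq_spanSingleton.mp hJI
    refine ⟨(⟨J, hJ0⟩, z), ?_⟩
    simp only [e]
    congr 2
  rw [← ENNReal.tsum_sigma, ← ENNReal.tsum_prod]
  exact ((Equiv.ofBijective e ⟨hinj, hsurj⟩).tsum_eq (fun p : Σ κ, {a : K // a ∈ (I κ).1 ∧ a ≠ 0} => G p.1 p.2)).symm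
lemma dual_family (I : ClassGroup (𝓞 K) → FrI K)
    (hI : Bijective fun κ => mk K (I κ)) :
    Bijective fun κ => mk K (dualU (I κ)) := by
  have : ∀ J : FrI K, dualU J = dualU 1 * J⁻¹ := by
    intro J
    apply ext
    rw [val_mul, Units.val_inv_eq_inv_val]
    exact FractionalIdeal.dual_eq_mul_inv ℤ ℚ J.1
  have h2 : (fun κ => mk K (dualU (I κ))) = fun κ => mk K (dualU 1) * (mk K (I κ))⁻¹ := by
    grind
  rw [h2]
  exact (Equiv.mulLeft (mk K (dualU 1))).bijective.comp ((Equiv.inv _).bijective.comp hI)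
lemma exists_family : ∃ I : ClassGroup (𝓞 K) → FrI K,
    Bijective fun κ => mk K (I κ) := by
  have h : Function.Surjective (mk K : FrI K → ClassGroup (𝓞 K)) := by
    intro x
    exact ClassGroup.induction (P := fun x => ∃ a, mk K a = x) K (fun I => ⟨I, rfl⟩) x
  refine ⟨Function.surjInv h, ?_⟩
  have : (fun κ => mk K (Function.surjInv h κ)) = id := funext fun κ => Function.surjInv_eq h κ
  rw [this]
  exact Function.bijective_id
end
end
section
open MeasureTheory Real NumberField Module NumberField.Units NumberField.Units.dirichletUnitTheorem
open scoped nonZeroDivisors Classical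
section
open Set (univ)
section
variable {K : Type*} [Field K] [NumberField K]
def zx (z : logSpace K) (w : InfinitePlace K) : ℝ :=
  if h : w = w₀ then - ∑ v, z v else z ⟨w, h⟩
def Lam (u : ℝ) (z : logSpace K) (w : InfinitePlace K) : ℝ := u + 2 * zx z w / w.mult
lemma mult_pos' (w : InfinitePlace K) : (0:ℝ) < w.mult := by exact_mod_cast InfinitePlace.mult_pos
lemma sum_zx (z : logSpace K) : ∑ w, zx z w = 0 := by
  rw [Fintype.sum_eq_add_sum_subtype_ne _ (w₀ : InfinitePlace K)]
  have : ∀ i : {w : InfinitePlace K // w ≠ w₀}, zx z i.1 = z i := fun i => by simp [zx, i.2]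
  simp only [this]
  simp [zx]
lemma sum_Lam (u : ℝ) (z : logSpace K) : ∑ w, (w.mult : ℝ) * Lam u z w = dg K * u := by
  have : ∀ w : InfinitePlace K, (w.mult : ℝ) * Lam u z w = w.mult * u + 2 * zx z w := fun w => by
    simp only [Lam]; field_simp
  simp_rw [this, Finset.sum_add_distrib, ← Finset.mul_sum, sum_zx, ← Finset.sum_mul]
  rw [← InfinitePlace.sum_mult_eq]; push_cast; ring
lemma zx_add (z z' : logSpace K) (w) : zx (z + z') w = zx z w + zx z' w := by
  unfold zx; split_ifs
  · simp [Finset.sum_add_distrib]; ring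
  · simp
lemma zx_smul (c : ℝ) (z : logSpace K) (w) : zx (c • z) w = c * zx z w := by
  unfold zx; split_ifs
  · simp [Finset.mul_sum]
  · simp
lemma zx_neg (z : logSpace K) (w) : zx (-z) w = - zx z w := by
  rw [← neg_one_smul ℝ z, zx_smul]; ring
lemma Lam_neg (u : ℝ) (z : logSpace K) (w) : Lam (-u) (-z) w = - Lam u z w := by
  simp only [Lam, zx_neg]; ring
lemma zx_log (ε : (𝓞 K)ˣ) (w : InfinitePlace K) :
    zx (logEmbedding K (Additive.ofMul ε)) w = w.mult * log (w (ε : K)) := by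
  unfold zx
  split_ifs with h
  · subst h
    have := sum_logEmbedding_component (K := K) ε
    rw [neg_eq_iff_eq_neg, ← neg_mul, ← this]
  · rfl
lemma Lam_unit (u : ℝ) (z : logSpace K) (ε : (𝓞 K)ˣ) (w : InfinitePlace K) :
    exp (Lam u (logEmbedding K (Additive.ofMul ε) + z) w) = exp (Lam u z w) * (w (ε : K)) ^ 2 := by
  have hp : 0 < w (ε : K) := InfinitePlace.pos_iff.mpr (by simp)
  have h : Lam u (logEmbedding K (Additive.ofMul ε) + z) w = Lam u z w + log (w (ε:K) ^ 2) := by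
    simp only [Lam, zx_add, zx_log, log_pow]; field_simp; ring
  rw [h, exp_add, exp_log bp]
lemma zx_cont (w : InfinitePlace K) : Continuous fun z : logSpace K => zx z w := by
  unfold zx; split_ifs
  · fun_prop
  · fun_prop
variable (K) in
lemma haar_Lam : ∃ κ : ENNReal, κ ≠ 0 ∧ κ ≠ ⊤ ∧ ∀ Φ : (InfinitePlace K → ℝ) → ENNReal, Measurable Φ →
    ∫⁻ u : ℝ, ∫⁻ z : logSpace K, Φ (Lam u z) = κ * ∫⁻ x, Φ x := by
  let A0 : (ℝ × logSpace K) →ₗ[ℝ] (InfinitePlace K → ℝ) :=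
    { toFun := fun p => Lam p.1 p.2
      map_add' := fun p q => by funext w; simp only [Lam, Prod.fst_add, Prod.snd_add, zx_add, Pi.add_apply]; ring
      map_smul' := fun c p => by
        funext w; simp only [Lam, Prod.smul_fst, Prod.smul_snd, zx_smul, Pi.smul_apply, smul_eq_mul, RingHom.id_apply]; ring }
  have hinj : Function.Injective A0 := by
    rw [injective_iff_map_eq_zero]
    rintro ⟨u, z⟩ h
    have h1 : ∀ w, Lam u z w = 0 := fun w => congrFun h w
    have h2 := sum_Lam u z
    simp only [h1, mul_zero, Finset.sum_const_zero] at h2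
    have hu : u = 0 := by
      rcases mul_eq_zero.mp h2.symm with h | h
      · exact absurd h (by exact_mod_cast (finrank_pos (R := ℚ) (M := K)).ne')
      · exact h
    ext
    · exact hu
    · rename_i v
      have h3 := h1 v.1
      have := (mult_pos' v.1).ne'
      simp only [Lam, hu, zx, v.2, dif_neg, not_false_eq_true, zero_add] at h3
      simp only [Prod.snd_zero, Pi.zero_apply]
      rcases div_eq_zero_iff.mp h3 with h | h
      · linarith
      · exact absurd h this
  have hdim : finrank ℝ (ℝ × logSpace K) = finrank ℝ (InfinitePlace K → ℝ) := by
    rw [finrank_prod, finrank_self, finrank_fintype_fun_eq_card, finrank_fintype_fun_eq_card,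
      Fintype.card_subtype_compl, Fintype.card_subtype_eq]
    have : 0 < Fintype.card (InfinitePlace K) := Fintype.card_pos
    omega
  let A : (ℝ × logSpace K) ≃L[ℝ] (InfinitePlace K → ℝ) :=
    (LinearEquiv.ofInjectiveOfFinrankEq A0 hinj hdim).toContinuousLinearEquiv
  have hA : ∀ p, A p = Lam p.1 p.2 := fun p => rfl
  have hAm : Measurable A := A.continuous.measurable
  haveI : (Measure.map A (volume : Measure (ℝ × logSpace K))).IsAddHaarMeasure := by
    have : (volume : Measure (ℝ × logSpace K)).IsAddHaarMeasure := Measure.prod.instIsAddHaarMeasure _ _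
    exact A.isAddHaarMeasure_map _
  have hs := Measure.isAddLeftInvariant_eq_smul (Measure.map A (volume : Measure (ℝ × logSpace K))) volume
  set c := Measure.addHaarScalarFactor (Measure.map A (volume : Measure (ℝ × logSpace K))) volume with hc
  refine ⟨c, ?_, ENNReal.coe_ne_top, ?_⟩
  · have := Measure.addHaarScalarFactor_pos_of_isAddHaarMeasure (Measure.map A (volume : Measure (ℝ × logSpace K))) volume
    exact_mod_cast this.ne'
  · intro Φ hΦ
    calc _ = ∫⁻ p : ℝ × logSpace K, Φ (A p) := by
          rw [Measure.volume_eq_prod, lintegral_prod]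
          · rfl
          · exact (hΦ.comp hAm).aemeasurable
      _ = ∫⁻ x, Φ x ∂(Measure.map A volume) := (lintegral_map hΦ hAm).symm
      _ = _ := by rw [hs, lintegral_smul_measure]; rfl
lemma lint_prod {ι : Type*} [Fintype ι] (f : ι → ℝ → ℝ) (h0 : ∀ i x, 0 ≤ f i x)
    (hi : ∀ i, Integrable (f i)) :
    ∫⁻ x : ι → ℝ, ENNReal.ofReal (∏ i, f i (x i)) = ENNReal.ofReal (∏ i, ∫ x, f i x) := by
  rw [← ofReal_integral_eq_lintegral_ofReal]
  · rw [integral_fintype_prod_volume_eq_prod]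
  · exact Integrable.fintype_prod hi
  · exact Filter.Eventually.of_forall fun x => Finset.prod_nonneg fun i _ => h0 i _
lemma gamma_log (p q : ℝ) (hp : 0 < p) (hq : 0 < q) :
    Integrable (fun x : ℝ => exp (p * x - q * exp x)) ∧
      ∫ x : ℝ, exp (p * x - q * exp x) = (1 / q) ^ p * Gamma p := by
  have h1 : IntegrableOn (fun t : ℝ => t ^ (p - 1) * exp (-(q * t))) (Set.Ioi 0) := by
    have := integrableOn_rpow_mul_exp_neg_mul_rpow (p := 1) (s := p - 1) (b := q) bl bn hq
    simpa using this
  have hr : exp '' univ = Set.Ioi 0 := by rw [Set.image_univ, range_exp]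
  have hd : ∀ x ∈ (univ : Set ℝ), HasDerivWithinAt exp (exp x) univ x :=
    fun x _ => (hasDerivAt_exp x).hasDerivWithinAt
  have he : ∀ x : ℝ, |exp x| • ((exp x) ^ (p - 1) * exp (-(q * exp x))) = exp (p * x - q * exp x) := by
    intro x
    rw [abs_of_pos (exp_pos x), smul_eq_mul, ← exp_mul, ← exp_add, ← exp_add]
    ring_nf
  constructor
  · rw [← hr, integrableOn_image_iff_integrableOn_abs_deriv_smul MeasurableSet.univ hd exp_injective.injOn] at h1
    simp only [he] at h1
    simpa using h1
  · have h2 := integral_image_eq_integral_abs_deriv_smul MeasurableSet.univ hd exp_injective.injOn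
      (fun t : ℝ => t ^ (p - 1) * exp (-(q * t)))
    simp only [he, hr] at h2
    rw [integral_rpow_mul_exp_neg_mul_Ioi hp hq] at h2
    rw [h2]; simp
end
end
section
open Algebra (norm)
open ENNReal (ofReal ofReal_mul)
open Finset (mul_sum sum_add_distrib sum_congr)
open FractionalIdeal (absNorm)
open Ideal (absNorm absNorm_eq_zero_iff)
open Int (natAbs_pos)
open Nat (card)
section
variable {K : Type*} [Field K] [NumberField K]
instance : Countable (NzI K) := by
  have h : (⋃ n : ℕ, {J : Ideal (𝓞 K) | absNorm J = n ∧ J ≠ ⊥}).Countable := by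
    refine Set.countable_iUnion fun n => ?_
    rcases Nat.eq_zero_or_pos n with rfl | hn
    · convert! Set.countable_empty
      ext J; simp only [Set.mem_setOf_eq, Set.mem_empty_iff_false, iff_false, not_and, not_not]
      exact absNorm_eq_zero_iff.mp
    · exact ((Ideal.finite_setOf_absNorm_eq n).subset fun J hJ => hJ.1).countable
  refine (h.mono ?_ : {J : Ideal (𝓞 K) | J ≠ ⊥}.Countable).to_subtype
  intro J hJ
  exact Set.mem_iUnion.mpr ⟨_, rfl, hJ⟩
def kern (μ u : ℝ) (z : logSpace K) (a : K) : ℝ :=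
  exp (-π * Qf (fun w => μ * exp (Lam u z w)) a)
def muI (I : FrI K) : ℝ :=
  (((absNorm I.1 : ℚ) : ℝ) ^ 2 * (discr K).natAbs) ^ (-1 / (dg K : ℝ))
variable (K) in
def Gam (s : ℝ) : ℝ :=
  ∏ w : InfinitePlace K, (1 / (π * w.mult)) ^ (w.mult * s / 2) * Gamma (w.mult * s / 2)
lemma kern_cont (μ : ℝ) (a : K) : Continuous fun p : ℝ × logSpace K => kern μ p.1 p.2 a := by
  unfold kern Qf Lam
  have := fun w => zx_cont (K := K) w
  fun_prop
lemma kern_unit (μ u : ℝ) (z : logSpace K) (a : K) (ε : (𝓞 K)ˣ) :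
    kern μ u z (((ε : 𝓞 K) : K) * a) = kern μ u (logEmbedding K (Additive.ofMul ε) + z) a := by
  unfold kern Qf
  simp only [Lam_unit, map_mul]
  congr 2
  refine sum_congr rfl fun w _ => ?_
  ring
lemma unit_unfold (D : Set (logSpace K)) (hD : IsAddFundamentalDomain (unitLattice K) D volume)
    (g : logSpace K → ENNReal) :
    ∑' ε : (𝓞 K)ˣ, ∫⁻ z in D, g (logEmbedding K (Additive.ofMul ε) + z) =
      (card (torsion K) : ENNReal) * ∫⁻ z, g z := by
  have hmem : ∀ ε : (𝓞 K)ˣ, logEmbedding K (Additive.ofMul ε) ∈ unitLattice K := fun ε =>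
    ⟨Additive.ofMul ε, trivial, rfl⟩
  let φ : (𝓞 K)ˣ → unitLattice K := fun ε => ⟨_, hmem ε⟩
  have h1 : ∫⁻ z, g z = ∑' l : unitLattice K, ∫⁻ z in D, g ((l : logSpace K) + z) := by
    haveI : VAddInvariantMeasure (unitLattice K) (logSpace K) volume :=
      inferInstanceAs (VAddInvariantMeasure (unitLattice K).toAddSubgroup (logSpace K) volume)
    haveI : MeasurableConstVAdd (unitLattice K) (logSpace K) :=
      inferInstanceAs (MeasurableConstVAdd (unitLattice K).toAddSubgroup (logSpace K))
    exact hD.lintegral_eq_tsum'' g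
  rw [h1, ← (Equiv.sigmaFiberEquiv φ).tsum_eq, ENNReal.tsum_sigma', ← ENNReal.tsum_mul_left]
  congr 1; funext l
  have h2 : ∀ x : {ε // φ ε = l}, (∫⁻ z in D, g (logEmbedding K (Additive.ofMul ((Equiv.sigmaFiberEquiv φ) ⟨l, x⟩)) + z)) =
      ∫⁻ z in D, g ((l : logSpace K) + z) := by
    rintro ⟨ε, rfl⟩; rfl
  simp_rw [h2]
  rw [ENNReal.tsum_const]
  congr 1
  obtain ⟨ε0, hε0⟩ : ∃ ε, φ ε = l := by
    obtain ⟨x, -, hx⟩ := l.2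
    exact ⟨x.toMul, Subtype.ext hx⟩
  have key : ∀ ε, φ ε = l ↔ ε0⁻¹ * ε ∈ torsion K := by
    intro ε
    rw [← logEmbedding_eq_zero_iff, ← hε0, ofMul_mul, ofMul_inv, map_add, map_neg, Subtype.ext_iff]
    rw [neg_add_eq_zero, eq_comm]
  let e : {ε // φ ε = l} ≃ torsion K :=
    { toFun := fun x => ⟨ε0⁻¹ * x.1, (key _).1 x.2⟩
      invFun := fun y => ⟨ε0 * y.1, (key _).2 (by simp)⟩
      left_inv := fun x => by simp
      right_inv := fun y => by simp }
  rw [ENat.card_congr e, ENat.card_eq_coe_natCard]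
  rfl
def Fu (I : ClassGroup (𝓞 K) → FrI K) (D : Set (logSpace K)) (u : ℝ) : ENNReal :=
  ∑' κ, ∑' a : {a : K // a ∈ (I κ).1 ∧ a ≠ 0}, ∫⁻ z in D, ofReal (kern (muI (I κ)) u z a)
lemma muI_pos (I : FrI K) : 0 < muI I := by
  unfold muI
  have h1 : (0:ℚ) < absNorm I.1 := lt_of_le_of_ne (FractionalIdeal.absNorm_nonneg _)
    (Ne.symm (FractionalIdeal.absNorm_eq_zero_iff.not.mpr I.ne_zero))
  have h2 : 0 < (discr K).natAbs := natAbs_pos.mpr (discr_ne_zero K)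
  positivity
lemma kern_int (c : ENNReal) (hc : ∀ Φ : (InfinitePlace K → ℝ) → ENNReal, Measurable Φ →
    ∫⁻ u : ℝ, ∫⁻ z : logSpace K, Φ (Lam u z) = c * ∫⁻ x, Φ x) (μ : ℝ) (hμ : 0 < μ) (a : K) (ha : a ≠ 0)
    (s : ℝ) (hs : 0 < s) :
    ∫⁻ u : ℝ, ∫⁻ z : logSpace K, ofReal (exp (dg K * s / 2 * u)) * ofReal (kern μ u z a) =
      c * ofReal (Gam K s * exp (-(s / 2) * (dg K * log μ + 2 * log |(norm ℚ a : ℝ)|))) := by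
  set cw : InfinitePlace K → ℝ := fun w => log μ + 2 * log (w a) with hcw
  have hwa : ∀ w : InfinitePlace K, 0 < w a := fun w => InfinitePlace.pos_iff.mpr ha
  have hsum : ∑ w : InfinitePlace K, (w.mult : ℝ) * cw w = dg K * log μ + 2 * log |(norm ℚ a : ℝ)| := by
    have h1 := InfinitePlace.prod_eq_abs_norm a
    have h2 : log |(norm ℚ a : ℝ)| = ∑ w : InfinitePlace K, (w.mult : ℝ) * log (w a) := by
      rw [← Rat.cast_abs, ← h1, log_prod (fun w _ => (pow_pos (hwa w) _).ne')]
      simp [log_pow]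
    rw [h2]
    simp only [hcw, mul_add, sum_add_distrib, ← Finset.sum_mul]
    rw [← InfinitePlace.sum_mult_eq, mul_sum]
    push_cast
    congr 1
    refine sum_congr rfl fun w _ => by ring
  set f : InfinitePlace K → ℝ → ℝ := fun w x => exp (w.mult * s / 2 * (x + cw w) - π * w.mult * exp (x + cw w)) with hf
  have hgl := fun w : InfinitePlace K => gamma_log (w.mult * s / 2) (π * w.mult)
    (by have := mult_pos' w; positivity) (by have := mult_pos' w; positivity)
  have e1 : ∀ u (z : logSpace K), ofReal (exp (dg K * s / 2 * u)) * ofReal (kern μ u z a) =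
      ofReal (exp (-(s / 2) * ∑ w : InfinitePlace K, (w.mult : ℝ) * cw w)) * ofReal (∏ w, f w (Lam u z w)) := by
    intro u z
    rw [← ofReal_mul (exp_pos _).le, ← ofReal_mul (exp_pos _).le]
    congr 1
    rw [hf, ← exp_sum, kern, ← exp_add, ← exp_add]
    congr 1
    have h3 : dg K * s / 2 * u = s / 2 * (dg K * u) := by ring
    rw [h3, ← sum_Lam u z, Qf, mul_sum, mul_sum, mul_sum, ← sum_add_distrib, ← sum_add_distrib]
    refine sum_congr rfl fun w _ => ?_
    have h4 : exp (Lam u z w + cw w) = μ * exp (Lam u z w) * (w a) ^ 2 := by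
      rw [exp_add, hcw]
      simp only
      rw [exp_add, exp_log hμ, mul_comm 2, exp_mul, exp_log (hwa w)]
      norm_cast; ring
    rw [h4]; ring
  simp_rw [e1]
  rw [hc (fun x => ofReal (exp (-(s / 2) * ∑ w : InfinitePlace K, (w.mult : ℝ) * cw w)) * ofReal (∏ w, f w (x w)))]
  · rw [lintegral_const_mul, lint_prod]
    · have : ∀ w, ∫ x, f w x = (1 / (π * w.mult)) ^ (w.mult * s / 2) * Gamma (w.mult * s / 2) := by
        intro w
        rw [← (hgl w).2]
        exact integral_add_right_eq_self (fun x => exp (w.mult * s / 2 * x - π * w.mult * exp x)) (cw w)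
      simp_rw [this]
      rw [← ofReal_mul (exp_pos _).le, hsum, mul_comm (Gam K s), Gam]
    · exact fun _ _ => (exp_pos _).le
    · exact fun w => (hgl w).1.comp_add_right (cw w)
    · fun_prop
  · fun_prop
lemma Fu_eq (I : ClassGroup (𝓞 K) → FrI K)
    (hI : Function.Bijective fun κ => ClassGroup.mk K (I κ)) :
    ∃ (μ : NzI K → ℝ) (α : NzI K → K), (∀ J, 0 < μ J) ∧ (∀ J, α J ≠ 0) ∧
      (∀ J, dg K * log (μ J) + 2 * log |(norm ℚ (α J) : ℝ)| =
        2 * log (absNorm J.1) - log (discr K).natAbs) ∧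
      ∀ D, IsAddFundamentalDomain (unitLattice K) D volume → ∀ u,
        Fu I D u = ∑' J, (card (torsion K) : ENNReal) * ∫⁻ z, ofReal (kern (μ J) u z (α J)) := by
  obtain ⟨k, α, h0, hN, hG⟩ := classify I hI
  refine ⟨fun J => muI (I (k J)), α, fun J => muI_pos _, h0, ?_, ?_⟩
  · intro J
    have h1 : (0:ℝ) < ((absNorm (I (k J)).1 : ℚ) : ℝ) := by
      exact_mod_cast lt_of_le_of_ne (FractionalIdeal.absNorm_nonneg _)
        (Ne.symm (FractionalIdeal.absNorm_eq_zero_iff.not.mpr (I (k J)).ne_zero))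
    have h2 : 0 < dsc K := by exact_mod_cast natAbs_pos.mpr (discr_ne_zero K)
    have h3 : (0:ℝ) < absNorm J.1 := by
      exact_mod_cast Nat.pos_of_ne_zero (absNorm_eq_zero_iff.not.mpr J.2)
    have h4 : (0:ℝ) < dg K := by exact_mod_cast finrank_pos
    simp only [muI]
    rw [← Rat.cast_abs, hN, log_rpow bp, Rat.cast_mul, Rat.cast_natCast,
      log_mul bp bp, log_mul bp bp, log_pow]
    field_simp
    push_cast
    ring
  · intro D hD u
    rw [Fu, hG fun κ a => ∫⁻ z in D, ofReal (kern (muI (I κ)) u z a)]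
    congr 1; funext J
    simp_rw [kern_unit]
    exact unit_unfold D hD fun z => ofReal (kern (muI (I (k J))) u z (α J))
lemma Fu_mellin (I : ClassGroup (𝓞 K) → FrI K)
    (hI : Function.Bijective fun κ => ClassGroup.mk K (I κ))
    (D) (hD : IsAddFundamentalDomain (unitLattice K) D volume)
    (c : ENNReal) (hc : ∀ Φ : (InfinitePlace K → ℝ) → ENNReal, Measurable Φ →
    ∫⁻ u : ℝ, ∫⁻ z : logSpace K, Φ (Lam u z) = c * ∫⁻ x, Φ x) (s : ℝ) (hs : 0 < s) :
    ∫⁻ u : ℝ, ofReal (exp (dg K * s / 2 * u)) * Fu I D u =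
      (card (torsion K) : ENNReal) * c * ofReal (Gam K s * dsc K ^ (s / 2)) *
        ∑' J : NzI K, ofReal ((absNorm J.1 : ℝ) ^ (-s)) := by
  obtain ⟨μ, α, hμ, hα, hN, hF⟩ := Fu_eq I hI
  have hm : ∀ J : NzI K, Measurable fun u : ℝ => ∫⁻ z, ofReal (kern (μ J) u z (α J)) := fun J =>
    Measurable.lintegral_prod_right' (f := fun p : ℝ × logSpace K => ofReal (kern (μ J) p.1 p.2 (α J)))
      (kern_cont _ _).measurable.ennreal_ofReal
  simp_rw [hF D hD, ← ENNReal.tsum_mul_left]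
  rw [lintegral_tsum]
  · congr 1; funext J
    have h1 : ∀ u : ℝ, ofReal (exp (dg K * s / 2 * u)) * ((card (torsion K) : ENNReal) *
        ∫⁻ z, ofReal (kern (μ J) u z (α J))) = (card (torsion K) : ENNReal) *
        ∫⁻ z, ofReal (exp (dg K * s / 2 * u)) * ofReal (kern (μ J) u z (α J)) := by
      intro u
      rw [lintegral_const_mul']
      · ring
      · exact ENNReal.ofReal_ne_top
    simp_rw [h1]
    rw [lintegral_const_mul, kern_int c hc _ (hμ J) _ (hα J) s hs, hN, mul_assoc, mul_assoc]
    · have h2 : 0 < dsc K := by exact_mod_cast natAbs_pos.mpr (discr_ne_zero K)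
      have h3 : (0:ℝ) < absNorm J.1 := by
        exact_mod_cast Nat.pos_of_ne_zero (absNorm_eq_zero_iff.not.mpr J.2)
      rw [← ENNReal.ofReal_mul']
      · congr 3
        rw [mul_assoc]
        congr 1
        rw [rpow_def_of_pos h2, rpow_def_of_pos h3, ← exp_add]
        ring_nf
      · positivity
    · exact Measurable.lintegral_prod_right' (f := fun p : ℝ × logSpace K => ofReal (exp (dg K * s / 2 * p.1)) * ofReal (kern (μ J) p.1 p.2 (α J)))
        (by
          have := (kern_cont (μ J) (α J)).measurable
          fun_prop)
  · intro J
    have := hm J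
    fun_prop
end
end
section
open ENNReal (ofReal)
open FractionalIdeal (absNorm)
section
variable {K : Type*} [Field K] [NumberField K]
lemma tsum_split (S : Set K) (h0 : (0:K) ∈ S) (f : K → ENNReal) :
    ∑' a : S, f a = ∑' a : {a : K // a ∈ S ∧ a ≠ 0}, f a + f 0 := by
  have h1 : S = {a : K | a ∈ S ∧ a ≠ 0} ∪ {0} := by
    grind
  have h2 : Disjoint {a : K | a ∈ S ∧ a ≠ 0} {0} := by simp
  have h3 := ENNReal.summable.tsum_union_disjoint (f := f) h2 ENNReal.summable
  rw [← h1] at h3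
  rw [h3, tsum_singleton]
  rfl
lemma muI_pow (I : FrI K) :
    ((absNorm I.1 : ℚ) : ℝ) ^ 2 * (discr K).natAbs * (muI I) ^ (dg K) = 1 := by
  have h1 : (0:ℝ) < ((absNorm I.1 : ℚ) : ℝ) := by
    exact_mod_cast lt_of_le_of_ne (FractionalIdeal.absNorm_nonneg _)
      (Ne.symm (FractionalIdeal.absNorm_eq_zero_iff.not.mpr I.ne_zero))
  have h2 : 0 < dsc K := by exact_mod_cast Int.natAbs_pos.mpr (discr_ne_zero K)
  have h4 : (dg K : ℝ) ≠ 0 := by exact_mod_cast (finrank_pos (R := ℚ) (M := K)).ne'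
  rw [muI, ← rpow_natCast _ (dg K), ← rpow_mul bp]
  rw [div_mul_cancel₀ _ h4, rpow_neg_one]
  exact mul_inv_cancel₀ bp
lemma muI_dual (I : FrI K) : muI (dualU I) = (muI I)⁻¹ := by
  have h := absNorm_dualU I
  have h' : ((absNorm (dualU I).1 : ℚ) : ℝ) * (((absNorm I.1 : ℚ) : ℝ) * (discr K).natAbs) = 1 := by
    exact_mod_cast h
  rw [muI, muI, ← inv_rpow bp]
  congr 1
  refine eq_inv_of_mul_eq_one_left ?_
  calc _ = (((absNorm (dualU I).1 : ℚ) : ℝ) * (((absNorm I.1 : ℚ) : ℝ) * (discr K).natAbs)) ^ 2 := by ring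
    _ = 1 := by aesop
lemma theta_enn (I : FrI K) (u : ℝ) (z : logSpace K) :
    ∑' a : {a : K // a ∈ I.1 ∧ a ≠ 0}, ofReal (kern (muI I) u z a) + 1 =
      ofReal (exp (-(dg K / 2) * u)) *
        (∑' a : {a : K // a ∈ (dualU I).1 ∧ a ≠ 0}, ofReal (kern (muI (dualU I)) (-u) (-z) a) + 1) := by
  have hk0 : ∀ μ u (z : logSpace K), kern μ u z (0:K) = 1 := by
    simp [kern, Qf]
  have hs : ∀ (J : FrI K) u (z : logSpace K),
      ∑' a : {a : K // a ∈ J.1 ∧ a ≠ 0}, ofReal (kern (muI J) u z a) + 1 =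
      ofReal (∑' a : (J.1 : Set K), kern (muI J) u z a) := by
    intro J u z
    have h1 := (theta_ideal J (fun w => muI J * exp (Lam u z w)) (fun w => mul_pos (muI_pos J) (exp_pos _))).1
    rw [ENNReal.ofReal_tsum_of_nonneg (f := fun a : (J.1 : Set K) => kern (muI J) u z a) (fun a => (exp_pos _).le) h1,
      tsum_split (J.1 : Set K) (FractionalIdeal.zero_mem _) (fun a => ofReal (kern (muI J) u z a)), hk0, ENNReal.ofReal_one]
    rfl
  rw [hs, hs, ← ENNReal.ofReal_mul (exp_pos _).le]
  congr 1
  have h2 := (theta_ideal I (fun w => muI I * exp (Lam u z w)) (fun w => mul_pos (muI_pos I) (exp_pos _))).2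
  have h3 : ∏ w : InfinitePlace K, (muI I * exp (Lam u z w)) ^ w.mult = (muI I) ^ (dg K) * exp (dg K * u) := by
    simp_rw [mul_pow, Finset.prod_mul_distrib, Finset.prod_pow_eq_pow_sum, InfinitePlace.sum_mult_eq, ← exp_nat_mul,
      ← exp_sum, sum_Lam]
  rw [h3, ← mul_assoc, muI_pow, one_mul] at h2
  have h4 : (√(exp (dg K * u)))⁻¹ = exp (-(dg K / 2) * u) := by
    rw [← exp_half, ← exp_neg]
    ring_nf
  rw [h4] at h2
  have h5 : (fun w => muI I * exp (Lam u z w))⁻¹ = fun w => muI (dualU I) * exp (Lam (-u) (-z) w) := by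
    funext w
    rw [Pi.inv_apply, muI_dual, Lam_neg, exp_neg, mul_inv]
  rw [h5] at h2
  exact h2
def Vd (D : Set (logSpace K)) : ENNReal := Nat.card (ClassGroup (𝓞 K)) * volume D
lemma neg_fund (D : Set (logSpace K)) (hD : IsAddFundamentalDomain (unitLattice K) D volume) :
    IsAddFundamentalDomain (unitLattice K) (Neg.neg ⁻¹' D) volume := by
  refine hD.preimage_of_equiv (f := Neg.neg) (e := Neg.neg) (Measure.measurePreserving_neg volume).quasiMeasurePreserving (Equiv.neg _).bijective ?_
  intro g x
  simp only [Submodule.vadd_def, vadd_eq_add, Submodule.coe_neg]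
  abel
lemma Fu_meas (I : FrI K) (u : ℝ) (a : K) (D : Set (logSpace K)) :
    AEMeasurable (fun z => ofReal (kern (muI I) u z a)) (volume.restrict D) :=
  (((kern_cont (muI I) a).comp (by fun_prop : Continuous fun z : logSpace K => (u, z))).measurable.ennreal_ofReal).aemeasurable
lemma Fu_add (I : ClassGroup (𝓞 K) → FrI K) (D) (u : ℝ) :
    Fu I D u + Vd D = ∑' κ, ∫⁻ z in D, (∑' a : {a : K // a ∈ (I κ).1 ∧ a ≠ 0}, ofReal (kern (muI (I κ)) u z a) + 1) := by
  have hcK : Countable K := (finBasis ℚ K).equivFun.toEquiv.injective.countable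
  have : ∀ κ, ∫⁻ z in D, (∑' a : {a : K // a ∈ (I κ).1 ∧ a ≠ 0}, ofReal (kern (muI (I κ)) u z a) + 1) =
      (∑' a : {a : K // a ∈ (I κ).1 ∧ a ≠ 0}, ∫⁻ z in D, ofReal (kern (muI (I κ)) u z a)) + volume D := by
    intro κ
    rw [lintegral_add_right _ measurable_const, lintegral_tsum (fun a => Fu_meas _ _ _ _)]
    simp
  simp_rw [this]
  rw [ENNReal.tsum_add, Fu, Vd]
  rw [ENNReal.tsum_const, ENat.card_eq_coe_natCard]
  rfl
lemma Fu_feq (I : ClassGroup (𝓞 K) → FrI K)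
    (hI : Function.Bijective fun κ => ClassGroup.mk K (I κ)) (D)
    (hD : IsAddFundamentalDomain (unitLattice K) D volume) (u : ℝ) :
    Fu I D u + Vd D = ofReal (exp (-(dg K / 2) * u)) *
      (Fu (fun κ => dualU (I κ)) D (-u) + Vd D) := by
  have hV : Vd D = Vd (Neg.neg ⁻¹' D) := by
    rw [Vd, Vd, Set.neg_preimage, Measure.measure_neg]
  have hF : Fu (fun κ => dualU (I κ)) D (-u) = Fu (fun κ => dualU (I κ)) (Neg.neg ⁻¹' D) (-u) := by
    obtain ⟨μ, α, hμ, hα, hN, hF⟩ := Fu_eq _ (dual_family I hI)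
    rw [hF _ hD, hF _ (neg_fund D hD)]
  rw [Fu_add]
  conv_rhs => rw [hF, hV, Fu_add]
  rw [← ENNReal.tsum_mul_left]
  congr 1; funext κ
  rw [lintegral_congr (fun z => theta_enn (I κ) u z)]
  rw [lintegral_const_mul' _ _ ENNReal.ofReal_ne_top]
  congr 1
  rw [← (Measure.measurePreserving_neg (volume : Measure (logSpace K))).setLIntegral_comp_preimage_emb (MeasurableEquiv.neg _).measurableEmbedding]
  congr 1
  funext a
  rw [neg_neg]
end
end
end
section
open MeasureTheory Real ProbabilityTheory
open ENNReal (ofReal toReal_add toReal_ofReal)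
open Set (Ioi)
section
lemma lint_exp (a : ℝ) (ha : 0 < a) :
    ∫⁻ u in Ioi (0:ℝ), ofReal (exp (-a * u)) = ofReal (1 / a) := by
  rw [← ofReal_integral_eq_lintegral_ofReal (integrableOn_exp_mul_Ioi bl 0)
    (ae_of_all _ fun u => (exp_pos _).le), integral_exp_mul_Ioi bl 0]
  simp
lemma hecke_abs (N : ℝ) (hN : 0 < N) (F G : ℝ → ENNReal) (hFm : Measurable F) (hGm : Measurable G)
    (V : ENNReal) (hV : V ≠ ⊤)
    (hfe : ∀ u, F u + V = ofReal (exp (-(N / 2) * u)) * (G (-u) + V))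
    (M : ℝ → ℝ) (hM0 : ∀ s, 1 < s → 0 ≤ M s)
    (hF : ∀ s, 1 < s → ∫⁻ u, ofReal (exp (N * s / 2 * u)) * F u = ofReal (M s))
    (hG : ∀ s, 1 < s → ∫⁻ u, ofReal (exp (N * s / 2 * u)) * G u = ofReal (M s)) :
    ∃ L : ℂ → ℂ, Differentiable ℂ L ∧
      (∀ s : ℝ, 1 < s → L s = ((M s - 2 * V.toReal / N / (s * (s - 1)) : ℝ) : ℂ)) ∧
      (∀ s : ℂ, -1 ≤ s.re → s.re ≤ 2 → ‖L s‖ ≤ 2 * M 2) ∧ V.toReal ≤ N * M 2 := by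
  set A : (ℝ → ENNReal) → ℝ → ENNReal := fun F s => ∫⁻ u in Ioi (0:ℝ), ofReal (exp (N * s / 2 * u)) * F u with hA
  have hAmono : ∀ F s t, s ≤ t → A F s ≤ A F t := by
    intro F s t hst
    refine setLIntegral_mono' measurableSet_Ioi fun u hu => ?_
    gcongr
    exact (Set.mem_Ioi.mp hu).le
  have hAle : ∀ F : ℝ → ENNReal, (∀ s, 1 < s → ∫⁻ u, ofReal (exp (N * s / 2 * u)) * F u = ofReal (M s)) →
      ∀ s t, 1 < t → s ≤ t → A F s ≤ ofReal (M t) := by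
    intro F hF s t ht hst
    exact ((hAmono F s t hst).trans (setLIntegral_le_lintegral _ _)).trans_eq (hF t ht)
  have hAfin : ∀ F : ℝ → ENNReal, (∀ s, 1 < s → ∫⁻ u, ofReal (exp (N * s / 2 * u)) * F u = ofReal (M s)) →
      ∀ s, A F s ≠ ⊤ := by
    intro F hF s
    exact ne_top_of_le_ne_top ENNReal.ofReal_ne_top (hAle F hF s (max s 2) (by simp) (le_max_left _ _))
  set mu : (ℝ → ENNReal) → Measure ℝ := fun F => (volume.restrict (Ioi 0)).withDensity F with hmu
  have hl : ∀ F : ℝ → ENNReal, Measurable F → ∀ s, ∫⁻ u, ofReal (exp (N * s / 2 * u)) ∂(mu F) = A F s := by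
    intro F hF s
    rw [hmu, lintegral_withDensity_eq_lintegral_mul _ hF bf]
    simp only [hA, Pi.mul_apply, mul_comm]
  have hint : ∀ F : ℝ → ENNReal, Measurable F → (∀ s, A F s ≠ ⊤) → integrableExpSet id (mu F) = Set.univ := by
    intro F hFm hf
    ext t
    simp only [integrableExpSet, Set.mem_setOf_eq, Set.mem_univ, iff_true, id]
    refine ⟨by fun_prop, ?_⟩
    rw [hasFiniteIntegral_iff_ofReal (ae_of_all _ fun u => (exp_pos _).le)]
    have := hl F hFm (t * 2 / N)
    rw [show N * (t * 2 / N) / 2 = t by field_simp] at this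
    rw [this]
    exact (hf _).lt_top
  have hmgf : ∀ F : ℝ → ENNReal, Measurable F → ∀ s, mgf id (mu F) (N * s / 2) = (A F s).toReal := by
    intro F hFm s
    rw [mgf, integral_eq_lintegral_of_nonneg_ae (ae_of_all _ fun u => (exp_pos _).le) bf]
    simp only [id]
    rw [hl F hFm]
  have hdiff : ∀ F : ℝ → ENNReal, Measurable F → (∀ s, A F s ≠ ⊤) → Differentiable ℂ (complexMGF id (mu F)) := by
    intro F hFm hf z
    refine (hasDerivAt_complexMGF ?_).differentiableAt
    rw [hint F hFm hf]; simp
  have key : ∀ s, 1 < s → ofReal (M s) + V * ofReal (1 / (N * s / 2)) =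
      A F s + A G (1 - s) + V * ofReal (1 / (N * (s - 1) / 2)) := by
    intro s hs
    have h1 : ofReal (M s) = A F s + ∫⁻ u in Ioi (0:ℝ), ofReal (exp (-(N * s / 2) * u)) * F (-u) := by
      rw [← hF s hs, ← lintegral_add_compl _ (measurableSet_Ioi (a := (0:ℝ)))]
      congr 1
      have := (Measure.measurePreserving_neg (volume : Measure ℝ)).setLIntegral_comp_preimage (s := Set.Iic (0:ℝ)) measurableSet_Iic (f := fun u => ofReal (exp (N * s / 2 * u)) * F u) bf
      rw [Set.compl_Ioi, ← this]
      simp only [Set.neg_preimage, Set.neg_Iic, neg_zero]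
      rw [setLIntegral_congr (Ioi_ae_eq_Ici (a := (0:ℝ))).symm]
      simp only [mul_neg, neg_mul]
    rw [h1, ← lint_exp (N * s / 2) bp, ← lint_exp (N * (s - 1) / 2) (by nlinarith),
      ← lintegral_const_mul _ bf, ← lintegral_const_mul _ bf, add_assoc, add_assoc,
      ← lintegral_add_right _ bf]
    congr 1
    rw [← lintegral_add_right _ bf]
    refine lintegral_congr fun u => ?_
    have := hfe (-u)
    rw [mul_comm V, mul_comm V, ← mul_add, this, ← mul_assoc, ← ENNReal.ofReal_mul (exp_pos _).le, ← exp_add, mul_add]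
    congr 4 <;> ring_nf
  have keyr : ∀ s, 1 < s → M s + V.toReal * (1 / (N * s / 2)) =
      (A F s).toReal + (A G (1 - s)).toReal + V.toReal * (1 / (N * (s - 1) / 2)) := by
    intro s hs
    have h := congrArg ENNReal.toReal (key s hs)
    rw [toReal_add (by simp) (ENNReal.mul_ne_top hV (by simp)), toReal_add (ENNReal.add_ne_top.mpr ⟨hAfin F hF _, hAfin G hG _⟩) (ENNReal.mul_ne_top hV (by simp)),
      toReal_add (hAfin F hF _) (hAfin G hG _), ENNReal.toReal_mul, ENNReal.toReal_mul, toReal_ofReal (hM0 s hs),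
      toReal_ofReal bp, toReal_ofReal bp] at h
    exact h
  refine ⟨fun s => complexMGF id (mu F) (N * s / 2) + complexMGF id (mu G) (N * (1 - s) / 2), ?_, ?_, ?_, ?_⟩
  · have h1 := hdiff F hFm (hAfin F hF)
    have h2 := hdiff G hGm (hAfin G hG)
    intro s
    exact DifferentiableAt.add (DifferentiableAt.comp (g := complexMGF id (mu F)) (f := fun s : ℂ => (N * s / 2 : ℂ)) s (h1 _) bf)
      (DifferentiableAt.comp (g := complexMGF id (mu G)) (f := fun s : ℂ => (N * (1 - s) / 2 : ℂ)) s (h2 _) bf)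
  · intro s hs
    have h1 := complexMGF_ofReal (X := id) (μ := mu F) (N * s / 2)
    have h2 := complexMGF_ofReal (X := id) (μ := mu G) (N * (1 - s) / 2)
    push_cast at h1 h2
    simp only
    rw [h1, h2, hmgf F hFm, hmgf G hGm, ← Complex.ofReal_add]
    congr 1
    have := keyr s hs
    have h0 : s - 1 ≠ 0 := by linarith
    rw [show 2 * V.toReal / N / (s * (s - 1)) = V.toReal * (1 / (N * (s - 1) / 2)) - V.toReal * (1 / (N * s / 2)) by field_simp; ring]
    linarith
  · intro s hs1 hs2
    refine (norm_add_le _ _).trans ?_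
    have h1 := norm_complexMGF_le_mgf (X := id) (μ := mu F) (z := (N * s / 2 : ℂ))
    have h2 := norm_complexMGF_le_mgf (X := id) (μ := mu G) (z := (N * (1 - s) / 2 : ℂ))
    have e1 : (N * s / 2 : ℂ).re = N * s.re / 2 := by simp
    have e2 : (N * (1 - s) / 2 : ℂ).re = N * (1 - s.re) / 2 := by simp
    rw [e1, hmgf F hFm] at h1
    rw [e2, hmgf G hGm] at h2
    have h3 := ENNReal.toReal_mono (by simp) (hAle F hF s.re 2 bn hs2)
    have h4 := ENNReal.toReal_mono (by simp) (hAle G hG (1 - s.re) 2 bn bl)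
    rw [toReal_ofReal (hM0 2 bn)] at h3 h4
    linarith
  · have := keyr 2 bn
    have h1 : 0 ≤ (A F 2).toReal := ENNReal.toReal_nonneg
    have h2 : 0 ≤ (A G (1 - 2)).toReal := ENNReal.toReal_nonneg
    have h3 : M 2 * N + V.toReal = ((A F 2).toReal + (A G (1 - 2)).toReal) * N + V.toReal * 2 := by
      grind
    nlinarith
end
end
section
open MeasureTheory Real NumberField Module Filter Ideal
open scoped nonZeroDivisors Classical Topology
section
variable (K : Type*) [Field K] [NumberField K]
def aK (n : ℕ) : ℕ := Nat.card {I : Ideal (𝓞 K) // absNorm I = n}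
lemma aK_summable (s : ℂ) (hs : 1 < s.re) : LSeriesSummable (fun n => (aK K n : ℂ)) s := by
  have h : Tendsto (fun n : ℕ => (∑ k ∈ Finset.Icc 1 n, (aK K k : ℝ)) / n) atTop (𝓝 (dedekindZeta_residue K)) := by
    refine ((tendsto_norm_le_div_atTop₀ K).comp tendsto_natCast_atTop_atTop).congr fun n ↦ ?_
    simp only [Function.comp_apply, Nat.cast_le, ← Nat.cast_sum]
    congr
    rw [← add_left_inj 1, ← card_norm_le_eq_card_norm_le_add_one,
      show Finset.Icc 1 n = Finset.Ioc 0 n from Finset.Icc_succ_left_eq_Ioc _ _,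
      show 1 = aK K 0 by simp [aK, absNorm_eq_zero_iff],
      Finset.sum_Ioc_add_eq_sum_Icc (n.zero_le)]
    simp only [aK]
    rw [← Finset.card_preimage_eq_sum_card_image_eq (fun k _ ↦ finite_setOfPred_absNorm_eq k)]
    simp [Set.coe_eq_subtype]
  have h2 := LSeriesSummable_of_sum_norm_bigO_and_nonneg (f := fun n => (aK K n : ℝ)) (r := 1) (s := s) ?_ (fun n => Nat.cast_nonneg _) zero_le_one hs
  · simpa using h2
  · have h3 := h.isBigO_one ℝ
    have h4 := h3.mul (Asymptotics.isBigO_refl (fun n : ℕ => (n:ℝ)) atTop)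
    refine (h4.congr' ?_ ?_)
    · filter_upwards [eventually_gt_atTop 0] with n hn
      field_simp
    · simp
lemma aK_tsum_fiber (n : ℕ) (hn : n ≠ 0) (c : ℂ) :
    HasSum (fun _ : {J : NzI K // absNorm J.1 = n} => c) (aK K n * c) := by
  let e : {J : NzI K // absNorm J.1 = n} ≃ {I : Ideal (𝓞 K) // absNorm I = n} :=
    { toFun := fun J => ⟨J.1.1, J.2⟩
      invFun := fun I => ⟨⟨I.1, fun h => hn (by aesop)⟩, I.2⟩
      left_inv := fun _ => rfl
      right_inv := fun _ => rfl }
  haveI : Finite {I : Ideal (𝓞 K) // absNorm I = n} := finite_setOf_absNorm_eq n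
  haveI : Finite {J : NzI K // absNorm J.1 = n} := Finite.of_equiv _ e.symm
  haveI := Fintype.ofFinite {J : NzI K // absNorm J.1 = n}
  convert! hasSum_fintype _
  rw [Finset.sum_const, Finset.card_univ, ← Nat.card_eq_fintype_card, Nat.card_congr e, nsmul_eq_mul, aK]
lemma zeta_ideal (s : ℂ) (hs : 1 < s.re) :
    Summable (fun J : NzI K => ‖(absNorm J.1 : ℂ) ^ (-s)‖) ∧
    HasSum (fun J : NzI K => (absNorm J.1 : ℂ) ^ (-s)) (dedekindZeta K s) := by
  let e := Equiv.sigmaFiberEquiv (fun J : NzI K => absNorm J.1)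
  have key : ∀ n : ℕ, ∀ φ : ℕ → ℂ, HasSum (fun J : {J : NzI K // absNorm J.1 = n} => φ (absNorm J.1.1)) (if n = 0 then 0 else aK K n * φ n) := by
    intro n φ
    split_ifs with h
    · subst h
      haveI : IsEmpty {J : NzI K // absNorm J.1 = 0} := ⟨fun J => J.1.2 (absNorm_eq_zero_iff.mp J.2)⟩
      exact hasSum_empty
    · refine (aK_tsum_fiber K n h (φ n)).congr_fun ?_
      intro J
      rw [J.2]
  have hS := aK_summable K s hs
  have h1 : Summable (fun J : NzI K => ‖(absNorm J.1 : ℂ) ^ (-s)‖) := by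
    rw [← e.summable_iff]
    have hk : ∀ n : ℕ, HasSum (fun J : {J : NzI K // absNorm J.1 = n} => ‖(absNorm J.1.1 : ℂ) ^ (-s)‖) ‖LSeries.term (fun n => (aK K n : ℂ)) s n‖ := by
      intro n
      have := (key n (fun m => (‖(m : ℂ) ^ (-s)‖ : ℂ)))
      rw [← Complex.hasSum_ofReal]
      convert! this using 1
      rw [LSeries.term_def]
      split_ifs with h
      · simp
      · rw [norm_div, Complex.norm_natCast, Complex.cpow_neg, norm_inv]
        push_cast; rfl
    refine (summable_sigma_of_nonneg (fun _ => norm_nonneg _)).mpr ⟨fun n => (hk n).summable, ?_⟩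
    refine hS.norm.congr fun n => ?_
    exact ((hk n).tsum_eq).symm
  refine ⟨h1, ?_⟩
  rw [← e.hasSum_iff]
  have h2 := (e.summable_iff.mpr h1.of_norm).hasSum
  convert! h2 using 1
  rw [h2.tsum_eq, Summable.tsum_sigma' (fun n => (key n (fun m => (m:ℂ) ^ (-s))).summable) (e.summable_iff.mpr h1.of_norm), dedekindZeta, LSeries]
  refine tsum_congr fun n => ?_
  refine Eq.trans ?_ (key n (fun m => (m:ℂ) ^ (-s))).tsum_eq.symm
  rw [LSeries.term_def]
  split_ifs with h
  · rfl
  · rw [Complex.cpow_neg, div_eq_mul_inv]; rfl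
def zr (s : ℝ) : ℝ := ∑' J : NzI K, (absNorm J.1 : ℝ) ^ (-s)
lemma zr_summable (s : ℝ) (hs : 1 < s) : Summable (fun J : NzI K => (absNorm J.1 : ℝ) ^ (-s)) := by
  refine (zeta_ideal K s (by simpa using hs)).1.congr fun J => ?_
  rw [show (-(s:ℂ)) = ((-s : ℝ) : ℂ) by push_cast; rfl, show ((absNorm J.1 : ℂ)) = ((absNorm J.1 : ℝ) : ℂ) by push_cast; rfl,
    ← Complex.ofReal_cpow bp, Complex.norm_real, norm_of_nonneg bp]
lemma zr_eq (s : ℝ) (hs : 1 < s) : dedekindZeta K s = (zr K s : ℂ) := by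
  rw [← (zeta_ideal K s (by simpa using hs)).2.tsum_eq, zr, Complex.ofReal_tsum]
  refine tsum_congr fun J => ?_
  rw [Complex.ofReal_cpow bp]
  push_cast; rfl
lemma zr_enn (s : ℝ) (hs : 1 < s) : ∑' J : NzI K, ENNReal.ofReal ((absNorm J.1 : ℝ) ^ (-s)) = ENNReal.ofReal (zr K s) :=
  (ENNReal.ofReal_tsum_of_nonneg (fun _ => by positivity) (zr_summable K s hs)).symm
lemma zr_nonneg (s : ℝ) : 0 ≤ zr K s := tsum_nonneg fun _ => by positivity
lemma zeta_diff : DifferentiableOn ℂ (dedekindZeta K) {s | 1 < s.re} := by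
  have h : LSeries.abscissaOfAbsConv (fun n => (aK K n : ℂ)) ≤ 1 := by
    refine LSeries.abscissaOfAbsConv_le_of_forall_lt_LSeriesSummable' fun y hy => aK_summable K y ?_
    exact_mod_cast hy
  refine (LSeries_differentiableOn (fun n => (aK K n : ℂ))).mono fun s hs => ?_
  exact lt_of_le_of_lt h (by exact_mod_cast hs)
end
end
section
open MeasureTheory Real NumberField Module Filter
open scoped nonZeroDivisors Classical Topology
open Complex (I)
section
lemma invGamma_bound : ∃ C : ℝ, 0 < C ∧ ∀ z : ℂ, 1 / 4 ≤ z.re → z.re ≤ 2 → ‖(Complex.Gamma z)⁻¹‖ ≤ Real.exp (C * (1 + ‖z‖)) := by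
  have hc : Continuous fun z : ℂ => (Complex.Gamma z)⁻¹ := Complex.differentiable_one_div_Gamma.continuous
  obtain ⟨C1, hC1⟩ := ((isCompact_Icc (a := (1/4:ℝ)) (b := 2)).reProdIm (isCompact_Icc (a := (-1:ℝ)) (b := 1))).exists_bound_of_continuousOn hc.continuousOn
  have hc2 : ContinuousOn Real.Gamma (Set.Icc 1 3) := fun x hx =>
    (Real.differentiableAt_Gamma fun m => by grind).continuousAt.continuousWithinAt
  obtain ⟨C2, hC2⟩ := isCompact_Icc.exists_bound_of_continuousOn hc2
  refine ⟨|C1| + |C2| + 4, by positivity, fun z h1 h2 => ?_⟩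
  by_cases hz : |z.im| ≤ 1
  · have := hC1 z (by exact ⟨⟨h1, h2⟩, abs_le.mp hz⟩)
    have h3 := add_one_le_exp ((|C1| + |C2| + 4) * (1 + ‖z‖))
    have h4 : C1 ≤ |C1| := le_abs_self _
    have h5 := norm_nonneg z
    nlinarith [abs_nonneg C1, abs_nonneg C2]
  · push Not at hz
    have him : z.im ≠ 0 := by grind
    have hg := Complex.Gamma_mul_Gamma_one_sub z
    have hk : ∀ w : ℂ, w.im ≠ 0 → w ≠ 0 := fun w hw h => hw (by rw [h]; rfl)
    have e1 : Complex.Gamma (1 - z + 1) = (1 - z) * Complex.Gamma (1 - z) := Complex.Gamma_add_one _ (hk _ (by simp [*]))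
    have e2 : Complex.Gamma (1 - z + 1 + 1) = (1 - z + 1) * Complex.Gamma (1 - z + 1) := Complex.Gamma_add_one _ (hk _ (by simp [*]))
    have hG3 : ‖Complex.Gamma (1 - z + 1 + 1)‖ ≤ |C2| := by
      have hre : (1 - z + 1 + 1).re = 3 - z.re := by simp; ring
      have : ‖Complex.Gamma (1 - z + 1 + 1)‖ ≤ Real.Gamma (3 - z.re) := by
        rw [Complex.Gamma_eq_integral bl, Gamma_eq_integral bl, Complex.GammaIntegral]
        refine (norm_integral_le_integral_norm _).trans (le_of_eq ?_)
        refine setIntegral_congr_fun measurableSet_Ioi fun x hx => ?_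
        rw [norm_mul, Complex.norm_cpow_eq_rpow_re_of_pos hx, Complex.norm_real, norm_of_nonneg (exp_pos _).le]
        simp only [Complex.sub_re, hre, Complex.one_re]
      have h3 := hC2 (3 - z.re) ⟨by linarith, by linarith⟩
      exact this.trans ((le_abs_self _).trans (h3.trans (le_abs_self _)))
    have hz1 : Complex.Gamma (1 - z) ≠ 0 := Complex.Gamma_ne_zero fun m hm => by
      have := congrArg Complex.im hm; simp at this; exact him this
    have hz2 : Complex.Gamma z ≠ 0 := Complex.Gamma_ne_zero fun m hm => by
      have := congrArg Complex.im hm; simp at this; exact him this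
    have hs0 : Complex.sin (π * z) ≠ 0 := by
      grind
    have e3 : (Complex.Gamma z)⁻¹ = Complex.Gamma (1 - z) * Complex.sin (π * z) / π := by
      grind
    have hn1 : 1 ≤ ‖1 - z‖ := by
      have := Complex.abs_im_le_norm (1 - z); simp at this; linarith
    have hn2 : 1 ≤ ‖1 - z + 1‖ := by
      have := Complex.abs_im_le_norm (1 - z + 1); simp at this; linarith
    have hG1 : ‖Complex.Gamma (1 - z)‖ ≤ |C2| := by
      rw [e2, e1, norm_mul, norm_mul] at hG3
      refine le_trans ?_ hG3
      calc _ = 1 * (1 * ‖Complex.Gamma (1 - z)‖) := by ring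
        _ ≤ _ := by gcongr
    have hsin : ‖Complex.sin (π * z)‖ ≤ Real.exp (4 * ‖z‖) := by
      rw [Complex.sin]
      have hb : ∀ w : ℂ, ‖w‖ = π * ‖z‖ → ‖Complex.exp w‖ ≤ Real.exp (4 * ‖z‖) := by
        intro w hw
        refine (Complex.norm_exp_le_exp_norm w).trans (exp_le_exp.mpr ?_)
        rw [hw]
        have := pi_le_four
        gcongr
      have h1 := hb (-(π * z) * I) (by simp [abs_of_pos pi_pos])
      have h2 := hb ((π * z) * I) (by simp [abs_of_pos pi_pos])
      have h3 := norm_sub_le (Complex.exp (-(π * z) * I)) (Complex.exp ((π * z) * I))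
      rw [norm_div, norm_mul, Complex.norm_I]
      simp only [Complex.norm_ofNat]
      linarith
    rw [e3, norm_div, norm_mul, Complex.norm_real, norm_of_nonneg pi_pos.le]
    have h6 : |C2| ≤ Real.exp (|C2|) := by have := add_one_le_exp |C2|; linarith
    calc _ ≤ |C2| * Real.exp (4 * ‖z‖) / 1 := by
          gcongr
          linarith [pi_gt_three]
      _ ≤ Real.exp |C2| * Real.exp (4 * ‖z‖) := by rw [div_one]; gcongr
      _ = Real.exp (|C2| + 4 * ‖z‖) := (exp_add _ _).symm
      _ ≤ _ := by
        refine exp_le_exp.mpr ?_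
        nlinarith [abs_nonneg C1, abs_nonneg C2, norm_nonneg z]
end
end
section
open MeasureTheory Real NumberField Module Filter NumberField.Units NumberField.Units.dirichletUnitTheorem
open scoped nonZeroDivisors Classical Topology
open ENNReal (ofReal ofReal_mul)
open Nat (card)
section
variable (K : Type*) [Field K] [NumberField K]
def Rg (s : ℂ) : ℂ :=
  ∏ w : InfinitePlace K, (Complex.Gamma (w.mult * s / 2))⁻¹ * ((π * w.mult : ℝ) : ℂ) ^ (w.mult * s / 2)
lemma Rg_diff : Differentiable ℂ (Rg K) := by
  refine Differentiable.fun_finsetProd fun w _ => ?_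
  refine Differentiable.mul ?_ ?_
  · exact Complex.differentiable_one_div_Gamma.comp (by fun_prop : Differentiable ℂ fun s : ℂ => (w.mult * s / 2 : ℂ))
  · refine Differentiable.const_cpow bf (Or.inl ?_)
    have := mult_pos' w
    exact_mod_cast (by positivity : (π * w.mult : ℝ) ≠ 0)
lemma Rg_zero : Rg K 0 = 0 := by
  have w : InfinitePlace K := Classical.arbitrary _
  refine Finset.prod_eq_zero (Finset.mem_univ w) ?_
  simp
lemma Rg_real (s : ℝ) (hs : 0 < s) : 0 < Gam K s ∧ Rg K s = ((Gam K s)⁻¹ : ℝ) := by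
  constructor
  · refine Finset.prod_pos fun w _ => ?_
    have := mult_pos' w
    have := Gamma_pos_of_pos (show 0 < w.mult * s / 2 by positivity)
    positivity
  · rw [Gam, ← Finset.prod_inv_distrib, Rg]
    push_cast
    refine Finset.prod_congr rfl fun w _ => ?_
    have := mult_pos' w
    rw [show (w.mult * s / 2 : ℂ) = ((w.mult * s / 2 : ℝ) : ℂ) by push_cast; rfl, Complex.Gamma_ofReal,
      ← Complex.ofReal_natCast, ← Complex.ofReal_mul, ← Complex.ofReal_cpow bp]
    rw [one_div, inv_rpow bp]
    push_cast
    rw [mul_inv, inv_inv]; ring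
lemma Gam_two : Gam K 2 ≤ 1 := by
  refine Finset.prod_le_one (fun w _ => ?_) fun w _ => ?_
  · have := mult_pos' w
    have := Gamma_pos_of_pos (show 0 < w.mult * (2:ℝ) / 2 by positivity)
    positivity
  · have h1 := mult_pos' w
    have h2 : Gamma (w.mult * 2 / 2) = 1 := by
      rw [mul_div_cancel_right₀ _ two_ne_zero]
      unfold InfinitePlace.mult
      split_ifs <;> simp
    rw [h2, mul_one]
    refine rpow_le_one bp ?_ bp
    rw [div_le_one bp]
    have : (1:ℝ) ≤ w.mult := by exact_mod_cast h1
    nlinarith [pi_gt_three]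
lemma Rg_bound (C : ℝ) (h0C : 0 < C) (hC : ∀ z : ℂ, 1 / 4 ≤ z.re → z.re ≤ 2 → ‖(Complex.Gamma z)⁻¹‖ ≤ exp (C * (1 + ‖z‖)))
    (s : ℂ) (h1 : 1 / 2 ≤ s.re) (h2 : s.re ≤ 2) : ‖Rg K s‖ ≤ exp ((C + 2) * dg K * (1 + ‖s‖)) := by
  rw [Rg, norm_prod, ← InfinitePlace.sum_mult_eq (K := K)]
  push_cast
  rw [Finset.mul_sum, Finset.sum_mul, exp_sum]
  refine Finset.prod_le_prod (fun _ _ => norm_nonneg _) fun w _ => ?_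
  have h3 : (w.mult : ℝ) = 1 ∨ (w.mult : ℝ) = 2 := by
    unfold InfinitePlace.mult
    split_ifs <;> simp
  have hm1 : (1:ℝ) ≤ w.mult := by rcases h3 with h | h <;> rw [h] <;> norm_num
  have hm2 : (w.mult:ℝ) ≤ 2 := by rcases h3 with h | h <;> rw [h] <;> norm_num
  have hre : ((w.mult : ℂ) * s / 2).re = w.mult * s.re / 2 := by simp
  have hnm : ‖(w.mult : ℂ) * s / 2‖ = w.mult * ‖s‖ / 2 := by simp
  have h4 := hC (w.mult * s / 2) (by rw [hre]; nlinarith) (by rw [hre]; nlinarith)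
  have h5 : ‖((π * w.mult : ℝ) : ℂ) ^ ((w.mult : ℂ) * s / 2)‖ ≤ exp (2 * w.mult) := by
    rw [Complex.norm_cpow_eq_rpow_re_of_pos bp, hre, exp_mul]
    have h6 : π * w.mult ≤ exp 2 := by
      have : (2.7:ℝ) ≤ exp 1 := by linarith [exp_one_gt_d9]
      have e2 : exp 2 = exp 1 * exp 1 := by rw [← exp_add]; norm_num
      nlinarith [pi_lt_d2]
    calc _ ≤ (exp 2) ^ (w.mult * s.re / 2) := rpow_le_rpow bp h6 bp
      _ ≤ _ := rpow_le_rpow_of_exponent_le (one_le_exp bn) (by nlinarith)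
  push_cast at h5
  rw [norm_mul]
  refine (mul_le_mul h4 h5 (norm_nonneg _) (exp_pos _).le).trans ?_
  rw [← exp_add, hnm]
  refine exp_le_exp.mpr ?_
  have h7 := norm_nonneg s
  have h8 : 1 + w.mult * ‖s‖ / 2 ≤ w.mult * (1 + ‖s‖) := by nlinarith
  have h9 := mul_le_mul_of_nonneg_left h8 h0C.le
  nlinarith [mul_nonneg (zero_le_one.trans hm1) h7]
lemma hecke_L : ∃ L : ℂ → ℂ, ∃ V P : ℝ, 0 < P ∧ 0 ≤ V ∧ Differentiable ℂ L ∧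
      (∀ s : ℝ, 1 < s → L s = ((P * Gam K s * dsc K ^ (s / 2) * zr K s - 2 * V / dg K / (s * (s - 1)) : ℝ) : ℂ)) ∧
      (∀ s : ℂ, -1 ≤ s.re → s.re ≤ 2 → ‖L s‖ ≤ 2 * (P * Gam K 2 * dsc K * zr K 2)) ∧
       V ≤ dg K * (P * Gam K 2 * dsc K * zr K 2) := by
  obtain ⟨κ, hκ0, hκ, hc⟩ := haar_Lam K
  obtain ⟨I, hI⟩ := exists_family (K := K)
  have hD := ZLattice.isAddFundamentalDomain (basisUnitLattice K) (volume : Measure (logSpace K))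
  have hDb := ZSpan.fundamentalDomain_isBounded ((basisUnitLattice K).ofZLatticeBasis ℝ (unitLattice K))
  set D := ZSpan.fundamentalDomain ((basisUnitLattice K).ofZLatticeBasis ℝ (unitLattice K))
  have hN : (0:ℝ) < dg K := by exact_mod_cast finrank_pos (R := ℚ) (M := K)
  have hV : Vd D ≠ ⊤ := ENNReal.mul_ne_top (by simp) hDb.measure_lt_top.ne
  have hmeas : ∀ I : ClassGroup (𝓞 K) → FrI K, (Function.Bijective fun κ => ClassGroup.mk K (I κ)) → Measurable (Fu I D) := by
    intro I hI
    obtain ⟨μ, α, hμ, hα, hN, hF⟩ := Fu_eq I hI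
    have : Fu I D = fun u => _ := funext fun u => hF D hD u
    rw [this]
    refine Measurable.ennreal_tsum fun J => Measurable.const_mul ?_ _
    exact Measurable.lintegral_prod_right' (f := fun p : ℝ × logSpace K => ofReal (kern (μ J) p.1 p.2 (α J)))
      (kern_cont _ _).measurable.ennreal_ofReal
  have htor : 0 < card (torsion K) := Nat.card_pos
  set P : ℝ := card (torsion K) * κ.toReal with hP
  have hP0 : 0 < P := mul_pos (by exact_mod_cast htor) (ENNReal.toReal_pos hκ0 hκ)
  have hPe : (card (torsion K) : ENNReal) * κ = ofReal P := by
    rw [hP, ofReal_mul bp, ENNReal.ofReal_natCast, ENNReal.ofReal_toReal hκ]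
  have hmel : ∀ I : ClassGroup (𝓞 K) → FrI K, (Function.Bijective fun κ => ClassGroup.mk K (I κ)) →
      ∀ s, 1 < s → ∫⁻ u, ofReal (exp (dg K * s / 2 * u)) * Fu I D u =
        ofReal (P * Gam K s * dsc K ^ (s / 2) * zr K s) := by
    intro I hI s hs
    have hg := (Rg_real K s bl).1
    rw [Fu_mellin I hI D hD κ hc s bl, zr_enn K s hs, hPe, ← ofReal_mul bp, ← ofReal_mul bp]
    congr 1; ring
  obtain ⟨L, h1, h2, h3, h4⟩ := hecke_abs (dg K) hN (Fu I D) (Fu (fun κ => dualU (I κ)) D) (hmeas I hI)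
    (hmeas _ (dual_family I hI)) (Vd D) hV (Fu_feq I hI D hD) (fun s => P * Gam K s * dsc K ^ (s / 2) * zr K s)
    (fun s hs => by
      have hg := (Rg_real K s bl).1
      have := zr_nonneg K s
      positivity) (hmel I hI) (hmel _ (dual_family I hI))
  simp only [div_self (two_ne_zero' ℝ), rpow_one] at h3 h4
  refine ⟨L, (Vd D).toReal, P, hP0, ENNReal.toReal_nonneg, h1, h2, h3, h4⟩
lemma eq_of_real (f g : ℂ → ℂ) (hf : DifferentiableOn ℂ f {s | 1 < s.re}) (hg : DifferentiableOn ℂ g {s | 1 < s.re})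
    (h : ∀ s : ℝ, 1 < s → f s = g s) : ∀ s : ℂ, 1 < s.re → f s = g s := by
  have ho : IsOpen {s : ℂ | 1 < s.re} := isOpen_lt continuous_const Complex.continuous_re
  have := AnalyticOnNhd.eqOn_of_preconnected_of_frequently_eq (z₀ := (2:ℂ)) (hf.analyticOnNhd ho) (hg.analyticOnNhd ho)
    (convex_halfSpace_re_gt 1).isPreconnected (by simp) ?_
  · exact fun s hs => this hs
  · have h1 : Tendsto (fun x : ℝ => (x : ℂ)) (𝓝[>] 2) (𝓝[≠] (2:ℂ)) := by
      refine tendsto_nhdsWithin_iff.mpr ⟨?_, ?_⟩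
      · exact (Complex.continuous_ofReal.tendsto' 2 2 (by simp)).mono_left nhdsWithin_le_nhds
      · filter_upwards [self_mem_nhdsWithin] with x hx
        simp only [Set.mem_compl_iff, Set.mem_singleton_iff]
        intro h
        have : x = 2 := by exact_mod_cast h
        exact absurd this (ne_of_gt hx)
    refine h1.frequently (Eventually.frequently ?_)
    filter_upwards [self_mem_nhdsWithin] with x hx
    exact h x (by have : (2:ℝ) < x := hx
                  linarith)
end
lemma hecke : ∃ C : ℝ, 0 < C ∧ ∀ (K : Type) [Field K] [NumberField K], ∃ H : ℂ → ℂ, Differentiable ℂ H ∧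
    (∀ s : ℂ, 1 < s.re → H s = (s - 1) * dedekindZeta K s) ∧
    (∀ s : ℂ, 1 / 2 ≤ s.re → s.re ≤ 2 → ‖H s‖ ≤ zr K 2 * (discr K).natAbs * exp (C * dg K * (1 + ‖s‖))) := by
  obtain ⟨C, hC0, hC⟩ := invGamma_bound
  refine ⟨C + 8, by linarith, fun K _ _ => ?_⟩
  obtain ⟨L, V, P, hP, hV0, hLd, hLr, hLb, hV⟩ := hecke_L K
  have hN : (1:ℝ) ≤ dg K := by exact_mod_cast finrank_pos (R := ℚ) (M := K)
  set N : ℝ := (dg K : ℝ)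
  have hd : (1:ℝ) ≤ (discr K).natAbs := by exact_mod_cast Int.natAbs_pos.mpr (discr_ne_zero K)
  set Δ : ℝ := dsc K
  have hΔ : (Δ:ℂ) ≠ 0 := by exact_mod_cast (by linarith : Δ ≠ 0)
  have hRd : Differentiable ℂ (dslope (Rg K) 0) := by
    rw [← differentiableOn_univ]
    exact (Complex.differentiableOn_dslope univ_mem).mpr (Rg_diff K).differentiableOn
  have hRv : ∀ s : ℂ, s ≠ 0 → dslope (Rg K) 0 s = Rg K s / s := by
    intro s hs
    rw [dslope_of_ne _ hs, slope_def_field, Rg_zero, sub_zero, sub_zero]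
  have hHd : Differentiable ℂ (fun s => (s * (s - 1) * L s + 2 * V / N) * dslope (Rg K) 0 s * (Δ:ℂ) ^ (-s / 2) / P) := by
    refine Differentiable.div_const (Differentiable.mul bf ?_) _
    exact Differentiable.const_cpow bf (Or.inl hΔ)
  refine ⟨fun s => (s * (s - 1) * L s + 2 * V / N) * dslope (Rg K) 0 s * (Δ:ℂ) ^ (-s / 2) / P, hHd, ?_, ?_⟩
  · refine eq_of_real _ (fun s => (s - 1) * dedekindZeta K s) hHd.differentiableOn ((by fun_prop : DifferentiableOn ℂ (fun s : ℂ => s - 1) _).mul (zeta_diff K)) fun s hs => ?_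
    have hg := Rg_real K s bl
    have hs0 : (s:ℂ) ≠ 0 := by exact_mod_cast (by linarith : s ≠ 0)
    rw [hLr s hs, hRv _ hs0, hg.2, zr_eq K s hs]
    have e : (Δ:ℂ) ^ (-(s:ℂ) / 2) = ((Δ ^ (-s/2) : ℝ) : ℂ) := by
      rw [Complex.ofReal_cpow bl]; push_cast; rfl
    rw [e]
    norm_cast
    congr 1
    have h1 : s - 1 ≠ 0 := by linarith
    have h2 : s ≠ 0 := by linarith
    have h3 := hg.1.ne'
    have h5 : Δ ^ (s / 2) * Δ ^ (-s/2) = 1 := by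
      rw [← rpow_add bl]; ring_nf; simp
    have h4 : s * (s - 1) * (P * Gam K s * Δ ^ (s / 2) * zr K s - 2 * V / N / (s * (s - 1))) + 2 * V / N = s * (s - 1) * (P * Gam K s * Δ ^ (s / 2) * zr K s) := by
      field_simp; ring
    rw [h4]
    calc _ = (s - 1) * zr K s * (s / s) * (P / P) * (Gam K s * (Gam K s)⁻¹) * (Δ ^ (s / 2) * Δ ^ (-s/2)) := by ring
      _ = _ := by rw [h5, div_self h2, div_self hP.ne', mul_inv_cancel₀ h3]; ring
  · intro s hs1 hs2
    have hs0 : s ≠ 0 := by rintro rfl; simp at hs1; linarith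
    have hns : 1 / 2 ≤ ‖s‖ := hs1.trans (Complex.re_le_norm s)
    have hL := hLb s bl hs2
    have hR := Rg_bound K C hC0 hC s hs1 hs2
    have hg2 := Gam_two K
    have hg2' := (Rg_real K 2 bn).1
    have hz := zr_nonneg K 2
    set M : ℝ := P * Gam K 2 * Δ * zr K 2 with hM
    have hM0 : 0 ≤ M := by positivity
    have hMP : M ≤ P * (zr K 2 * Δ) := by
      have : 0 ≤ P * (zr K 2 * Δ) := by positivity
      calc M = Gam K 2 * (P * (zr K 2 * Δ)) := by rw [hM]; ring
        _ ≤ _ := mul_le_of_le_one_left this hg2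
    have hVN : V / N ≤ M := by rw [div_le_iff₀ bl]; linarith
    have h1 : ‖s * (s - 1) * L s + 2 * V / N‖ ≤ ‖s‖ * (2 * M * (3 + ‖s‖ )) * 2 := by
      have e1 : ‖(2 * V / N : ℂ)‖ = 2 * (V / N) := by
        rw [show (2 * V / N : ℂ) = ((2 * (V / N) : ℝ) : ℂ) by push_cast; ring, Complex.norm_real, norm_of_nonneg bp]
      have e2 : ‖s * (s - 1) * L s‖ ≤ ‖s‖ * (‖s‖ + 1) * (2 * M) := by
        rw [norm_mul, norm_mul]
        gcongr
        simpa using norm_sub_le s 1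
      have := norm_add_le (s * (s - 1) * L s) (2 * V / N)
      rw [e1] at this
      nlinarith [mul_nonneg hM0 (norm_nonneg s), mul_nonneg (mul_nonneg hM0 (norm_nonneg s)) (norm_nonneg s), mul_nonneg hM0 (sub_nonneg.mpr hns)]
    have hpw : ‖(Δ:ℂ) ^ (-s / 2)‖ ≤ 1 := by
      rw [Complex.norm_cpow_eq_rpow_re_of_pos bl]
      refine rpow_le_one_of_one_le_of_nonpos hd ?_
      simp; linarith
    have hns0 : 0 < ‖s‖ := by linarith
    simp only
    rw [hRv s hs0, norm_div, norm_mul, norm_mul, norm_div, Complex.norm_real, norm_of_nonneg hP.le]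
    set E := exp ((C + 2) * N * (1 + ‖s‖)) with hE
    have hE0 : 0 < E := exp_pos _
    calc _ ≤ ‖s‖ * (2 * M * (3 + ‖s‖)) * 2 * (E / ‖s‖) * 1 / P := by gcongr
      _ = M * (4 * (3 + ‖s‖)) * E / P := by field_simp; ring
      _ ≤ P * (zr K 2 * Δ) * (4 * (3 + ‖s‖)) * E / P := by gcongr
      _ = zr K 2 * Δ * (4 * (3 + ‖s‖) * E) := by field_simp
      _ ≤ _ := by
        gcongr
        have h6 : 4 * (3 + ‖s‖) ≤ exp (6 * N * (1 + ‖s‖)) := by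
          have h7 : (6:ℝ) * (1 + ‖s‖) ≤ 6 * N * (1 + ‖s‖) := by nlinarith
          refine le_trans ?_ (exp_le_exp.mpr h7)
          have h8 := add_one_le_exp (3 * (1 + ‖s‖))
          have h9 : exp (6 * (1 + ‖s‖)) = exp (3 * (1 + ‖s‖)) * exp (3 * (1 + ‖s‖)) := by rw [← exp_add]; ring_nf
          rw [h9]
          nlinarith
        calc _ ≤ exp (6 * N * (1 + ‖s‖)) * E := by gcongr
          _ = _ := by rw [hE, ← exp_add]; ring_nf
end
section
open Real NumberField Module Filter IsDedekindDomain
open scoped nonZeroDivisors Classical Topology ENNReal ArithmeticFunction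
open ENNReal (ofReal tsum_comm tsum_mul_right)
open Ideal (absNorm absNorm_eq_zero_iff)
section
variable (K : Type*) [Field K] [NumberField K]
abbrev PS := HeightOneSpectrum (𝓞 K)
variable {K}
def nP (P : PS K) : ℕ := absNorm P.asIdeal
lemma nP_gt (P : PS K) : 1 < nP P := by
  have h0 : nP P ≠ 0 := absNorm_eq_zero_iff.not.mpr P.ne_bot
  have h1 : nP P ≠ 1 := Ideal.absNorm_eq_one_iff.not.mpr P.isPrime.ne_top
  omega
lemma log_nP (P : PS K) : 0 < log (nP P) := log_pos (by exact_mod_cast nP_gt P)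
lemma hk_pow (P Q : PS K) (J : Ideal (𝓞 K)) (k : ℕ) :
    P.asIdeal ^ (k + 1) ∣ Q.asIdeal * J ↔ if P = Q then P.asIdeal ^ k ∣ J else P.asIdeal ^ (k + 1) ∣ J := by
  split_ifs with h
  · subst h
    rw [pow_succ', mul_dvd_mul_iff_left]
    exact P.ne_bot
  · refine ⟨fun hd => ?_, fun hd => hd.mul_left _⟩
    have : IsCoprime (P.asIdeal ^ (k + 1)) Q.asIdeal := by
      refine IsCoprime.pow_left ?_
      rw [Ideal.isCoprime_iff_sup_eq]
      exact P.isMaximal.coprime_of_ne Q.isMaximal (fun he => h (HeightOneSpectrum.ext he))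
    exact this.dvd_of_dvd_mul_left hd
lemma log_norm (J : Ideal (𝓞 K)) (hJ : J ≠ ⊥) :
    ofReal (log (absNorm J)) =
      ∑' P : PS K, ∑' k : ℕ, if P.asIdeal ^ (k + 1) ∣ J then ofReal (log (nP P)) else 0 := by
  induction J using UniqueFactorizationMonoid.induction_on_prime with
  | h₁ => exact absurd rfl hJ
  | h₂ J hu =>
    rw [Ideal.isUnit_iff.mp hu]
    simp only [Ideal.absNorm_top, Nat.cast_one, log_one, ENNReal.ofReal_zero]
    symm
    simp only [ENNReal.tsum_eq_zero, ite_eq_right_iff]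
    intro P k h
    exfalso
    rw [← Ideal.one_eq_top] at h
    exact P.isPrime.ne_top (Ideal.isUnit_iff.mp (isUnit_of_dvd_one ((dvd_pow_self _ (Nat.succ_ne_zero k)).trans h)))
  | h₃ J Q hJ0 hQ ih =>
    let Q' : PS K := ⟨Q, Ideal.isPrime_of_prime hQ, hQ.ne_zero⟩
    have hJ0' : J ≠ ⊥ := hJ0
    have hN : (absNorm J : ℝ) ≠ 0 := by exact_mod_cast absNorm_eq_zero_iff.not.mpr hJ0'
    have hNp : (1:ℝ) ≤ absNorm J := by
      exact_mod_cast Nat.one_le_iff_ne_zero.mpr (absNorm_eq_zero_iff.not.mpr hJ0')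
    have hQN : (1:ℝ) < absNorm Q := by exact_mod_cast nP_gt Q'
    have e1 : ∀ P : PS K, (∑' k : ℕ, if P.asIdeal ^ (k + 1) ∣ Q * J then ofReal (log (nP P)) else 0) =
        (if P = Q' then ofReal (log (nP P)) else 0) + ∑' k : ℕ, if P.asIdeal ^ (k + 1) ∣ J then ofReal (log (nP P)) else 0 := by
      intro P
      have e2 : ∀ k, (P.asIdeal ^ (k + 1) ∣ Q * J) ↔ if P = Q' then P.asIdeal ^ k ∣ J else P.asIdeal ^ (k + 1) ∣ J :=
        fun k => hk_pow P Q' J k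
      simp only [e2]
      split_ifs with h
      · rw [tsum_eq_zero_add' ENNReal.summable]
        simp
      · simp
    simp only [e1]
    rw [ENNReal.tsum_add, ← ih hJ0', tsum_ite_eq, map_mul]
    push_cast
    rw [log_mul bl hN, ENNReal.ofReal_add (log_nonneg hQN.le) (log_nonneg hNp)]
    rfl
def lamS (K : Type*) [Field K] [NumberField K] (s : ℝ) : ℝ≥0∞ :=
  ∑' P : PS K, ∑' k : ℕ, ofReal (log (nP P)) * ofReal ((nP P ^ (k + 1) : ℕ) ^ (-s))
lemma lamS_mul (s : ℝ) : ∑' J : NzI K, ofReal (log (absNorm J.1)) * ofReal ((absNorm J.1 : ℝ) ^ (-s)) =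
    lamS K s * ∑' J : NzI K, ofReal ((absNorm J.1 : ℝ) ^ (-s)) := by
  have h1 : ∀ J : NzI K, ofReal (log (absNorm J.1)) * ofReal ((absNorm J.1 : ℝ) ^ (-s)) =
      ∑' P : PS K, ∑' k : ℕ, (if P.asIdeal ^ (k + 1) ∣ J.1 then ofReal (log (nP P)) else 0) * ofReal ((absNorm J.1 : ℝ) ^ (-s)) := by
    intro J
    rw [log_norm J.1 J.2]
    simp only [tsum_mul_right]
  simp only [h1]
  rw [tsum_comm, lamS, ← tsum_mul_right]
  refine tsum_congr fun P => ?_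
  rw [tsum_comm, ← tsum_mul_right]
  refine tsum_congr fun k => ?_
  have hP0 : P.asIdeal ^ (k + 1) ≠ ⊥ := pow_ne_zero _ P.ne_bot
  let φ : NzI K → NzI K := fun J => ⟨P.asIdeal ^ (k + 1) * J.1, mul_ne_zero hP0 J.2⟩
  have hφ : Function.Injective φ := by
    intro J J' h
    have := congrArg Subtype.val h
    exact Subtype.ext (mul_left_cancel₀ hP0 this)
  rw [← hφ.tsum_eq, ← ENNReal.tsum_mul_left]
  · refine tsum_congr fun J => ?_
    rw [if_pos (Dvd.intro _ rfl), mul_assoc]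
    congr 1
    rw [← ENNReal.ofReal_mul bp, ← mul_rpow bp bp]
    simp only [φ, map_mul, map_pow, nP]
    push_cast; rfl
  · intro J hJ
    by_contra h
    refine hJ ?_
    simp only
    rw [if_neg, zero_mul]
    rintro ⟨J', h'⟩
    refine h ⟨⟨J', ?_⟩, Subtype.ext h'.symm⟩
    rintro rfl
    exact J.2 (by simp [*])
def lamE (K : Type*) [Field K] [NumberField K] (n : ℕ) : ℝ≥0∞ :=
  ∑' P : PS K, ∑' k : ℕ, if nP P ^ (k + 1) = n then ofReal (log (nP P)) else 0
lemma lamS_eq (s : ℝ) : lamS K s = ∑' n : ℕ, lamE K n * ofReal ((n:ℝ) ^ (-s)) := by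
  simp only [lamE, ← tsum_mul_right]
  rw [tsum_comm, lamS]
  refine tsum_congr fun P => ?_
  rw [tsum_comm]
  refine tsum_congr fun k => ?_
  rw [tsum_eq_single (nP P ^ (k + 1))]
  · simp
  · aesop
lemma nP_prime (P : PS K) : ∃ p : ℕ, p.Prime ∧ (p : 𝓞 K) ∈ P.asIdeal ∧ ∃ j, 0 < j ∧ nP P = p ^ j := by
  have h1 : ((nP P : ℕ) : 𝓞 K) ∈ P.asIdeal := Ideal.absNorm_mem _
  have h2 : ∀ n : ℕ, n ≠ 0 → (n : 𝓞 K) ∈ P.asIdeal → ∃ p : ℕ, p.Prime ∧ (p : 𝓞 K) ∈ P.asIdeal := by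
    intro n
    induction n using Nat.recOnMul with
    | zero => intro h; exact absurd rfl h
    | one => intro _ h; exact absurd ((Ideal.eq_top_iff_one _).mpr (by simpa using h)) P.isPrime.ne_top
    | prime p hp => exact fun _ h => ⟨p, hp, h⟩
    | mul a b ha hb =>
      intro hn h
      rw [Nat.cast_mul] at h
      rcases P.isPrime.mem_or_mem h with h | h
      · aesop
      · aesop
  obtain ⟨p, hp, hpP⟩ := h2 _ (by have := nP_gt P; omega) h1
  refine ⟨p, hp, hpP, ?_⟩
  have h3 : nP P ∣ p ^ dg K := by
    have := Ideal.absNorm_dvd_absNorm_of_le ((Ideal.span_singleton_le_iff_mem _).mpr hpP)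
    rw [Ideal.absNorm_span_singleton, show ((p : ℕ) : 𝓞 K) = algebraMap ℤ (𝓞 K) p by simp, Algebra.norm_algebraMap, RingOfIntegers.rank, Int.natAbs_pow, Int.natAbs_natCast] at this
    exact this
  obtain ⟨j, _, hj⟩ := (Nat.dvd_prime_pow hp).mp h3
  refine ⟨j, Nat.pos_of_ne_zero ?_, hj⟩
  rintro rfl
  have := nP_gt P
  rw [hj] at this; simp at this
lemma sum_over_p (p : ℕ) (hp : p.Prime) (S : Finset (PS K)) (hS : ∀ P ∈ S, (p : 𝓞 K) ∈ P.asIdeal) :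
    ∑ P ∈ S, log (nP P) ≤ dg K * log p := by
  have h1 : ∏ P ∈ S.image HeightOneSpectrum.asIdeal, P ∣ Ideal.span {(p : 𝓞 K)} := by
    refine Finset.prod_primes_dvd _ ?_ ?_
    · intro P hP
      obtain ⟨Q, _, rfl⟩ := Finset.mem_image.mp hP
      exact Q.prime
    · intro P hP
      obtain ⟨Q, hQ, rfl⟩ := Finset.mem_image.mp hP
      rw [Ideal.dvd_span_singleton]
      exact hS Q hQ
  rw [Finset.prod_image (fun P _ Q _ h => HeightOneSpectrum.ext h)] at h1
  have h2 := Ideal.absNorm_dvd_absNorm_of_le (Ideal.le_of_dvd h1)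
  rw [map_prod, Ideal.absNorm_span_singleton, show ((p : ℕ) : 𝓞 K) = algebraMap ℤ (𝓞 K) p by simp, Algebra.norm_algebraMap, RingOfIntegers.rank, Int.natAbs_pow, Int.natAbs_natCast] at h2
  have h3 := Nat.le_of_dvd (pow_pos hp.pos _) h2
  rw [← log_prod (fun P _ => by have := nP_gt P; positivity), ← log_pow]
  refine log_le_log ?_ ?_
  · exact Finset.prod_pos fun P _ => by have := nP_gt P; positivity
  · exact_mod_cast h3
lemma lamE_le (n : ℕ) : lamE K n ≤ ofReal (dg K * Λ n) := by
  by_cases hn : IsPrimePow n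
  · obtain ⟨p, m, hp, hm, rfl⟩ := (isPrimePow_nat_iff n).mp hn
    rw [ArithmeticFunction.vonMangoldt_apply_pow hm.ne', ArithmeticFunction.vonMangoldt_apply_prime hp]
    refine ENNReal.summable.tsum_le_of_sum_le fun S => ?_
    have h1 : ∀ P ∈ S, (∑' k : ℕ, if nP P ^ (k + 1) = p ^ m then ofReal (log (nP P)) else 0) ≤
        if (p : 𝓞 K) ∈ P.asIdeal then ofReal (log (nP P)) else 0 := by
      intro P _
      by_cases hk : ∃ k, nP P ^ (k + 1) = p ^ m
      · obtain ⟨k, hk⟩ := hk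
        rw [tsum_eq_single k]
        · rw [if_pos hk, if_pos]
          have : ((p ^ m : ℕ) : 𝓞 K) ∈ P.asIdeal := by
            rw [← hk, Nat.cast_pow]
            exact Ideal.pow_mem_of_mem _ (Ideal.absNorm_mem _) _ (Nat.succ_pos k)
          rw [Nat.cast_pow] at this
          exact P.isPrime.mem_of_pow_mem _ this
        · intro k' hk'
          rw [if_neg]
          intro h
          have := Nat.pow_right_injective (nP_gt P) (h.trans hk.symm)
          omega
      · aesop
    refine (Finset.sum_le_sum h1).trans ?_
    rw [← Finset.sum_filter, ← ENNReal.ofReal_sum_of_nonneg (fun P _ => (log_nP P).le)]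
    refine ENNReal.ofReal_le_ofReal (sum_over_p p hp _ fun P hP => (Finset.mem_filter.mp hP).2)
  · have : lamE K n = 0 := by
      simp only [lamE, ENNReal.tsum_eq_zero, ite_eq_right_iff]
      intro P k h
      exfalso
      obtain ⟨p, hp, _, j, hj, hN⟩ := nP_prime P
      refine hn ((isPrimePow_nat_iff n).mpr ⟨p, j * (k + 1), hp, by positivity, ?_⟩)
      rw [← h, hN, pow_mul]
    rw [this]; exact zero_le
end
end
section
open Real NumberField Module Filter IsDedekindDomain
open scoped nonZeroDivisors Classical Topology ENNReal ArithmeticFunction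
open Complex (I norm_exp norm_real)
open ENNReal (ofReal ofReal_mul)
open Ideal (absNorm)
open LSeries (abscissaOfAbsConv abscissaOfAbsConv_le_of_forall_lt_LSeriesSummable' term_def)
section
variable (K : Type*) [Field K] [NumberField K]
def lam (n : ℕ) : ℝ := (lamE K n).toReal
lemma lam_nonneg (n : ℕ) : 0 ≤ lam K n := ENNReal.toReal_nonneg
lemma lam_le (n : ℕ) : lam K n ≤ dg K * Λ n := by
  refine ENNReal.toReal_le_of_le_ofReal ?_ (lamE_le n)
  positivity
lemma lam_enn (n : ℕ) : ofReal (lam K n) = lamE K n :=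
  ENNReal.ofReal_toReal (ne_top_of_le_ne_top ENNReal.ofReal_ne_top (lamE_le n))
lemma lam_summable (s : ℂ) (hs : 1 < s.re) : LSeriesSummable (fun n => (lam K n : ℂ)) s := by
  have h := ((ArithmeticFunction.LSeriesSummable_vonMangoldt hs).smul (dg K : ℂ)).norm
  refine Summable.of_norm_bounded h fun n => LSeries.norm_term_le s ?_
  have h1 := lam_le K n
  have h2 := lam_nonneg K n
  rw [norm_real, norm_of_nonneg h2]
  refine h1.trans ?_
  simp only [Pi.smul_apply, smul_eq_mul, norm_mul, Complex.norm_natCast, norm_real]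
  gcongr
  exact le_abs_self _
lemma lser_real (f : ℕ → ℝ) (hf : ∀ n, 0 ≤ f n) (s : ℝ) (hs : 1 < s) (h : LSeriesSummable (fun n => (f n : ℂ)) s) :
    ∃ r : ℝ, 0 ≤ r ∧ LSeries (fun n => (f n : ℂ)) s = r ∧
      ∑' n : ℕ, ofReal (f n) * ofReal ((n:ℝ) ^ (-s)) = ofReal r := by
  have e : ∀ n : ℕ, LSeries.term (fun n => (f n : ℂ)) s n = ((f n * (n:ℝ) ^ (-s) : ℝ) : ℂ) := by
    intro n
    rw [term_def]
    split_ifs with h0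
    · subst h0
      rw [Nat.cast_zero, zero_rpow bl]; simp
    · push_cast
      rw [Complex.ofReal_cpow bp, div_eq_mul_inv, ← Complex.cpow_neg]
      push_cast; rfl
  have h' : Summable fun n : ℕ => f n * (n:ℝ) ^ (-s) := by
    rw [← Complex.summable_ofReal]
    exact h.congr fun n => e n
  refine ⟨∑' n : ℕ, f n * (n:ℝ) ^ (-s), tsum_nonneg fun n => mul_nonneg (hf n) bp, ?_, ?_⟩
  · rw [LSeries, Complex.ofReal_tsum]
    exact tsum_congr e
  · rw [ENNReal.ofReal_tsum_of_nonneg (fun n => mul_nonneg (hf n) bp) h']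
    exact tsum_congr fun n => (ofReal_mul (hf n)).symm
lemma fiber_enn (φ : ℕ → ℝ≥0∞) (h0 : φ 0 = 0) : ∑' J : NzI K, φ (absNorm J.1) = ∑' n : ℕ, (aK K n : ℝ≥0∞) * φ n := by
  rw [← (Equiv.sigmaFiberEquiv (fun J : NzI K => absNorm J.1)).tsum_eq, ENNReal.tsum_sigma']
  refine tsum_congr fun n => ?_
  rcases eq_or_ne n 0 with rfl | hn
  · rw [h0, mul_zero]
    haveI : IsEmpty {J : NzI K // absNorm J.1 = 0} := ⟨fun J => J.1.2 (Ideal.absNorm_eq_zero_iff.mp J.2)⟩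
    exact tsum_empty
  have e : ∀ J : {J : NzI K // absNorm J.1 = n}, φ (absNorm ((Equiv.sigmaFiberEquiv (fun J : NzI K => absNorm J.1)) ⟨n, J⟩).1) = φ n := by
    aesop
  rw [tsum_congr e, ENNReal.tsum_const]
  let e : {J : NzI K // absNorm J.1 = n} ≃ {I : Ideal (𝓞 K) // absNorm I = n} :=
    { toFun := fun J => ⟨J.1.1, J.2⟩
      invFun := fun I => ⟨⟨I.1, fun h => hn (by rw [← I.2, h, Ideal.absNorm_bot])⟩, I.2⟩
      left_inv := fun _ => rfl
      right_inv := fun _ => rfl }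
  haveI : Finite {I : Ideal (𝓞 K) // absNorm I = n} := Ideal.finite_setOf_absNorm_eq n
  haveI : Finite {J : NzI K // absNorm J.1 = n} := Finite.of_equiv _ e.symm
  rw [ENat.card_eq_coe_natCard, Nat.card_congr e, aK]
  simp
lemma aK_absc : abscissaOfAbsConv (fun n => (aK K n : ℂ)) ≤ 1 :=
  abscissaOfAbsConv_le_of_forall_lt_LSeriesSummable' fun y hy => aK_summable K y (by exact_mod_cast hy)
lemma lam_absc : abscissaOfAbsConv (fun n => (lam K n : ℂ)) ≤ 1 :=
  abscissaOfAbsConv_le_of_forall_lt_LSeriesSummable' fun y hy => lam_summable K y (by exact_mod_cast hy)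
lemma isOpen_re : IsOpen {s : ℂ | 1 < s.re} := isOpen_lt continuous_const Complex.continuous_re
lemma zeta_dlog (s : ℂ) (hs : 1 < s.re) :
    deriv (dedekindZeta K) s = -LSeries (fun n => (lam K n : ℂ)) s * dedekindZeta K s := by
  refine eq_of_real _ _ ((zeta_diff K).deriv isOpen_re) (DifferentiableOn.mul (DifferentiableOn.neg ?_) (zeta_diff K)) ?_ s hs
  · refine (LSeries_differentiableOn (fun n => (lam K n : ℂ))).mono fun s hs => ?_
    exact lt_of_le_of_lt (lam_absc K) (by exact_mod_cast hs)
  intro s hs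
  have h1 : abscissaOfAbsConv (fun n => (aK K n : ℂ)) < ((s:ℂ).re : EReal) :=
    lt_of_le_of_lt (aK_absc K) (by exact_mod_cast hs)
  have e1 : dedekindZeta K = LSeries (fun n => (aK K n : ℂ)) := rfl
  have e2 : LSeries.logMul (fun n => (aK K n : ℂ)) = fun n : ℕ => ((log (n:ℝ) * (aK K n : ℝ) : ℝ) : ℂ) := by
    simp
  have h2 := LSeriesSummable_logMul_of_lt_re h1
  have h3 := LSeries_deriv h1
  rw [e2] at h2 h3
  obtain ⟨r, hr, hr1, hr2⟩ := lser_real _ (fun n => mul_nonneg (log_natCast_nonneg n) (Nat.cast_nonneg _)) s hs h2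
  obtain ⟨q, hq, hq1, hq2⟩ := lser_real _ (lam_nonneg K) s hs (lam_summable K s (by simpa using hs))
  simp only [lam_enn] at hq2
  have h4 := lamS_mul (K := K) s
  rw [lamS_eq, hq2, zr_enn K s hs, fiber_enn K (fun n => ofReal (log n) * ofReal ((n:ℝ) ^ (-s))) (by simp)] at h4
  have h5 : ∑' n : ℕ, (aK K n : ℝ≥0∞) * (ofReal (log n) * ofReal ((n:ℝ) ^ (-s))) = ofReal r := by
    rw [← hr2]
    refine tsum_congr fun n => ?_
    rw [ofReal_mul (log_natCast_nonneg n), ENNReal.ofReal_natCast]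
    ring
  rw [h5, ← ofReal_mul hq] at h4
  have h6 := (ENNReal.ofReal_eq_ofReal_iff hr (mul_nonneg hq (zr_nonneg K s))).mp h4
  simp only [Pi.mul_apply, Pi.neg_apply]
  rw [zr_eq K s hs, hq1, e1, h3, hr1, h6]
  push_cast; ring
def bK (n : ℕ) : ℝ := lam K n / log n
lemma bK_nonneg (n : ℕ) : 0 ≤ bK K n := div_nonneg (lam_nonneg K n) (log_natCast_nonneg n)
lemma lam_le_log (n : ℕ) : lam K n ≤ dg K * log n :=
  (lam_le K n).trans (by gcongr; exact ArithmeticFunction.vonMangoldt_le_log)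
lemma bK_le (n : ℕ) : bK K n ≤ dg K := by
  rw [bK]
  exact div_le_of_le_mul₀ (log_natCast_nonneg n) (Nat.cast_nonneg _) (lam_le_log K n)
lemma bK_one : bK K 1 = 0 := by simp [bK]
lemma bK_log (n : ℕ) : log n * bK K n = lam K n := by
  rcases eq_or_ne (log n) 0 with h | h
  · have := lam_le_log K n
    have := lam_nonneg K n
    rw [h] at *
    linarith
  · rw [bK]; field_simp
lemma bK_summable (s : ℂ) (hs : 1 < s.re) : LSeriesSummable (fun n => (bK K n : ℂ)) s :=
  LSeriesSummable_of_bounded_of_one_lt_re (m := dg K) (fun n _ => by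
    rw [norm_real, norm_of_nonneg (bK_nonneg K n)]; exact bK_le K n) hs
lemma bK_absc : abscissaOfAbsConv (fun n => (bK K n : ℂ)) ≤ 1 :=
  abscissaOfAbsConv_le_of_forall_lt_LSeriesSummable' fun y hy => bK_summable K y (by exact_mod_cast hy)
lemma bK_deriv (s : ℂ) (hs : 1 < s.re) :
    HasDerivAt (LSeries (fun n => (bK K n : ℂ))) (-LSeries (fun n => (lam K n : ℂ)) s) s := by
  have := LSeries_hasDerivAt (lt_of_le_of_lt (bK_absc K) (show (1:EReal) < (s.re : EReal) by exact_mod_cast hs))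
  convert! this using 3
  ext n
  simp [LSeries.logMul, ← bK_log K n]
lemma zeta_exp (s : ℂ) (hs : 1 < s.re) :
    dedekindZeta K s = Complex.exp (LSeries (fun n => (bK K n : ℂ)) s) := by
  set B := LSeries (fun n => (bK K n : ℂ)) with hB
  have hd : ∀ s : ℂ, 1 < s.re → HasDerivAt (fun s => dedekindZeta K s * Complex.exp (-B s)) 0 s := by
    intro s hs
    have h1 := ((zeta_diff K).differentiableAt (isOpen_re.mem_nhds hs)).hasDerivAt
    have h2 := ((bK_deriv K s hs).neg).cexp
    convert! h1.mul h2 using 1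
    rw [zeta_dlog K s hs]
    simp only [Pi.neg_apply, ← hB]
    ring
  have hconst : ∀ y : ℝ, 1 < y → dedekindZeta K y * Complex.exp (-B y) = dedekindZeta K s * Complex.exp (-B s) := by
    intro y hy
    refine isOpen_re.is_const_of_deriv_eq_zero (convex_halfSpace_re_gt 1).isPreconnected
      (fun s hs => (hd s hs).differentiableAt.differentiableWithinAt) (fun s hs => (hd s hs).deriv) ?_ hs
    simpa using hy
  have t1 : Tendsto (fun y : ℝ => dedekindZeta K y) atTop (𝓝 1) := by
    have := LSeries.tendsto_atTop (lt_of_le_of_lt (aK_absc K) (by exact EReal.coe_lt_top 1))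
    have e1 : (aK K 1 : ℂ) = 1 := by simp [aK, Ideal.absNorm_eq_one_iff]
    rw [e1] at this
    exact this
  have t2 : Tendsto (fun y : ℝ => B y) atTop (𝓝 0) := by
    have := LSeries.tendsto_atTop (lt_of_le_of_lt (bK_absc K) (by exact EReal.coe_lt_top 1))
    simpa [bK_one] using this
  have t3 := t1.mul ((Complex.continuous_exp.tendsto _).comp t2.neg)
  have t4 : Tendsto (fun y : ℝ => dedekindZeta K y * Complex.exp (-B y)) atTop (𝓝 (dedekindZeta K s * Complex.exp (-B s))) := by
    refine tendsto_const_nhds.congr' ?_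
    filter_upwards [eventually_gt_atTop 1] with y hy
    exact (hconst y hy).symm
  have h := tendsto_nhds_unique t4 t3
  simp only [neg_zero, Complex.exp_zero, mul_one] at h
  rw [Complex.exp_neg] at h
  field_simp at h
  exact h
lemma sum_rpow_le (s : ℝ) (hs : 1 < s) : ∑' n : ℕ, ((n:ℝ) + 2) ^ (-s) ≤ 1 / (s - 1) := by
  refine tsum_le_of_sum_range_le (fun n => by positivity) fun N => ?_
  have h := AntitoneOn.sum_le_integral (x₀ := 1) (a := N) (f := fun x : ℝ => x ^ (-s)) ?_
  · refine (le_of_eq ?_).trans (h.trans ?_)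
    · refine Finset.sum_congr rfl fun i _ => ?_
      push_cast; ring_nf
    · rw [integral_rpow (Or.inr ⟨by linarith, ?_⟩)]
      · rw [one_rpow, ← neg_div_neg_eq]
        have h1 : 0 ≤ (1 + (N:ℝ)) ^ (-s + 1) := by positivity
        rw [show -(-s + 1) = s - 1 by ring]
        gcongr
        linarith
      · rw [Set.uIcc_of_le (by simp)]
        simp
  · intro a ha b hb hab
    exact rpow_le_rpow_of_nonpos (by linarith [ha.1]) hab bl
lemma bK_norm (s : ℂ) (hs : 1 < s.re) : ‖LSeries (fun n => (bK K n : ℂ)) s‖ ≤ dg K / (s.re - 1) := by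
  have h := bK_summable K s hs
  have hb : ∀ n : ℕ, ‖LSeries.term (fun n => (bK K n : ℂ)) s (n + 2)‖ ≤ dg K * ((n:ℝ) + 2) ^ (-s.re) := by
    intro n
    rw [LSeries.norm_term_eq, if_neg (by omega), norm_real, norm_of_nonneg (bK_nonneg K _), div_eq_mul_inv,
      ← rpow_neg bp]
    push_cast
    gcongr
    exact bK_le K _
  have hs2 : Summable fun n : ℕ => ((n:ℝ) + 2) ^ (-s.re) := by
    have := (summable_nat_add_iff 2).mpr (summable_nat_rpow (p := -s.re) |>.mpr bl)
    simpa using this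
  rw [LSeries, ← h.sum_add_tsum_nat_add 2]
  simp only [Finset.sum_range_succ, Finset.sum_range_zero, LSeries.term_zero]
  have e1 : LSeries.term (fun n => (bK K n : ℂ)) s 1 = 0 := by simp [term_def, bK_one]
  rw [e1, add_zero, add_zero, zero_add]
  refine (tsum_of_norm_bounded (hs2.mul_left _).hasSum hb).trans ?_
  rw [tsum_mul_left, div_eq_mul_one_div]
  gcongr
  exact sum_rpow_le _ hs
lemma zeta_lower (s : ℂ) (hs : 1 < s.re) : Real.exp (-(dg K / (s.re - 1))) ≤ ‖dedekindZeta K s‖ := by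
  rw [zeta_exp K s hs, norm_exp]
  gcongr
  exact neg_le_of_abs_le ((Complex.abs_re_le_norm _).trans (bK_norm K s hs))
lemma zr_two : zr K 2 ≤ Real.exp (dg K) := by
  have h := zr_eq K 2 bn
  have h2 : ‖dedekindZeta K ((2:ℝ):ℂ)‖ ≤ Real.exp (dg K) := by
    rw [zeta_exp K _ bn, norm_exp]
    gcongr
    have := (Complex.abs_re_le_norm _).trans (bK_norm K ((2:ℝ):ℂ) bn)
    refine (le_abs_self _).trans (this.trans (le_of_eq ?_))
    norm_num
  rw [h, norm_real, norm_of_nonneg (zr_nonneg K 2)] at h2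
  exact h2
lemma zeta_341 (σ t : ℝ) (hσ : 1 < σ) :
    1 ≤ ‖dedekindZeta K σ‖ ^ 3 * ‖dedekindZeta K (σ + t * I)‖ ^ 4 * ‖dedekindZeta K (σ + 2 * t * I)‖ := by
  have hr : ∀ u : ℝ, 1 < ((σ:ℂ) + u * I).re := by intro u; simpa using hσ
  have key : ∀ u : ℝ, HasSum (fun n : ℕ => if n = 0 then 0 else bK K n * (n:ℝ) ^ (-σ) * cos (u * log n)) (LSeries (fun n => (bK K n : ℂ)) (σ + u * I)).re := by
    intro u
    have h := Complex.hasSum_re (bK_summable K _ (hr u)).hasSum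
    refine h.congr_fun ?_
    intro n
    rw [term_def]
    split_ifs with h0
    · simp
    · have hn : (n:ℂ) ≠ 0 := by exact_mod_cast h0
      have hn' : (0:ℝ) < n := by positivity
      rw [div_eq_mul_inv, ← Complex.cpow_neg, Complex.cpow_def_of_ne_zero hn, Complex.re_ofReal_mul, Complex.exp_re,
        ← Complex.natCast_log, rpow_def_of_pos hn', mul_assoc]
      generalize log (n:ℝ) = L
      congr 2
      · congr 1
        simp
      · rw [← cos_neg]
        congr 1
        simp
        ring
  have h0 := key 0
  have h1 := key t
  have h2 := key (2 * t)
  have hh := ((h0.mul_left 3).add (h1.mul_left 4)).add h2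
  have hn := hh.nonneg (fun n => by
    split_ifs with h
    · simp
    · rw [show 2 * t * log n = 2 * (t * log n) by ring, cos_two_mul, zero_mul, cos_zero]
      have h3 : 0 ≤ bK K n * (n:ℝ) ^ (-σ) := mul_nonneg (bK_nonneg K n) bp
      nlinarith [mul_nonneg h3 (sq_nonneg (cos (t * log n) + 1))])
  have e0 : dedekindZeta K (σ:ℂ) = dedekindZeta K (σ + (0:ℝ) * I) := by simp
  have e2 : (σ:ℂ) + 2 * t * I = σ + (2 * t : ℝ) * I := by push_cast; ring
  rw [e2, e0, zeta_exp K _ (hr 0), zeta_exp K _ (hr (2 * t)), zeta_exp K _ (hr t)]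
  simp only [norm_exp, ← exp_nat_mul, ← exp_add]
  refine one_le_exp ?_
  push_cast
  simpa using hn
end
end
section
open Real NumberField Module Filter IsDedekindDomain
open scoped nonZeroDivisors Classical Topology ENNReal ArithmeticFunction ComplexConjugate
open Complex (I ofReal_zero)
section
variable (K : Type*) [Field K] [NumberField K]
lemma H_ne_gt (H : ℂ → ℂ) (hH : ∀ s : ℂ, 1 < s.re → H s = (s - 1) * dedekindZeta K s) (s : ℂ) (hs : 1 < s.re) : H s ≠ 0 := by
  rw [hH s hs, zeta_exp K s hs]
  refine mul_ne_zero ?_ (Complex.exp_ne_zero _)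
  intro h
  rw [sub_eq_zero] at h
  rw [h] at hs; simp at hs
lemma H_ne_one (H : ℂ → ℂ) (hd : Differentiable ℂ H) (hH : ∀ s : ℂ, 1 < s.re → H s = (s - 1) * dedekindZeta K s) : H 1 ≠ 0 := by
  have h1 := NumberField.tendsto_sub_one_mul_dedekindZeta_nhdsGT K
  have h2 : Tendsto (fun s : ℝ => H s) (𝓝[>] 1) (𝓝 (H ((1:ℝ):ℂ))) :=
    ((hd.continuous.comp Complex.continuous_ofReal).tendsto 1).mono_left nhdsWithin_le_nhds
  have h3 := tendsto_nhds_unique (h2.congr' ?_) h1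
  · rw [Complex.ofReal_one] at h3
    rw [h3]
    exact_mod_cast (dedekindZeta_residue_pos K).ne'
  · filter_upwards [self_mem_nhdsWithin] with s hs
    exact hH s (by simpa using hs)
lemma H_ne (H : ℂ → ℂ) (hd : Differentiable ℂ H) (hH : ∀ s : ℂ, 1 < s.re → H s = (s - 1) * dedekindZeta K s)
    (s : ℂ) (hs : 1 ≤ s.re) : H s ≠ 0 := by
  rcases hs.lt_or_eq with hs | hs
  · exact H_ne_gt K H hH s hs
  obtain ⟨t, rfl⟩ : ∃ t : ℝ, s = 1 + t * I := ⟨s.im, by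
    apply Complex.ext <;> simp [← hs]⟩
  rcases eq_or_ne t 0 with rfl | ht
  · simpa using H_ne_one K H hd hH
  intro h0
  have hcont : ∀ u : ℝ, Tendsto (fun x : ℝ => ‖H (1 + u * I + x)‖) (𝓝[>] 0) (𝓝 ‖H (1 + u * I)‖) := by
    intro u
    have : Continuous (fun x : ℝ => ‖H (1 + u * I + x)‖) := (hd.continuous.comp bf).norm
    have h := this.tendsto 0
    simp only [ofReal_zero, add_zero] at h
    exact h.mono_left nhdsWithin_le_nhds
  have hder : HasDerivAt (fun x : ℝ => H (1 + t * I + x)) (deriv H (1 + t * I)) 0 := by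
    have h1 : HasDerivAt H (deriv H (1 + t * I)) (1 + t * I + ((0:ℝ):ℂ)) := by
      simpa using (hd _).hasDerivAt
    have h2 : HasDerivAt (fun x : ℝ => (1 + t * I + (x:ℂ))) 1 0 := by
      simpa using (Complex.ofRealCLM.hasDerivAt (x := (0:ℝ))).const_add (1 + t * I)
    have h3 := h1.comp_of_eq (0:ℝ) h2 rfl
    rw [mul_one] at h3
    exact h3
  have hsl := hder.tendsto_slope_zero_right.norm
  simp only [zero_add, ofReal_zero, add_zero, h0, sub_zero, norm_smul] at hsl
  have hlim := ((((hcont 0).pow 3).mul (hsl.pow 3)).mul (hcont t)).mul (hcont (2 * t))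
  rw [h0, norm_zero, mul_zero, zero_mul] at hlim
  have hlow : ∀ᶠ x : ℝ in 𝓝[>] 0, |t| ^ 5 ≤ ‖H (1 + (0:ℝ) * I + x)‖ ^ 3 * (‖x⁻¹‖ * ‖H (1 + t * I + x)‖) ^ 3 * ‖H (1 + t * I + x)‖ * ‖H (1 + (2 * t : ℝ) * I + x)‖ := by
    filter_upwards [self_mem_nhdsWithin] with x hx
    have hx : 0 < x := hx
    have h341 := zeta_341 K (1 + x) t bl
    have hv : ∀ u : ℝ, ‖H (1 + u * I + x)‖ = ‖(x:ℂ) + u * I‖ * ‖dedekindZeta K ((1 + x : ℝ) + u * I)‖ := by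
      intro u
      rw [hH _ (by simpa using hx), norm_mul]
      push_cast
      congr 2 <;> ring_nf
    have hn : ∀ u : ℝ, |u| ≤ ‖(x:ℂ) + u * I‖ := by
      intro u
      have := Complex.abs_im_le_norm (x ~~ u)
      simpa using this
    rw [hv 0, hv t, hv (2 * t)]
    have hn1 := hn t
    have hn2 : |t| ≤ ‖(x:ℂ) + (2 * t : ℝ) * I‖ := by
      refine le_trans ?_ (hn (2 * t))
      rw [abs_mul, abs_two]; linarith [abs_nonneg t]
    have e1 : dedekindZeta K ((1 + x : ℝ) + (2 * t : ℝ) * I) = dedekindZeta K ((1 + x : ℝ) + 2 * t * I) := by push_cast; rfl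
    have e2 : dedekindZeta K ((1 + x : ℝ) + (0 : ℝ) * I) = dedekindZeta K ((1 + x : ℝ)) := by simp
    rw [e1, e2]
    simp only [ofReal_zero, zero_mul, add_zero, Complex.norm_real, norm_inv, norm_of_nonneg hx.le] at h341 ⊢
    calc |t| ^ 5 = |t| ^ 4 * |t| * 1 := by ring
      _ ≤ ‖(x:ℂ) + t * I‖ ^ 4 * ‖(x:ℂ) + (2 * t : ℝ) * I‖ * (‖dedekindZeta K (1 + x : ℝ)‖ ^ 3 * ‖dedekindZeta K ((1 + x : ℝ) + t * I)‖ ^ 4 * ‖dedekindZeta K ((1 + x : ℝ) + 2 * t * I)‖) := by gcongr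
      _ = _ := by
        field_simp
  have := ge_of_tendsto hlim hlow
  have h5 : 0 < |t| ^ 5 := by positivity
  linarith
lemma H_conj (H : ℂ → ℂ) (hd : Differentiable ℂ H) (hH : ∀ s : ℂ, 1 < s.re → H s = (s - 1) * dedekindZeta K s) (s : ℂ) :
    H (conj s) = conj (H s) := by
  let g : ℂ → ℂ := fun s => conj (H (conj s))
  have hg : Differentiable ℂ g := fun s => by
    have := (hd (conj s)).conj_conj
    rw [Complex.conj_conj] at this
    exact this
  have h1 : ∀ s : ℂ, 1 < s.re → H s = g s := by
    refine eq_of_real H g hd.differentiableOn hg.differentiableOn fun s hs => ?_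
    simp only [g, Complex.conj_ofReal]
    rw [hH s (by simpa using hs), zr_eq K s hs]
    simp
  have h2 : H = g := by
    refine AnalyticOnNhd.eq_of_eventuallyEq (𝕜 := ℂ) (z₀ := 2) (fun z _ => hd.analyticAt z) (fun z _ => hg.analyticAt z) ?_
    filter_upwards [isOpen_re.mem_nhds (show (2:ℂ) ∈ {s : ℂ | 1 < s.re} by simp)] with s hs
    exact h1 s hs
  have := congrFun h2 (conj s)
  simpa [g] using this
end
end
section
open Metric
open Complex (exp)
lemma logDeriv_bound (G : ℂ → ℂ) (c : ℂ) (R M : ℝ) (hR : 0 < R) (hd : DifferentiableOn ℂ G (ball c R))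
    (hne : ∀ z ∈ ball c R, G z ≠ 0) (hM : 0 < M) (hb : ∀ z ∈ ball c R, ‖G z‖ ≤ Real.exp M * ‖G c‖) :
    ∀ z ∈ closedBall c (3 / 4 * R), ‖logDeriv G z‖ ≤ 112 * M / R := by
  have hc : c ∈ ball c R := mem_ball_self hR
  obtain ⟨L, hL0, hL⟩ := (((hd.deriv isOpen_ball).div hd hne).isExactOn_ball).with_val_at c 0
  have hconst : ∀ z ∈ ball c R, G z * exp (-L z) = G c * exp (-L c) := by
    intro z hz
    have hder : ∀ z ∈ ball c R, HasDerivAt (fun z => G z * exp (-L z)) 0 z := by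
      intro z hz
      have h1 := (hd.differentiableAt (isOpen_ball.mem_nhds hz)).hasDerivAt
      have h2 := ((hL z hz).neg).cexp
      convert! h1.mul h2 using 1
      have := hne z hz
      simp only [Pi.div_apply, Pi.neg_apply]
      field_simp
      ring
    exact isOpen_ball.is_const_of_deriv_eq_zero (convex_ball c R).isPreconnected
      (fun s hs => (hder s hs).differentiableAt.differentiableWithinAt) (fun s hs => (hder s hs).deriv) hz hc
  have hre : ∀ z ∈ ball c R, (L z).re ≤ M := by
    intro z hz
    have h1 := hconst z hz
    rw [hL0, neg_zero, Complex.exp_zero, mul_one] at h1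
    have h2 : G z = G c * exp (L z) := by
      rw [← h1, mul_assoc, ← Complex.exp_add, neg_add_cancel, Complex.exp_zero, mul_one]
    have h3 := hb z hz
    rw [h2, norm_mul, Complex.norm_exp, mul_comm] at h3
    have h4 := le_of_mul_le_mul_right h3 (norm_pos_iff.mpr (hne c hc))
    exact Real.exp_le_exp.mp h4
  have hmap : ∀ w ∈ ball (0:ℂ) R, c + w ∈ ball c R := by
    simp
  have hbc : ∀ z ∈ closedBall c (7 / 8 * R), ‖L z‖ ≤ 14 * M := by
    intro z hz
    rw [mem_closedBall, dist_eq_norm] at hz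
    have h := Complex.borelCaratheodory_zero (f := fun w => L (c + w)) (R := R) (z := z - c) hM ?_ (fun w hw => hre _ (hmap w hw)) hR ?_ ?_
    · simp only [add_sub_cancel] at h
      refine h.trans ?_
      rw [div_le_iff₀ bl]
      nlinarith
    · intro w hw
      have h1 := (hL (c + w) (hmap w hw)).comp_const_add c w
      exact h1.differentiableAt.differentiableWithinAt
    · rw [mem_ball_zero_iff]; linarith
    · simp [*]
  intro z hz
  rw [mem_closedBall] at hz
  have hsub : ∀ w, dist w z ≤ R / 8 → dist w c ≤ 7 / 8 * R := fun w hw => by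
    have := dist_triangle w z c; linarith
  have h := Complex.norm_deriv_le_of_forall_mem_sphere_norm_le (f := L) (c := z) (R := R / 8) (C := 14 * M) bp ?_ ?_
  · rw [(hL z (by rw [mem_ball]; linarith)).deriv] at h
    refine h.trans (le_of_eq ?_)
    field_simp
    norm_num
  · refine DifferentiableOn.diffContOnCl ?_
    intro w hw
    have hw := closure_ball_subset_closedBall hw
    exact (hL w (by rw [mem_ball]; have := hsub w hw; linarith)).differentiableAt.differentiableWithinAt
  · intro w hw
    exact hbc w (hsub w (by rw [mem_sphere.mp hw]))
end
section
open Real NumberField Module Filter MeasureTheory Set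
open scoped Classical Topology ArithmeticFunction
section
open Complex (I continuous_ofReal)
lemma ker_int (φ : ℝ → ℂ) (B : ℝ) (hc : Continuous φ) (hb : ∀ t, ‖φ t‖ ≤ B * (1 + t ^ 2)⁻¹) : Integrable φ :=
  (integrable_inv_one_add_sq.const_mul B).mono' hc.aestronglyMeasurable (Eventually.of_forall hb)
lemma norm_sq_line (c t : ℝ) (hc : 1 ≤ c) : 1 + t ^ 2 ≤ ‖(c:ℂ) + t * I‖ ^ 2 := by
  rw [← Complex.normSq_eq_norm_sq, Complex.normSq_apply]
  simp; nlinarith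
lemma line_ne (c t : ℝ) (hc : 1 ≤ c) : (c:ℂ) + t * I ≠ 0 := by
  intro h
  have := congrArg Complex.re h
  simp at this; linarith
lemma line_ne1 (c t : ℝ) (hc : 1 < c) : (c:ℂ) + t * I - 1 ≠ 0 := by
  intro h
  have := congrArg Complex.re h
  simp at this; linarith
lemma mellin_log (s : ℂ) (hs : 0 < s.re) :
    HasMellin (fun t : ℝ => ((max (-log t) 0 : ℝ) : ℂ)) s (1 / s ^ 2) := by
  set f : ℝ → ℂ := indicator (Ioc 0 1) (fun _ => 1) with hf
  have hm : ∀ s : ℂ, 0 < s.re → mellin f s = 1 / s := fun s hs => (hasMellin_one_Ioc hs).2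
  have hint : Integrable f := (integrable_indicator_iff measurableSet_Ioc).mpr (by simp)
  have o1 : f =O[atTop] fun x => x ^ (-(s.re + 1)) := by
    refine Asymptotics.IsBigO.of_bound 0 ?_
    filter_upwards [eventually_gt_atTop 1] with t ht
    simp [hf, indicator, ht.not_ge]
  have o2 : f =O[𝓝[>] 0] fun x => x ^ (-(0:ℝ)) := by
    refine Asymptotics.IsBigO.of_bound 1 ?_
    filter_upwards with t
    simp only [hf, indicator]
    split_ifs <;> simp
  obtain ⟨h1, h2⟩ := mellin_hasDerivAt_of_isBigO_rpow (f := f) (a := s.re + 1) (b := 0) (s := s)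
    (hint.locallyIntegrable.locallyIntegrableOn _) o1 bl o2 hs
  · have h3 : HasDerivAt (mellin f) (-(1 / s ^ 2)) s := by
      have h4 : HasDerivAt (fun s : ℂ => s⁻¹) (-(s ^ 2)⁻¹) s := hasDerivAt_inv (by rintro rfl; simp at hs)
      rw [one_div]
      refine h4.congr_of_eventuallyEq ?_
      filter_upwards [(isOpen_lt continuous_const Complex.continuous_re).mem_nhds hs] with z hz
      rw [hm z hz, one_div]
    have h5 := h2.unique h3
    have e : EqOn (fun t : ℝ => -(log t • f t)) (fun t : ℝ => ((max (-log t) 0 : ℝ) : ℂ)) (Ioi 0) := by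
      intro t ht
      simp only [hf, indicator]
      split_ifs with h
      · rw [max_eq_left]
        · simp
        · have := log_nonpos ht.le h.2; linarith
      · have : 1 < t := by
          grind
        rw [max_eq_right]
        · simp
        · have := log_pos this; linarith
    have h6 : HasMellin (fun t : ℝ => -(log t • f t)) s (1 / s ^ 2) := by
      have h7 : HasMellin (fun t : ℝ => log t • f t) s (-(1 / s ^ 2)) := ⟨h1, h5⟩
      have := hasMellin_const_smul h7.1 (-1 : ℂ)
      rw [h7.2] at this
      simpa using this
    refine ⟨?_, ?_⟩
    · refine IntegrableOn.congr_fun h6.1 (fun t ht => ?_) measurableSet_Ioi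
      have := e ht
      rw [← this]
    · rw [← h6.2]
      refine setIntegral_congr_fun measurableSet_Ioi fun t ht => ?_
      have := e ht
      rw [← this]
lemma perron_log (c y : ℝ) (hc : 1 ≤ c) (hy : 0 < y) :
    ∫ t : ℝ, (y:ℂ) ^ (c ~~ t) / (c ~~ t) ^ 2 = 2 * (π:ℂ) * ((max (log y) 0 : ℝ) : ℂ) := by
  have hre : ∀ t : ℝ, 0 < (c ~~ t).re := by simp; linarith
  have h := mellinInv_mellin_eq c (fun t : ℝ => ((max (-log t) 0 : ℝ) : ℂ)) (x := y⁻¹) bp ((mellin_log c (by simp; linarith)).1) ?_ ?_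
  · rw [mellinInv] at h
    rw [log_inv, neg_neg] at h
    rw [← h]
    have e : ∀ t : ℝ, (((y⁻¹ : ℝ) : ℂ) ^ (-(c ~~ t)) • mellin (fun t : ℝ => ((max (-log t) 0 : ℝ) : ℂ)) (c ~~ t)) = (y:ℂ) ^ (c ~~ t) / (c ~~ t) ^ 2 := by
      intro t
      rw [(mellin_log _ (hre t)).2, smul_eq_mul, mul_one_div, Complex.ofReal_inv, Complex.inv_cpow _ _ (by rw [Complex.arg_ofReal_of_nonneg hy.le]; exact pi_pos.ne), Complex.cpow_neg, inv_inv]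
    simp only [e]
    rw [Complex.real_smul, ← mul_assoc]
    rw [show (2 * (π:ℂ)) * ((1 / (2 * π) : ℝ) : ℂ) = 1 by push_cast; field_simp, one_mul]
  · rw [Complex.VerticalIntegrable]
    have e : (fun t : ℝ => mellin (fun t : ℝ => ((max (-log t) 0 : ℝ) : ℂ)) (c ~~ t)) = fun t : ℝ => 1 / (c ~~ t) ^ 2 := by
      ext t; exact (mellin_log _ (hre t)).2
    rw [e]
    refine ker_int _ 1 ?_ fun t => ?_
    · refine Continuous.div continuous_const bf fun t => pow_ne_zero _ (line_ne c t hc)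
    · rw [norm_div, norm_pow, norm_one, one_div, one_mul]
      exact inv_anti₀ bp (norm_sq_line c t hc)
  · have : ContinuousAt (fun t : ℝ => max (-log t) 0) y⁻¹ := by
      have := (continuousAt_log (x := y⁻¹) bp).neg
      exact this.max continuousAt_const
    exact continuous_ofReal.continuousAt.comp this
lemma perron_main (c x : ℝ) (hc : 1 < c) (hx : 1 < x) :
    ∫ t : ℝ, (x:ℂ) ^ (c ~~ t) / (((c:ℂ) + t * I - 1) * (c ~~ t) ^ 2) = 2 * (π:ℂ) * ((x - 1 - log x : ℝ) : ℂ) := by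
  set f : ℝ → ℂ := fun t => (Ioc 0 1).indicator (fun t : ℝ => (t:ℂ) ^ (-1:ℂ)) t - (Ioc 0 1).indicator (fun _ => 1) t - ((max (-log t) 0 : ℝ) : ℂ) with hf
  have hM : ∀ s : ℂ, 1 < s.re → HasMellin f s (1 / ((s - 1) * s ^ 2)) := by
    intro s hs
    have h1 := hasMellin_cpow_Ioc (-1) (s := s) (by simp; linarith)
    have h2 := hasMellin_one_Ioc (s := s) bl
    have h3 := mellin_log s bl
    have h4 := hasMellin_sub h1.1 h2.1
    have h5 := hasMellin_sub h4.1 h3.1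
    rw [h4.2, h1.2, h2.2, h3.2] at h5
    have hs0 : s ≠ 0 := by rintro rfl; simp at hs; linarith
    have hs1 : s - 1 ≠ 0 := by
      intro h
      rw [sub_eq_zero] at h; rw [h] at hs; simp at hs
    convert! h5 using 1
    rw [← sub_eq_add_neg]
    field_simp
    ring
  have hre : ∀ t : ℝ, 1 < (c ~~ t).re := by intro t; simp; linarith
  have hx0 : 0 < x := by linarith
  have hx1 : x⁻¹ < 1 := inv_lt_one_of_one_lt₀ hx
  have hxi : 0 < x⁻¹ := by positivity
  have h := mellinInv_mellin_eq c f (x := x⁻¹) hxi ((hM c (by simpa using hc)).1) ?_ ?_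
  · have ev : f x⁻¹ = ((x - 1 - log x : ℝ) : ℂ) := by
      simp only [hf]
      rw [indicator_of_mem (show x⁻¹ ∈ Ioc (0:ℝ) 1 from ⟨hxi, hx1.le⟩), indicator_of_mem (show x⁻¹ ∈ Ioc (0:ℝ) 1 from ⟨hxi, hx1.le⟩), log_inv, neg_neg, max_eq_left (log_pos hx).le, Complex.cpow_neg_one]
      push_cast; rw [inv_inv]
    rw [mellinInv, ev] at h
    rw [← h]
    have e : ∀ t : ℝ, (((x⁻¹ : ℝ) : ℂ) ^ (-(c ~~ t)) • mellin f (c ~~ t)) = (x:ℂ) ^ (c ~~ t) / (((c:ℂ) + t * I - 1) * (c ~~ t) ^ 2) := by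
      intro t
      rw [(hM _ (hre t)).2, smul_eq_mul, mul_one_div, Complex.ofReal_inv, Complex.inv_cpow _ _ (by rw [Complex.arg_ofReal_of_nonneg hx0.le]; exact pi_pos.ne), Complex.cpow_neg, inv_inv]
    simp only [e]
    have hpi : (π:ℂ) ≠ 0 := by exact_mod_cast pi_ne_zero
    rw [Complex.real_smul, ← mul_assoc]
    rw [show (2 * (π:ℂ)) * ((1 / (2 * π) : ℝ) : ℂ) = 1 by push_cast; field_simp, one_mul]
  · rw [Complex.VerticalIntegrable]
    have e : (fun t : ℝ => mellin f (c ~~ t)) = fun t : ℝ => 1 / (((c:ℂ) + t * I - 1) * (c ~~ t) ^ 2) := by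
      ext t; exact (hM _ (hre t)).2
    rw [e]
    refine ker_int _ (c - 1)⁻¹ ?_ fun t => ?_
    · exact Continuous.div continuous_const bf fun t => mul_ne_zero (line_ne1 c t hc) (pow_ne_zero _ (line_ne c t hc.le))
    · rw [norm_div, norm_mul, norm_pow, norm_one, one_div, mul_inv]
      have h1 : c - 1 ≤ ‖(c:ℂ) + t * I - 1‖ := by
        have := Complex.re_le_norm ((c:ℂ) + t * I - 1)
        simpa using this
      have h2 := norm_sq_line c t hc.le
      have h3 : 0 < c - 1 := by linarith
      gcongr
  · have h1 : f =ᶠ[𝓝 x⁻¹] fun t : ℝ => ((t:ℂ))⁻¹ - 1 - ((max (-log t) 0 : ℝ) : ℂ) := by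
      filter_upwards [Ioo_mem_nhds hxi hx1] with t ht
      simp only [hf]
      rw [indicator_of_mem (show t ∈ Ioc (0:ℝ) 1 from ⟨ht.1, ht.2.le⟩), indicator_of_mem (show t ∈ Ioc (0:ℝ) 1 from ⟨ht.1, ht.2.le⟩), Complex.cpow_neg_one]
    refine ContinuousAt.congr ?_ h1.symm
    have h2 : ContinuousAt (fun t : ℝ => max (-log t) 0) x⁻¹ :=
      (continuousAt_log (x := x⁻¹) hxi.ne').neg.max continuousAt_const
    refine ContinuousAt.sub (ContinuousAt.sub (ContinuousAt.inv₀ continuous_ofReal.continuousAt ?_) continuousAt_const) (continuous_ofReal.continuousAt.comp h2)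
    exact_mod_cast hxi.ne'
end
section
open Complex (I)
open LSeries (term)
section
variable (K : Type*) [Field K] [NumberField K]
def psi1 (x : ℝ) : ℝ := ∑' n : ℕ, lam K n * max (log (x / n)) 0
lemma H_logDeriv (H : ℂ → ℂ) (hH : ∀ s : ℂ, 1 < s.re → H s = (s - 1) * dedekindZeta K s) (s : ℂ) (hs : 1 < s.re) :
    logDeriv H s = 1 / (s - 1) - LSeries (fun n => (lam K n : ℂ)) s := by
  have h1 : s - 1 ≠ 0 := by
    intro h
    rw [sub_eq_zero] at h; rw [h] at hs; simp at hs
  have hz : dedekindZeta K s ≠ 0 := by rw [zeta_exp K s hs]; exact Complex.exp_ne_zero _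
  have e : H =ᶠ[𝓝 s] fun s => (s - 1) * dedekindZeta K s := by
    filter_upwards [isOpen_re.mem_nhds hs] with z hz using hH z hz
  rw [logDeriv_apply, e.deriv_eq, e.eq_of_nhds, ← logDeriv_apply,
    logDeriv_mul (f := fun s => s - 1) s h1 hz bf ((zeta_diff K).differentiableAt (isOpen_re.mem_nhds hs)),
    logDeriv_apply, logDeriv_apply, zeta_dlog K s hs]
  simp only [deriv_sub_const, deriv_id'']
  field_simp
  ring
lemma psi1_formula (H : ℂ → ℂ) (hd : Differentiable ℂ H) (hH : ∀ s : ℂ, 1 < s.re → H s = (s - 1) * dedekindZeta K s)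
    (c x : ℝ) (hc : 1 < c) (hx : 1 < x) :
    Integrable (fun t : ℝ => logDeriv H (c ~~ t) * ((x:ℂ) ^ (c ~~ t) / (c ~~ t) ^ 2)) ∧
    ∫ t : ℝ, logDeriv H (c ~~ t) * ((x:ℂ) ^ (c ~~ t) / (c ~~ t) ^ 2) =
      2 * (π:ℂ) * ((x - 1 - log x - psi1 K x : ℝ) : ℂ) := by
  have hx0 : 0 < x := by linarith
  have hre : ∀ t : ℝ, 1 < (c ~~ t).re := by simp [*]
  have hxn : ∀ t : ℝ, ‖(x:ℂ) ^ (c ~~ t)‖ = x ^ c := by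
    intro t; rw [Complex.norm_cpow_eq_rpow_re_of_pos hx0]; simp
  have hxc : Continuous fun t : ℝ => (x:ℂ) ^ (c ~~ t) :=
    Continuous.const_cpow bf (Or.inl (by aesop))
  have hkc : Continuous fun t : ℝ => (x:ℂ) ^ (c ~~ t) / (c ~~ t) ^ 2 :=
    hxc.div bf fun t => pow_ne_zero _ (line_ne c t hc.le)
  have hkb : ∀ t : ℝ, ‖(x:ℂ) ^ (c ~~ t) / (c ~~ t) ^ 2‖ ≤ x ^ c * (1 + t ^ 2)⁻¹ := by
    intro t
    rw [norm_div, hxn, norm_pow, div_eq_mul_inv]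
    gcongr
    exact norm_sq_line c t hc.le
  have hki := ker_int _ _ hkc hkb
  set F : ℕ → ℝ → ℂ := fun n t => term (fun n => (lam K n : ℂ)) (c ~~ t) n * ((x:ℂ) ^ (c ~~ t) / (c ~~ t) ^ 2) with hF
  have hFe : ∀ n : ℕ, n ≠ 0 → ∀ t : ℝ, F n t = (lam K n : ℂ) * ((((x / n : ℝ)) : ℂ) ^ (c ~~ t) / (c ~~ t) ^ 2) := by
    intro n hn t
    have hn' : (0:ℝ) < n := by positivity
    simp only [hF]
    rw [LSeries.term_of_ne_zero hn, Complex.ofReal_div, Complex.div_cpow_ofReal_nonneg hx0.le hn'.le]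
    have h2 : ((n:ℝ):ℂ) ^ (c ~~ t) ≠ 0 := by
      simp [*]
    push_cast at h2 ⊢
    field_simp
  have hF0 : ∀ t, F 0 t = 0 := by simp [*]
  have hnt : ∀ (n : ℕ) (t : ℝ), ‖term (fun n => (lam K n : ℂ)) (c ~~ t) n‖ = ‖term (fun n => (lam K n : ℂ)) (c:ℂ) n‖ := by
    intro n t
    rw [LSeries.norm_term_eq, LSeries.norm_term_eq]; simp
  have hFn : ∀ (n : ℕ) (t : ℝ), ‖F n t‖ = ‖term (fun n => (lam K n : ℂ)) (c:ℂ) n‖ * ‖(x:ℂ) ^ (c ~~ t) / (c ~~ t) ^ 2‖ := by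
    simp [*]
  have hFc : ∀ n, Continuous (F n) := by
    intro n
    rcases eq_or_ne n 0 with rfl | hn
    · have : F 0 = fun _ => 0 := funext hF0
      rw [this]; exact continuous_const
    · simp only [hF, LSeries.term_of_ne_zero hn]
      refine Continuous.mul (Continuous.div continuous_const ?_ fun t => ?_) hkc
      · exact Continuous.const_cpow bf (Or.inl bp)
      · simp [*]
  have hFi : ∀ n, Integrable (F n) := by
    intro n
    refine (hki.norm.const_mul ‖term (fun n => (lam K n : ℂ)) (c:ℂ) n‖).mono' (hFc n).aestronglyMeasurable (Eventually.of_forall fun t => ?_)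
    rw [hFn]
  have hS := (lam_summable K (c:ℂ) (by simpa using hc)).norm
  have hsum : Summable fun n => ∫ t, ‖F n t‖ := by
    simp only [hFn, integral_const_mul]
    exact hS.mul_right _
  have h1 := hasSum_integral_of_summable_integral_norm hFi hsum
  have hval : ∀ n, ∫ t, F n t = 2 * (π:ℂ) * ((lam K n * max (log (x / n)) 0 : ℝ) : ℂ) := by
    intro n
    rcases eq_or_ne n 0 with rfl | hn
    · simp [hF0]
    · simp only [hFe n hn, integral_const_mul]
      rw [perron_log c (x / n) hc.le bp]
      push_cast; ring
  simp only [hval] at h1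
  have hL : ∀ t : ℝ, ∑' n, F n t = LSeries (fun n => (lam K n : ℂ)) (c ~~ t) * ((x:ℂ) ^ (c ~~ t) / (c ~~ t) ^ 2) := by
    intro t
    rw [tsum_mul_right, LSeries]
  simp only [hL] at h1
  have hpsi : 2 * (π:ℂ) * ((psi1 K x : ℝ) : ℂ) = ∫ t : ℝ, LSeries (fun n => (lam K n : ℂ)) (c ~~ t) * ((x:ℂ) ^ (c ~~ t) / (c ~~ t) ^ 2) := by
    rw [← h1.tsum_eq, psi1, Complex.ofReal_tsum, tsum_mul_left]
  have hlc : Continuous fun t : ℝ => logDeriv H (c ~~ t) := by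
    have hdc : Continuous (deriv H) := (hd.contDiff (n := 1)).continuous_deriv le_rfl
    exact (hdc.comp bf).div (hd.continuous.comp bf) fun t => H_ne_gt K H hH _ (hre t)
  have hmc : Continuous fun t : ℝ => 1 / ((c:ℂ) + t * I - 1) :=
    continuous_const.div bf fun t => line_ne1 c t hc
  have hmn : ∀ t : ℝ, ‖1 / ((c:ℂ) + t * I - 1)‖ ≤ (c - 1)⁻¹ := by
    intro t
    rw [norm_div, norm_one, one_div]
    refine inv_anti₀ bl ?_
    have := Complex.re_le_norm ((c:ℂ) + t * I - 1)
    simpa using this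
  have hLS : ∀ t : ℝ, LSeries (fun n => (lam K n : ℂ)) (c ~~ t) = 1 / ((c:ℂ) + t * I - 1) - logDeriv H (c ~~ t) := by
    intro t
    rw [H_logDeriv K H hH _ (hre t)]; ring
  have hLSn : ∀ t : ℝ, ‖LSeries (fun n => (lam K n : ℂ)) (c ~~ t)‖ ≤ ∑' n, ‖term (fun n => (lam K n : ℂ)) (c:ℂ) n‖ := by
    intro t
    refine tsum_of_norm_bounded hS.hasSum fun n => (hnt n t).le
  have i1 : Integrable (fun t : ℝ => 1 / ((c:ℂ) + t * I - 1) * ((x:ℂ) ^ (c ~~ t) / (c ~~ t) ^ 2)) := by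
    refine (hki.norm.const_mul (c - 1)⁻¹).mono' (hmc.mul hkc).aestronglyMeasurable (Eventually.of_forall fun t => ?_)
    rw [norm_mul]; gcongr; exact hmn t
  have i2 : Integrable (fun t : ℝ => LSeries (fun n => (lam K n : ℂ)) (c ~~ t) * ((x:ℂ) ^ (c ~~ t) / (c ~~ t) ^ 2)) := by
    refine (hki.norm.const_mul (∑' n, ‖term (fun n => (lam K n : ℂ)) (c:ℂ) n‖)).mono' (Continuous.mul ?_ hkc).aestronglyMeasurable (Eventually.of_forall fun t => ?_)
    · simp only [hLS]; exact hmc.sub hlc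
    · rw [norm_mul]; gcongr; exact hLSn t
  have e : (fun t : ℝ => logDeriv H (c ~~ t) * ((x:ℂ) ^ (c ~~ t) / (c ~~ t) ^ 2)) = fun t : ℝ => 1 / ((c:ℂ) + t * I - 1) * ((x:ℂ) ^ (c ~~ t) / (c ~~ t) ^ 2) - LSeries (fun n => (lam K n : ℂ)) (c ~~ t) * ((x:ℂ) ^ (c ~~ t) / (c ~~ t) ^ 2) := by
    ext t
    rw [H_logDeriv K H hH _ (hre t)]; ring
  rw [e]
  refine ⟨i1.sub i2, ?_⟩
  rw [integral_sub i1 i2, ← hpsi]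
  have e2 := perron_main c x hc hx
  have e3 : ∫ t : ℝ, 1 / ((c:ℂ) + t * I - 1) * ((x:ℂ) ^ (c ~~ t) / (c ~~ t) ^ 2) = 2 * (π:ℂ) * ((x - 1 - log x : ℝ) : ℂ) := by
    rw [← e2]
    congr 1
    ext t
    rw [div_mul_div_comm, one_mul]
  rw [e3]
  push_cast; ring
end
end
section
open Complex (I norm_real)
section
variable (K : Type*) [Field K] [NumberField K]
lemma lam_norm (s : ℂ) (X : ℝ) (hX : 0 < X) (hs : s.re = 1 + 1 / X) :
    ‖LSeries (fun n => (lam K n : ℂ)) s‖ ≤ dg K * (4 * X ^ 2) := by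
  have hX1 : 0 < 1 / (2 * X) := by positivity
  have hX2 : 1 / X = 2 * (1 / (2 * X)) := by field_simp
  have hs1 : 1 < s.re := by rw [hs]; linarith
  have h := lam_summable K s hs1
  have hb : ∀ n : ℕ, ‖LSeries.term (fun n => (lam K n : ℂ)) s (n + 2)‖ ≤ dg K * (2 * X) * ((n:ℝ) + 2) ^ (-(1 + 1 / (2 * X))) := by
    intro n
    have h0 : (0:ℝ) < (n:ℝ) + 2 := by positivity
    rw [LSeries.norm_term_eq, if_neg (by omega), norm_real, norm_of_nonneg (lam_nonneg K _), div_eq_mul_inv,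
      ← rpow_neg bp]
    have h1 : lam K (n + 2) ≤ dg K * (2 * X * ((n:ℝ) + 2) ^ (1 / (2 * X))) := by
      refine (lam_le K _).trans (mul_le_mul_of_nonneg_left ?_ bp)
      refine ArithmeticFunction.vonMangoldt_le_log.trans ?_
      have := log_le_rpow_div h0.le hX1
      push_cast; linarith
    have e : ((n + 2 : ℕ) : ℝ) ^ (-s.re) * ((n:ℝ) + 2) ^ (1 / (2 * X)) = ((n:ℝ) + 2) ^ (-(1 + 1 / (2 * X))) := by
      push_cast
      rw [← rpow_add h0, hs, hX2]; ring
    calc _ ≤ dg K * (2 * X * ((n:ℝ) + 2) ^ (1 / (2 * X))) * ((n + 2 : ℕ) : ℝ) ^ (-s.re) := by gcongr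
      _ = _ := by rw [← e]; ring
  have hs2 : Summable fun n : ℕ => ((n:ℝ) + 2) ^ (-(1 + 1 / (2 * X))) := by
    have := (summable_nat_add_iff 2).mpr (summable_nat_rpow (p := -(1 + 1 / (2 * X))) |>.mpr bl)
    simpa using this
  rw [LSeries, ← h.sum_add_tsum_nat_add 2]
  simp only [Finset.sum_range_succ, Finset.sum_range_zero, LSeries.term_zero]
  have e0 : lam K 1 = 0 := le_antisymm (by simpa using lam_le K 1) (lam_nonneg K 1)
  have e1 : LSeries.term (fun n => (lam K n : ℂ)) s 1 = 0 := by simp [*]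
  rw [e1, add_zero, add_zero, zero_add]
  refine (tsum_of_norm_bounded (hs2.mul_left _).hasSum hb).trans ?_
  rw [tsum_mul_left]
  have h3 := sum_rpow_le (1 + 1 / (2 * X)) bl
  have h4 : 1 / (1 + 1 / (2 * X) - 1) = 2 * X := by simp
  rw [h4] at h3
  calc _ ≤ (dg K : ℝ) * (2 * X) * (2 * X) := by gcongr
    _ = _ := by ring
lemma tail_int (T : ℝ) (hT : 0 < T) : ∫ t in (Ioc (-T) T)ᶜ, (1 + t ^ 2)⁻¹ ≤ 2 / T := by
  have h := integral_add_compl (μ := volume) (measurableSet_Ioc (a := -T) (b := T)) integrable_inv_one_add_sq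
  rw [integral_univ_inv_one_add_sq, ← intervalIntegral.integral_of_le bl, integral_inv_one_add_sq, arctan_neg] at h
  have h1 := arctan_inv_of_pos hT
  have h2 : arctan T⁻¹ ≤ T⁻¹ := by
    have := le_tan (x := arctan T⁻¹) (arctan_nonneg.mpr bp) (arctan_lt_pi_div_two _)
    rwa [tan_arctan] at this
  rw [div_eq_mul_inv]; linarith
lemma psi1_err (H : ℂ → ℂ) (hd : Differentiable ℂ H) (hH : ∀ s : ℂ, 1 < s.re → H s = (s - 1) * dedekindZeta K s)
    (X η T B : ℝ) (hX : 1 ≤ X) (hη : 0 < η) (hη1 : η ≤ 1 / 4) (hXη : 1 / X ≤ η) (hT : 1 ≤ T) (hB : 0 ≤ B)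
    (hb : ∀ s : ℂ, 1 - η / 2 ≤ s.re → s.re ≤ 1 + η → |s.im| ≤ T → H s ≠ 0 ∧ ‖logDeriv H s‖ ≤ B) :
    |exp X - 1 - X - psi1 K (exp X)| ≤ exp X * (B * exp (-(η / 2 * X)) + B / T ^ 2 + 5 * dg K * X ^ 2 / T) := by
  set x := exp X with hxd
  have hx1 : 1 < x := by exact one_lt_exp_iff.mpr bl
  have hx0 : 0 < x := by linarith
  set c : ℝ := 1 + 1 / X with hcd
  set a : ℝ := 1 - η / 2 with had
  have hX0 : 0 < 1 / X := by positivity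
  have hc : 1 < c := by rw [hcd]; linarith
  have hac : a ≤ c := by linarith
  obtain ⟨hi, he⟩ := psi1_formula K H hd hH c x hc hx1
  have hlx : log x = X := by rw [hxd, log_exp]
  rw [hlx] at he
  set k : ℂ → ℂ := fun s => logDeriv H s * ((x:ℂ) ^ s / s ^ 2) with hk
  have hxn : ∀ s : ℂ, ‖(x:ℂ) ^ s‖ = x ^ s.re := fun s => Complex.norm_cpow_eq_rpow_re_of_pos hx0 s
  have hxc : x ^ c = exp 1 * x := by
    rw [hxd, ← exp_mul, ← exp_add, hcd]; field_simp; ring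
  have he1 : exp 1 < 2.7182818286 := exp_one_lt_d9
  have hd1 : (1:ℝ) ≤ dg K := by exact_mod_cast (finrank_pos : 0 < dg K)
  have hsq : ∀ s : ℂ, 7 / 8 ≤ s.re → (1 + s.im ^ 2) / 2 ≤ ‖s‖ ^ 2 := by
    intro s hs
    rw [Complex.sq_norm, Complex.normSq_apply]; nlinarith [sq_nonneg s.im]
  have hlin : ∀ u t : ℝ, (u ~~ t).re = u ∧ (u ~~ t).im = t := by simp
  have ht : ‖∫ t in (Ioc (-T) T)ᶜ, k (c ~~ t)‖ ≤ 5 * dg K * X ^ 2 * (exp 1 * x) * (2 / T) := by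
    have hbt : ∀ t : ℝ, ‖k (c ~~ t)‖ ≤ 5 * dg K * X ^ 2 * (exp 1 * x) * (1 + t ^ 2)⁻¹ := by
      intro t
      have h1 : ‖logDeriv H (c ~~ t)‖ ≤ 5 * dg K * X ^ 2 := by
        rw [H_logDeriv K H hH _ (by rw [(hlin c t).1]; exact hc)]
        refine (norm_sub_le _ _).trans ?_
        have h2 := lam_norm K (c ~~ t) X bl (hlin c t).1
        have h3 : ‖1 / ((c:ℂ) + t * I - 1)‖ ≤ X := by
          rw [norm_div, norm_one]
          have h4 : 1 / X ≤ ‖(c:ℂ) + t * I - 1‖ := by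
            refine le_trans ?_ (Complex.re_le_norm _)
            simp [hcd]
          rw [div_le_iff₀ bl]
          rw [div_le_iff₀ bl] at h4
          linarith
        have h5 : X ≤ dg K * X ^ 2 := by nlinarith
        linarith
      rw [norm_mul, norm_div, hxn, (hlin c t).1, hxc, norm_pow, div_eq_mul_inv, ← mul_assoc]
      gcongr
      exact norm_sq_line c t hc.le
    have := norm_integral_le_of_norm_le (μ := volume.restrict (Ioc (-T) T)ᶜ) (integrable_inv_one_add_sq.integrableOn.const_mul (5 * dg K * X ^ 2 * (exp 1 * x))) (Eventually.of_forall hbt)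
    refine this.trans ?_
    rw [integral_const_mul]
    gcongr
    exact tail_int T bl
  have hdiff : DifferentiableOn ℂ k (uIcc a c ×ℂ uIcc (-T) T) := by
    intro s hs
    rw [Complex.mem_reProdIm, uIcc_of_le hac, uIcc_of_le bl] at hs
    have h0 := (hb s hs.1.1 (hs.1.2.trans (by rw [hcd]; linarith)) (abs_le.mpr hs.2)).1
    have hs0 : s ≠ 0 := by
      rintro rfl
      have := hs.1.1; simp at this; linarith
    refine DifferentiableAt.differentiableWithinAt ?_
    refine DifferentiableAt.mul ?_ (DifferentiableAt.div ?_ bf (pow_ne_zero _ hs0))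
    · have : DifferentiableAt ℂ (deriv H) s := by
        fun_prop
      exact this.div (hd s) h0
    · exact DifferentiableAt.const_cpow differentiableAt_id (Or.inl (by simp [*]))
  have hrect := Complex.integral_boundary_rect_eq_zero_of_differentiableOn k ⟨a, -T⟩ ⟨c, T⟩ hdiff
  have hkb : ∀ u t : ℝ, a ≤ u → u ≤ c → |t| ≤ T → ‖k (u ~~ t)‖ ≤ B * x ^ u * (2 * (1 + t ^ 2)⁻¹) := by
    intro u t h1 h2 h3
    have h4 := (hb (u ~~ t) (by rw [(hlin u t).1]; exact h1) (by rw [(hlin u t).1]; linarith) (by simp [*])).2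
    have h5 := hsq (u ~~ t) (by rw [(hlin u t).1]; linarith)
    rw [(hlin u t).2] at h5
    rw [norm_mul, norm_div, hxn, (hlin u t).1, norm_pow, div_eq_mul_inv, ← mul_assoc]
    have h6 : (‖(u:ℂ) + t * I‖ ^ 2)⁻¹ ≤ 2 * (1 + t ^ 2)⁻¹ := by
      refine (inv_anti₀ bp h5).trans (le_of_eq ?_)
      field_simp
    gcongr
  have hhor : ∀ t : ℝ, |t| = T → ‖∫ u : ℝ in a..c, k (u ~~ t)‖ ≤ B * (exp 1 * x) / T ^ 2 := by
    intro t h3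
    refine (intervalIntegral.norm_integral_le_of_norm_le_const (C := B * (exp 1 * x) * (2 / T ^ 2)) fun u hu => ?_).trans ?_
    · rw [uIoc_of_le hac] at hu
      refine (hkb u t hu.1.le hu.2 h3.le).trans ?_
      have h7 : (1 + t ^ 2)⁻¹ ≤ (T ^ 2)⁻¹ := by
        refine inv_anti₀ bp ?_
        rw [← sq_abs t, h3]; linarith
      have h8 : x ^ u ≤ exp 1 * x := by
        rw [← hxc]; exact rpow_le_rpow_of_exponent_le hx1.le hu.2
      rw [div_eq_mul_inv]
      gcongr
    · rw [abs_of_nonneg bl]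
      have : c - a ≤ 1 / 2 := by linarith
      calc _ ≤ B * (exp 1 * x) * (2 / T ^ 2) * (1 / 2) := by gcongr
        _ = _ := by field_simp
  have hleft : ‖∫ t : ℝ in (-T)..T, k (a ~~ t)‖ ≤ B * x ^ a * (2 * π) := by
    have h9 := intervalIntegral.norm_integral_le_of_norm_le (f := fun t : ℝ => k (a ~~ t)) (a := -T) (b := T) (μ := volume) bl
      (g := fun t : ℝ => B * x ^ a * (2 * (1 + t ^ 2)⁻¹)) (Eventually.of_forall fun t ht => hkb a t le_rfl hac (abs_le.mpr ⟨ht.1.le, ht.2⟩))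
      (((integrable_inv_one_add_sq.const_mul 2).const_mul _).intervalIntegrable)
    refine h9.trans ?_
    rw [intervalIntegral.integral_const_mul, intervalIntegral.integral_const_mul, integral_inv_one_add_sq, arctan_neg]
    have := arctan_lt_pi_div_two T
    gcongr
    linarith
  have hxa : x ^ a = x * exp (-(η / 2 * X)) := by
    rw [hxd, ← exp_mul, ← exp_add, had]; ring
  have hR : ‖∫ t : ℝ in (-T)..T, k (c ~~ t)‖ ≤ B * x ^ a * (2 * π) + 2 * (B * (exp 1 * x) / T ^ 2) := by
    have e : I * (∫ t : ℝ in (-T)..T, k (c ~~ t)) = I * (∫ t : ℝ in (-T)..T, k (a ~~ t))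
        + (∫ u : ℝ in a..c, k ((u:ℂ) + (T:ℝ) * I)) - (∫ u : ℝ in a..c, k ((u:ℂ) + (-T:ℝ) * I)) := by
      linear_combination hrect
    have h1 : ‖I * (∫ t : ℝ in (-T)..T, k (c ~~ t))‖ = ‖∫ t : ℝ in (-T)..T, k (c ~~ t)‖ := by
      simp
    rw [← h1, e]
    refine (norm_sub_le _ _).trans ?_
    have h2 := norm_add_le (I * (∫ t : ℝ in (-T)..T, k (a ~~ t))) (∫ u : ℝ in a..c, k ((u:ℂ) + (T:ℝ) * I))
    rw [norm_mul, Complex.norm_I, one_mul] at h2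
    have h3 := hhor T (abs_of_nonneg bl)
    have h4 := hhor (-T) (by rw [abs_neg]; exact abs_of_nonneg bl)
    linarith
  have hsplit := integral_add_compl (μ := volume) (measurableSet_Ioc (a := -T) (b := T)) hi
  rw [he, ← intervalIntegral.integral_of_le bl] at hsplit
  have hfin : 2 * π * |x - 1 - X - psi1 K x| ≤ B * x ^ a * (2 * π) + 2 * (B * (exp 1 * x) / T ^ 2) + 5 * dg K * X ^ 2 * (exp 1 * x) * (2 / T) := by
    have h1 : 2 * π * |x - 1 - X - psi1 K x| = ‖2 * (π:ℂ) * ((x - 1 - X - psi1 K x : ℝ) : ℂ)‖ := by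
      rw [norm_mul, norm_mul, norm_real, norm_real, Complex.norm_ofNat, norm_of_nonneg pi_pos.le, norm_eq_abs]
    rw [h1, ← hsplit]
    exact (norm_add_le _ _).trans (add_le_add hR ht)
  have hpi := pi_gt_three
  have h12 : 2 * π * |x - 1 - X - psi1 K x| ≤ 2 * π * (x * (B * exp (-(η / 2 * X)) + B / T ^ 2 + 5 * dg K * X ^ 2 / T)) := by
    refine hfin.trans ?_
    rw [hxa]
    have e1 : B * (x * exp (-(η / 2 * X))) * (2 * π) + 2 * (B * (exp 1 * x) / T ^ 2) + 5 * dg K * X ^ 2 * (exp 1 * x) * (2 / T) =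
      2 * π * (x * (B * exp (-(η / 2 * X)))) + 2 * exp 1 * (B * x / T ^ 2) + 10 * exp 1 * (dg K * X ^ 2 * x / T) := by ring
    have e2 : 2 * π * (x * (B * exp (-(η / 2 * X)) + B / T ^ 2 + 5 * dg K * X ^ 2 / T)) =
      2 * π * (x * (B * exp (-(η / 2 * X)))) + 2 * π * (B * x / T ^ 2) + 10 * π * (dg K * X ^ 2 * x / T) := by ring
    rw [e1, e2]
    gcongr <;> linarith
  exact le_of_mul_le_mul_left h12 bp
end
end
section
open Complex (re_ofReal_mul)
open Finset (sum_congr)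
open Metric (ball closedBall)
lemma factor_one (H : ℂ → ℂ) (hd : Differentiable ℂ H) (h0 : ∃ z, H z ≠ 0) (ρ : ℂ) :
    ∃ (n : ℕ) (G : ℂ → ℂ), Differentiable ℂ G ∧ (∀ s, H s = (s - ρ) ^ n * G s) ∧ G ρ ≠ 0 := by
  have ha : AnalyticOnNhd ℂ H univ := hd.differentiableOn.analyticOnNhd isOpen_univ
  have h1 : ¬ ∀ᶠ z in 𝓝 ρ, H z = 0 := by
    intro h
    obtain ⟨z, hz⟩ := h0
    exact hz (ha.eqOn_zero_of_preconnected_of_frequently_eq_zero isPreconnected_univ (mem_univ ρ) ((h.filter_mono nhdsWithin_le_nhds).frequently) (mem_univ z))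
  obtain ⟨n, g, hg, hg0, hgz⟩ := (ha ρ (mem_univ _)).exists_eventuallyEq_pow_smul_nonzero_iff.mpr h1
  have e : ∀ᶠ z in 𝓝 ρ, (if z = ρ then g ρ else H z / (z - ρ) ^ n) = g z := by
    filter_upwards [hgz] with z hz
    split_ifs with h
    · rw [h]
    · rw [hz, smul_eq_mul]
      field_simp
  refine ⟨n, fun z => if z = ρ then g ρ else H z / (z - ρ) ^ n, ?_, ?_, by simpa using hg0⟩
  · intro z
    by_cases hz : z = ρ
    · rw [hz]
      exact hg.differentiableAt.congr_of_eventuallyEq e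
    · have e2 : (fun z => if z = ρ then g ρ else H z / (z - ρ) ^ n) =ᶠ[𝓝 z] fun z => H z / (z - ρ) ^ n := by
        filter_upwards [isOpen_ne.mem_nhds hz] with w hw
        rw [if_neg hw]
      refine DifferentiableAt.congr_of_eventuallyEq ?_ e2
      exact (hd z).div bf (pow_ne_zero _ (sub_ne_zero.mpr hz))
  · intro s
    by_cases hs : s = ρ
    · have := hgz.self_of_nhds
      simp only [hs, if_true]; simpa using this
    · simp only [if_neg hs]
      field_simp
lemma factor_fin (H : ℂ → ℂ) (hd : Differentiable ℂ H) (h0 : ∃ z, H z ≠ 0) (Z : Finset ℂ) :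
    ∃ (m : ℂ → ℕ) (G : ℂ → ℂ), Differentiable ℂ G ∧ (∀ s, H s = (∏ ρ ∈ Z, (s - ρ) ^ m ρ) * G s) ∧ ∀ ρ ∈ Z, G ρ ≠ 0 := by
  induction Z using Finset.induction_on with
  | empty => exact ⟨fun _ => 0, H, hd, by simp, by simp⟩
  | insert a Z ha ih =>
    obtain ⟨m, G, hG, hHG, hZ⟩ := ih
    obtain ⟨z, hz⟩ := h0
    obtain ⟨n, G', hG', hGG, hn⟩ := factor_one G hG ⟨z, fun h => hz (by rw [hHG, h, mul_zero])⟩ a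
    refine ⟨Function.update m a n, G', hG', fun s => ?_, fun ρ hρ => ?_⟩
    · rw [Finset.prod_insert ha, Function.update_self, hHG, hGG]
      have : ∏ ρ ∈ Z, (s - ρ) ^ Function.update m a n ρ = ∏ ρ ∈ Z, (s - ρ) ^ m ρ :=
        Finset.prod_congr rfl fun ρ hρ => by
          rw [Function.update_of_ne (show ρ ≠ a from fun h => ha (by rwa [← h]))]
      rw [this]; ring
    · rcases Finset.mem_insert.mp hρ with rfl | h
      · exact hn
      · intro h2
        exact hZ ρ h (by rw [hGG, h2, mul_zero])
lemma iter_inv (k : ℕ) (a s : ℂ) : iteratedDeriv k (fun z : ℂ => (z - a)⁻¹) s = (-1) ^ k * k.factorial * ((s - a) ^ (k + 1))⁻¹ := by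
  have := congrFun (iter_deriv_inv_linear_sub k (1:ℂ) a) s
  simp only [one_mul, one_pow, mul_one] at this
  rw [iteratedDeriv_eq_iterate, this]
  rw [show (-1 - (k:ℤ)) = -((k + 1 : ℕ) : ℤ) by push_cast; ring, zpow_neg, zpow_natCast]
section
variable (K : Type*) [Field K] [NumberField K]
lemma turan (H : ℂ → ℂ) (hd : Differentiable ℂ H) (hH : ∀ s : ℂ, 1 < s.re → H s = (s - 1) * dedekindZeta K s)
    (r M : ℝ) (hr : 0 < r) (hM : 0 < M) (k : ℕ)
    (hb : ∀ z ∈ closedBall (1 + r : ℂ) (16 * r), ‖H z‖ ≤ exp M * ‖H (1 + r)‖) :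
    ∃ (Z : Finset ℂ) (m : ℂ → ℕ), (∀ ρ, ρ ∈ Z ↔ H ρ = 0 ∧ ρ ∈ closedBall (1 + r : ℂ) (8 * r)) ∧ (∀ ρ ∈ Z, 1 ≤ m ρ) ∧
      ∑ ρ ∈ Z, m ρ * (((r:ℂ) / (1 + r - ρ)) ^ (k + 1)).re ≤ 1 + 14 * M * (1 / 6) ^ k := by
  set s0 : ℂ := 1 + r with hs0
  have hre0 : 1 < s0.re := by simp [hs0, hr]
  have hne0 : H s0 ≠ 0 := H_ne_gt K H hH s0 hre0
  have ha : AnalyticOnNhd ℂ H univ := hd.differentiableOn.analyticOnNhd isOpen_univ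
  have hfin : ({ρ | H ρ = 0 ∧ ρ ∈ closedBall s0 (8 * r)} : Set ℂ).Finite := by
    by_contra hinf
    obtain ⟨x, hx, hacc⟩ := Infinite.exists_accPt_of_subset_isCompact (K := closedBall s0 (8 * r)) hinf (isCompact_closedBall _ _) (fun z hz => hz.2)
    have : ∃ᶠ z in 𝓝[≠] x, H z = 0 := by
      rw [accPt_iff_frequently_nhdsNE] at hacc
      exact hacc.mono fun z hz => hz.1
    exact hne0 (ha.eqOn_zero_of_preconnected_of_frequently_eq_zero isPreconnected_univ (mem_univ x) this (mem_univ s0))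
  obtain ⟨m, G, hG, hHG, hZ⟩ := factor_fin H hd ⟨s0, hne0⟩ hfin.toFinset
  set Z := hfin.toFinset with hZd
  have hmem : ∀ ρ, ρ ∈ Z ↔ H ρ = 0 ∧ ρ ∈ closedBall s0 (8 * r) := by intro ρ; simp [hZd]
  have hm : ∀ ρ ∈ Z, 1 ≤ m ρ := by
    intro ρ hρ
    by_contra h
    have h1 : m ρ = 0 := by omega
    have h2 := hHG ρ
    rw [((hmem ρ).mp hρ).1] at h2
    rcases mul_eq_zero.mp h2.symm with h3 | h3
    · obtain ⟨q, hq, hq2⟩ := Finset.prod_eq_zero_iff.mp h3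
      have h4 : ρ = q := by
        by_contra hne
        exact (pow_ne_zero _ (sub_ne_zero.mpr hne)) hq2
      rw [← h4, h1] at hq2; simp at hq2
    · exact hZ ρ hρ h3
  refine ⟨Z, m, hmem, hm, ?_⟩
  have hGne : ∀ z ∈ closedBall s0 (8 * r), G z ≠ 0 := by
    intro z hz h
    have : z ∈ Z := (hmem z).mpr ⟨by rw [hHG, h, mul_zero], hz⟩
    exact hZ z this h
  have hP0 : ∏ ρ ∈ Z, (s0 - ρ) ^ m ρ ≠ 0 := fun h => hne0 (by rw [hHG, h, zero_mul])
  have hsph : ∀ z ∈ Metric.sphere s0 (16 * r), ‖G z‖ ≤ exp M * ‖G s0‖ := by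
    intro z hz
    have hz' : dist z s0 = 16 * r := hz
    have h1 : ‖∏ ρ ∈ Z, (s0 - ρ) ^ m ρ‖ ≤ ‖∏ ρ ∈ Z, (z - ρ) ^ m ρ‖ := by
      rw [norm_prod, norm_prod]
      refine Finset.prod_le_prod (fun _ _ => norm_nonneg _) fun ρ hρ => ?_
      rw [norm_pow, norm_pow]
      have h2 := ((hmem ρ).mp hρ).2
      rw [Metric.mem_closedBall, dist_comm] at h2
      have h3 := dist_triangle z ρ s0
      rw [dist_comm ρ s0] at h3
      rw [← dist_eq_norm, ← dist_eq_norm]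
      gcongr
      linarith
    have h2 := hb z (Metric.sphere_subset_closedBall hz)
    rw [hHG z, hHG s0, norm_mul, norm_mul] at h2
    have h3 : 0 < ‖∏ ρ ∈ Z, (s0 - ρ) ^ m ρ‖ := norm_pos_iff.mpr hP0
    have h4 : ‖∏ ρ ∈ Z, (s0 - ρ) ^ m ρ‖ * ‖G z‖ ≤ ‖∏ ρ ∈ Z, (s0 - ρ) ^ m ρ‖ * (exp M * ‖G s0‖) := by
      refine (mul_le_mul_of_nonneg_right h1 (norm_nonneg _)).trans (h2.trans (le_of_eq (by ring)))
    exact le_of_mul_le_mul_left h4 h3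
  have hball : ∀ z ∈ ball s0 (8 * r), ‖G z‖ ≤ exp M * ‖G s0‖ := by
    intro z hz
    refine Complex.norm_le_of_forall_mem_frontier_norm_le (U := ball s0 (16 * r)) Metric.isBounded_ball hG.diffContOnCl ?_ ?_
    · rw [frontier_ball s0 bp]; exact hsph
    · exact subset_closure (Metric.ball_subset_ball bl hz)
  have hlog := logDeriv_bound G s0 (8 * r) M bp hG.differentiableOn (fun z hz => hGne z (Metric.ball_subset_closedBall hz)) hM hball
  have hldiff : ∀ z ∈ closedBall s0 (8 * r), DifferentiableAt ℂ (logDeriv G) z := by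
    intro z hz
    have h1 := (hG.contDiff (n := 2)).differentiable_deriv_two
    simp only [logDeriv]
    exact (h1 z).div (hG z) (hGne z hz)
  have hC := Complex.norm_iteratedDeriv_le_of_forall_mem_sphere_norm_le (c := s0) (R := 6 * r) (f := logDeriv G) (C := 112 * M / (8 * r)) k bp
    (by
      refine DifferentiableOn.diffContOnCl fun z hz => (hldiff z ?_).differentiableWithinAt
      rw [closure_ball _ bp] at hz
      exact Metric.closedBall_subset_closedBall bl hz)
    (fun z hz => hlog z (by
      have := Metric.sphere_subset_closedBall hz
      refine Metric.closedBall_subset_closedBall bl this))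
  have hZre : ∀ ρ ∈ Z, ∀ s : ℂ, 1 < s.re → s - ρ ≠ 0 := by
    intro ρ hρ s hs h
    have : s = ρ := sub_eq_zero.mp h
    exact H_ne_gt K H hH s hs (by rw [this]; exact ((hmem ρ).mp hρ).1)
  have hform : LSeries (fun n => (lam K n : ℂ)) =ᶠ[𝓝 s0] fun s => ((s - 1)⁻¹ - ∑ ρ ∈ Z, (m ρ : ℂ) * (s - ρ)⁻¹) - logDeriv G s := by
    filter_upwards [isOpen_re.mem_nhds hre0] with s hs
    have h1 := H_logDeriv K H hH s hs
    have h2 : H = fun s => (∏ ρ ∈ Z, (s - ρ) ^ m ρ) * G s := funext hHG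
    have h3 : ∏ ρ ∈ Z, (s - ρ) ^ m ρ ≠ 0 := Finset.prod_ne_zero_iff.mpr fun ρ hρ => pow_ne_zero _ (hZre ρ hρ s hs)
    have h4 : G s ≠ 0 := fun h => H_ne_gt K H hH s hs (by rw [hHG, h, mul_zero])
    rw [h2, logDeriv_mul (f := fun s => ∏ ρ ∈ Z, (s - ρ) ^ m ρ) s h3 h4 bf (hG s),
      logDeriv_prod (f := fun ρ s => (s - ρ) ^ m ρ) (fun ρ hρ => pow_ne_zero _ (hZre ρ hρ s hs)) (fun ρ hρ => by fun_prop)] at h1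
    have h5 : ∀ ρ ∈ Z, logDeriv (fun s => (s - ρ) ^ m ρ) s = (m ρ : ℂ) * (s - ρ)⁻¹ := by
      intro ρ hρ
      rw [logDeriv_fun_pow (f := fun s => s - ρ) bf, logDeriv_apply]
      simp
    rw [sum_congr rfl h5, one_div] at h1
    linear_combination h1
  have hi : ∀ a : ℂ, s0 - a ≠ 0 → ContDiffAt ℂ k (fun z : ℂ => (z - a)⁻¹) s0 := fun a h => ContDiffAt.inv bf h
  have h10 : s0 - 1 ≠ 0 := by
    simp only [hs0, add_sub_cancel_left]; exact_mod_cast hr.ne'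
  have hmi : ∀ ρ ∈ Z, ContDiffAt ℂ k (fun z : ℂ => (m ρ : ℂ) * (z - ρ)⁻¹) s0 := fun ρ hρ => contDiffAt_const.mul (hi ρ (hZre ρ hρ s0 hre0))
  have hlc : ContDiffAt ℂ k (logDeriv G) s0 := by
    have : AnalyticAt ℂ (logDeriv G) s0 := by
      refine (DifferentiableOn.analyticOnNhd (s := ball s0 (8 * r)) (fun z hz => (hldiff z (Metric.ball_subset_closedBall hz)).differentiableWithinAt) Metric.isOpen_ball) s0 (Metric.mem_ball_self bp)
    exact this.contDiffAt
  have hder := hform.iteratedDeriv_eq k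
  have hsc : ContDiffAt ℂ k (fun s => ∑ ρ ∈ Z, (m ρ : ℂ) * (s - ρ)⁻¹) s0 := ContDiffAt.sum hmi
  rw [iteratedDeriv_fun_sub ((hi 1 h10).sub hsc) hlc, iteratedDeriv_fun_sub (hi 1 h10) hsc, iteratedDeriv_fun_sum hmi] at hder
  have h6 : ∀ ρ ∈ Z, iteratedDeriv k (fun z : ℂ => (m ρ : ℂ) * (z - ρ)⁻¹) s0 = (-1) ^ k * k.factorial * ((m ρ : ℂ) * ((s0 - ρ) ^ (k + 1))⁻¹) := by
    intro ρ hρ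
    rw [iteratedDeriv_const_mul_field, iter_inv]; ring
  rw [sum_congr rfl h6, ← Finset.mul_sum, iter_inv] at hder
  have hpos := LSeries.iteratedDeriv_alternating (a := fun n => (lam K n : ℂ)) (fun n => by
    simpa using lam_nonneg K n) (x := 1 + r) (lt_of_le_of_lt (lam_absc K) (by exact_mod_cast (by linarith : (1:ℝ) < 1 + r))) k
  rw [show ((1 + r : ℝ) : ℂ) = s0 by simp [hs0], hder] at hpos
  have hk : (0:ℝ) < k.factorial := by exact_mod_cast k.factorial_pos
  have hsgn : ((-1:ℂ) ^ k) * (-1) ^ k = 1 := by rw [← mul_pow]; simp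
  set D := iteratedDeriv k (logDeriv G) s0 with hD
  have hre := (Complex.le_def.mp hpos).1
  have e1 : (-1:ℂ) ^ k * ((-1) ^ k * k.factorial * ((s0 - 1) ^ (k + 1))⁻¹ - (-1) ^ k * k.factorial * ∑ ρ ∈ Z, (m ρ : ℂ) * ((s0 - ρ) ^ (k + 1))⁻¹ - D)
    = ((k.factorial : ℝ) : ℂ) * (((s0 - 1) ^ (k + 1))⁻¹ - ∑ ρ ∈ Z, (m ρ : ℂ) * ((s0 - ρ) ^ (k + 1))⁻¹) - (-1) ^ k * D := by
    push_cast
    linear_combination ((k.factorial:ℂ) * (((s0 - 1) ^ (k + 1))⁻¹ - ∑ ρ ∈ Z, (m ρ : ℂ) * ((s0 - ρ) ^ (k + 1))⁻¹)) * hsgn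
  rw [e1, Complex.zero_re, Complex.sub_re, re_ofReal_mul] at hre
  have h7 : -(((-1:ℂ) ^ k) * D).re ≤ k.factorial * (112 * M / (8 * r)) / (6 * r) ^ k := by
    refine le_trans ?_ hC
    have := Complex.abs_re_le_norm (((-1:ℂ) ^ k) * D)
    rw [norm_mul, norm_pow, norm_neg, norm_one, one_pow, one_mul] at this
    exact (neg_le_abs _).trans this
  have h8 : (((s0 - 1) ^ (k + 1))⁻¹ : ℂ) = ((((r ^ (k + 1))⁻¹ : ℝ)) : ℂ) := by
    simp [hs0]
  rw [h8, Complex.sub_re, Complex.ofReal_re] at hre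
  have h9 : 0 ≤ (k.factorial : ℝ) * ((r ^ (k + 1))⁻¹ - (∑ ρ ∈ Z, (m ρ : ℂ) * ((s0 - ρ) ^ (k + 1))⁻¹).re + (112 * M / (8 * r)) / (6 * r) ^ k) := by
    have : (k.factorial : ℝ) * ((112 * M / (8 * r)) / (6 * r) ^ k) = k.factorial * (112 * M / (8 * r)) / (6 * r) ^ k := by ring
    nlinarith
  have h11 := nonneg_of_mul_nonneg_right h9 hk
  have e2 : ∑ ρ ∈ Z, m ρ * (((r:ℂ) / (s0 - ρ)) ^ (k + 1)).re = r ^ (k + 1) * (∑ ρ ∈ Z, (m ρ : ℂ) * ((s0 - ρ) ^ (k + 1))⁻¹).re := by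
    rw [Complex.re_sum, Finset.mul_sum]
    refine sum_congr rfl fun ρ hρ => ?_
    rw [div_pow, div_eq_mul_inv, ← Complex.ofReal_pow, re_ofReal_mul, ← Complex.ofReal_natCast, re_ofReal_mul]
    ring
  rw [e2]
  have h12 : 0 < r ^ (k + 1) := by positivity
  have h13 := mul_nonneg h12.le h11
  have e3 : r ^ (k + 1) * ((r ^ (k + 1))⁻¹ - (∑ ρ ∈ Z, (m ρ : ℂ) * ((s0 - ρ) ^ (k + 1))⁻¹).re + (112 * M / (8 * r)) / (6 * r) ^ k) =
    1 - r ^ (k + 1) * (∑ ρ ∈ Z, (m ρ : ℂ) * ((s0 - ρ) ^ (k + 1))⁻¹).re + 14 * M * (1 / 6) ^ k := by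
    have : r ^ (k + 1) * ((112 * M / (8 * r)) / (6 * r) ^ k) = 14 * M * (1 / 6) ^ k := by
      rw [mul_pow, div_pow, one_pow, pow_succ]; field_simp; ring
    have h14 : r ^ (k + 1) * (r ^ (k + 1))⁻¹ = 1 := mul_inv_cancel₀ h12.ne'
    linear_combination this + h14
  rw [e3] at h13
  linarith
end
end
section
open Complex (I)
open Metric (closedBall)
lemma pow_sub_one_le (z : ℂ) (n : ℕ) : ‖(1 + z) ^ n - 1‖ ≤ (1 + ‖z‖) ^ n - 1 := by
  induction n with
  | zero => simp
  | succ n ih =>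
    have e : (1 + z) ^ (n + 1) - 1 = ((1 + z) ^ n - 1) * (1 + z) + z := by ring
    rw [e]
    refine (norm_add_le _ _).trans ?_
    rw [norm_mul]
    have h1 : ‖1 + z‖ ≤ 1 + ‖z‖ := (norm_add_le _ _).trans (by simp)
    have h2 : ‖(1 + z) ^ n - 1‖ * ‖1 + z‖ ≤ ((1 + ‖z‖) ^ n - 1) * (1 + ‖z‖) := by gcongr; exact (norm_nonneg _).trans ih
    calc _ ≤ ((1 + ‖z‖) ^ n - 1) * (1 + ‖z‖) + ‖z‖ := by gcongr
      _ = _ := by ring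
lemma exp_tenth (x : ℝ) (hx : x ≤ 1 / 10) : exp x ≤ 10 / 9 := by
  have h1 := one_sub_le_exp_neg (1 / 10)
  have h2 : exp x ≤ exp (1 / 10) := exp_le_exp.mpr hx
  have h3 : exp (1 / 10) * exp (-(1 / 10)) = 1 := by rw [← exp_add]; simp
  nlinarith [exp_pos (1 / 10 : ℝ)]
lemma pow_tenth (x : ℝ) (n : ℕ) (hx : 0 ≤ x) (h : n * x ≤ 1 / 10) : (1 + x) ^ n ≤ 10 / 9 := by
  refine le_trans ?_ (exp_tenth (n * x) h)
  rw [exp_nat_mul]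
  gcongr
  linarith [add_one_le_exp x]
lemma re_pow_ge (u γ r : ℝ) (n : ℕ) (hr : 0 < r) (hu : r ≤ u) (hn : n * |γ| ≤ r / 10) :
    7 / 10 * (r / u) ^ n ≤ (((r:ℂ) / (u - γ * I)) ^ n).re := by
  have hu0 : 0 < u := by linarith
  set z : ℂ := -((γ / u : ℝ) : ℂ) * I with hz
  have hzn : ‖z‖ = |γ| / u := by
    rw [hz, norm_mul, norm_neg, Complex.norm_I, mul_one, Complex.norm_real, norm_eq_abs, abs_div, abs_of_pos hu0]
  have hω : ‖(1 + z) ^ n - 1‖ ≤ 1 / 9 := by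
    refine (pow_sub_one_le z n).trans ?_
    have := pow_tenth ‖z‖ n (norm_nonneg _) (by
      rw [hzn, ← mul_div_assoc, div_le_iff₀ hu0]; linarith)
    linarith
  set ω := (1 + z) ^ n with hωd
  have e : ((r:ℂ) / (u - γ * I)) ^ n = (((r / u) ^ n : ℝ) : ℂ) * ω⁻¹ := by
    have h1 : (u - γ * I : ℂ) = u * (1 + z) := by
      have : (u:ℂ) ≠ 0 := by aesop
      rw [hz]; push_cast; field_simp; ring
    rw [h1, hωd, ← inv_pow, Complex.ofReal_pow, ← mul_pow]
    push_cast
    rw [div_mul_eq_div_div, div_eq_mul_inv]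
  rw [e, Complex.re_ofReal_mul, mul_comm]
  refine mul_le_mul_of_nonneg_left ?_ bp
  rw [Complex.inv_re]
  have h1 := Complex.abs_re_le_norm (ω - 1)
  have h2 := Complex.abs_im_le_norm (ω - 1)
  simp only [Complex.sub_re, Complex.one_re, Complex.sub_im, Complex.one_im, sub_zero] at h1 h2
  have h3 := abs_le.mp (h1.trans hω)
  have h4 : Complex.normSq ω ≤ (10 / 9) ^ 2 := by
    rw [Complex.normSq_eq_norm_sq]
    have : ‖ω‖ ≤ 10 / 9 := by
      have := norm_sub_norm_le ω 1
      rw [norm_one] at this; linarith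
    gcongr
  have h5 : 0 < Complex.normSq ω := by
    rw [Complex.normSq_apply]; nlinarith [sq_nonneg ω.im]
  rw [le_div_iff₀ h5]
  nlinarith [h3.1]
section
variable (K : Type*) [Field K] [NumberField K]
lemma low_zero (H : ℂ → ℂ) (hd : Differentiable ℂ H) (hH : ∀ s : ℂ, 1 < s.re → H s = (s - 1) * dedekindZeta K s)
    (r M : ℝ) (hr : 0 < r) (hM : 0 < M) (k : ℕ)
    (hb : ∀ z ∈ closedBall (1 + r : ℂ) (16 * r), ‖H z‖ ≤ exp M * ‖H (1 + r)‖) (g : ℝ)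
    (hg : ∀ ρ ∈ closedBall (1 + r : ℂ) (8 * r), H ρ = 0 → |ρ.im| ≤ g) (hgk : (k + 1) * g ≤ r / 10)
    (hMk : 14 * M * (1 / 6) ^ k ≤ 1 / 10) (ρ : ℂ) (h0 : H ρ = 0) (him : ρ.im ≠ 0) (him2 : |ρ.im| ≤ r) :
    r / 10 < (k + 1) * (1 - ρ.re) := by
  by_contra! hcon
  obtain ⟨Z, m, hZ, hm, hsum⟩ := turan K H hd hH r M hr hM k hb
  have hre1 : ∀ q : ℂ, H q = 0 → q.re < 1 := by
    intro q hq
    by_contra! h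
    exact H_ne K H hd hH q h hq
  have hδ := hre1 ρ h0
  have hterm : ∀ q ∈ Z, 7 / 10 * (r / (1 + r - q.re)) ^ (k + 1) ≤ (((r:ℂ) / (1 + r - q)) ^ (k + 1)).re := by
    intro q hq
    have h1 := (hZ q).mp hq
    have h2 := hre1 q h1.1
    have h3 := re_pow_ge (1 + r - q.re) q.im r (k + 1) hr bl (by
      push_cast
      refine le_trans ?_ hgk
      have := hg q h1.2 h1.1
      gcongr)
    have e : (((1 + r - q.re : ℝ)) : ℂ) - (q.im : ℂ) * I = 1 + r - q := by
      conv_rhs => rw [← Complex.re_add_im q]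
      push_cast; ring
    rwa [e] at h3
  have hball : ∀ q : ℂ, q.re = ρ.re → |q.im| = |ρ.im| → q ∈ closedBall (1 + r : ℂ) (8 * r) := by
    intro q h1 h2
    rw [Metric.mem_closedBall, dist_eq_norm]
    refine (Complex.norm_le_abs_re_add_abs_im _).trans ?_
    simp only [Complex.sub_re, Complex.add_re, Complex.one_re, Complex.ofReal_re, Complex.sub_im, Complex.add_im, Complex.one_im, Complex.ofReal_im, add_zero, sub_zero]
    have h3 : 1 - ρ.re ≤ r := by nlinarith
    rw [abs_of_nonpos bl]
    linarith
  have hρZ : ρ ∈ Z := (hZ ρ).mpr ⟨h0, hball ρ rfl rfl⟩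
  have hρZ' : (starRingEnd ℂ) ρ ∈ Z := (hZ _).mpr ⟨by rw [H_conj K H hd hH, h0, map_zero], hball _ (by simp) (by simp)⟩
  have hne : ρ ≠ (starRingEnd ℂ) ρ := by
    intro h
    have := congrArg Complex.im h
    rw [Complex.conj_im] at this
    exact him bl
  have hnn : ∀ q ∈ Z, 0 ≤ m q * (((r:ℂ) / (1 + r - q)) ^ (k + 1)).re := by
    intro q hq
    have h2 := hre1 q ((hZ q).mp hq).1
    have h3 : 0 ≤ 7 / 10 * (r / (1 + r - q.re)) ^ (k + 1) := by
      have : 0 ≤ r / (1 + r - q.re) := div_nonneg hr.le bl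
      positivity
    exact mul_nonneg (Nat.cast_nonneg _) (h3.trans (hterm q hq))
  have hbig : ∀ q ∈ Z, q.re = ρ.re → 63 / 100 ≤ m q * (((r:ℂ) / (1 + r - q)) ^ (k + 1)).re := by
    intro q hq h1
    have h2 := hterm q hq
    rw [h1] at h2
    have h3 : (9 / 10 : ℝ) ≤ (r / (1 + r - ρ.re)) ^ (k + 1) := by
      have h4 := pow_tenth ((1 - ρ.re) / r) (k + 1) (div_nonneg bl hr.le) (by
        push_cast
        rw [← mul_div_assoc, div_le_iff₀ hr]; linarith)
      have e : r / (1 + r - ρ.re) = (1 + (1 - ρ.re) / r)⁻¹ := by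
        field_simp; ring
      rw [e, inv_pow, show (9 / 10 : ℝ) = (10 / 9)⁻¹ by norm_num]
      refine inv_anti₀ ?_ h4
      positivity
    have h5 : (1:ℝ) ≤ m q := by exact_mod_cast hm q hq
    nlinarith
  have h1 := Finset.sum_le_sum_of_subset_of_nonneg (s := {ρ, (starRingEnd ℂ) ρ}) (t := Z) (f := fun q => m q * (((r:ℂ) / (1 + r - q)) ^ (k + 1)).re)
    (by intro q hq; simp only [Finset.mem_insert, Finset.mem_singleton] at hq; rcases hq with rfl | rfl <;> assumption) (fun q hq _ => hnn q hq)
  rw [Finset.sum_pair hne] at h1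
  have h2 := hbig ρ hρZ rfl
  have h3 := hbig _ hρZ' (by simp)
  linarith
end
end
section
section
variable (K : Type*) [Field K] [NumberField K]
def ell : ℝ := log ((dg K : ℝ) * log (3 * dsc K))
def HB (C1 : ℝ) (H : ℂ → ℂ) : Prop :=
  Differentiable ℂ H ∧ (∀ s : ℂ, 1 < s.re → H s = (s - 1) * dedekindZeta K s) ∧
    ∀ s : ℂ, 1 / 2 ≤ s.re → s.re ≤ 2 →
      ‖H s‖ ≤ zr K 2 * (discr K).natAbs * exp (C1 * dg K * (1 + ‖s‖))
lemma discr_three (h2 : 1 < dg K) : (3:ℝ) ≤ dsc K := by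
  have := abs_discr_gt_two h2
  rw [Int.abs_eq_natAbs] at this
  have h : 3 ≤ (discr K).natAbs := by omega
  exact_mod_cast h
lemma log_three_ge : 1 ≤ log 3 := by
  rw [le_log_iff_exp_le bn]; linarith [exp_one_lt_d9]
lemma logD_ge (h2 : 1 < dg K) : 1 ≤ log dsc K :=
  log_three_ge.trans (log_le_log bn (discr_three K h2))
lemma log3D (h2 : 1 < dg K) : log (3 * dsc K) = log 3 + log dsc K :=
  log_mul bn (by linarith [discr_three K h2])
lemma exp_ell (h2 : 1 < dg K) : exp (ell K) = (dg K : ℝ) * log (3 * dsc K) := by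
  rw [ell, exp_log]
  rw [log3D K h2]
  positivity
lemma ell_ge (h2 : 1 < dg K) : 1 ≤ ell K := by
  have h2' : (2:ℝ) ≤ dg K := by aesop
  rw [← exp_le_exp, exp_ell K h2, log3D K h2]
  nlinarith [logD_ge K h2, log_three_ge, exp_one_lt_d9]
lemma d_le_exp (h2 : 1 < dg K) : (dg K : ℝ) ≤ exp (ell K) := by
  rw [exp_ell K h2, log3D K h2]
  nlinarith [logD_ge K h2, log_three_ge]
lemma logD_le_exp (h2 : 1 < dg K) : log dsc K ≤ exp (ell K) := by
  have h2' : (2:ℝ) ≤ dg K := by aesop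
  rw [exp_ell K h2, log3D K h2]
  nlinarith [logD_ge K h2, log_three_ge]
lemma d_le_logD (h2 : 1 < dg K) : (dg K : ℝ) ≤ 3 * log dsc K := by
  have h := abs_discr_ge h2
  have e : ((|discr K| : ℤ) : ℝ) = dsc K := by
    simp
  rw [e] at h
  have h1 : (4 / 9 : ℝ) * (9 / 4) ^ dg K ≤ dsc K := by
    refine le_trans ?_ h
    have : (9 / 4 : ℝ) ≤ 3 * π / 4 := by linarith [pi_gt_three]
    gcongr
  have h3 := log_le_log bp h1
  rw [log_mul bn bp, log_pow, show (4 / 9 : ℝ) = (9 / 4)⁻¹ by norm_num, log_inv] at h3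
  have h4 : log 2 ≤ log (9 / 4) := log_le_log bn bn
  have h5 := log_two_gt_d9
  have h6 := logD_ge K h2
  nlinarith
lemma H_ratio (C1 : ℝ) (hC1 : 0 < C1) (H : ℂ → ℂ) (hH : HB K C1 H) (s s1 : ℂ) (S a : ℝ) (ha : 0 < a) (ha1 : a ≤ 1)
    (hs : 1 / 2 ≤ s.re) (hs2 : s.re ≤ 2) (hS : ‖s‖ ≤ S) (hs1 : s1.re = 1 + a) :
    ‖H s‖ ≤ exp (dg K + log dsc K + C1 * dg K * (1 + S) + 2 * dg K / a) * ‖H s1‖ := by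
  obtain ⟨hd, hz, hb⟩ := hH
  have hd1 : (1:ℝ) ≤ dg K := by exact_mod_cast (finrank_pos : 0 < dg K)
  have hD : (0:ℝ) < (discr K).natAbs := by
    have := discr_ne_zero K
    exact_mod_cast Int.natAbs_pos.mpr this
  have h1 : ‖H s‖ ≤ exp (dg K + log dsc K + C1 * dg K * (1 + S)) := by
    rw [exp_add, exp_add, exp_log hD]
    refine (hb s hs hs2).trans ?_
    have := zr_two K
    gcongr
  have h2 : exp (-(2 * dg K / a)) ≤ ‖H s1‖ := by
    rw [hz s1 (by rw [hs1]; linarith), norm_mul]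
    have h3 : a ≤ ‖s1 - 1‖ := by
      refine le_trans ?_ (Complex.re_le_norm _)
      simp [hs1]
    have h4 := zeta_lower K s1 (by rw [hs1]; linarith)
    rw [hs1, add_sub_cancel_left] at h4
    have h5 : exp (-(dg K / a)) ≤ a := by
      rw [← le_log_iff_exp_le ha]
      have := one_sub_inv_le_log_of_pos ha
      have h6 : a⁻¹ ≤ dg K / a := by rw [div_eq_mul_inv]; nlinarith [inv_pos.mpr ha]
      linarith
    calc exp (-(2 * dg K / a)) = exp (-(dg K / a)) * exp (-(dg K / a)) := by rw [← exp_add]; congr 1; ring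
      _ ≤ a * exp (-(dg K / a)) := by gcongr
      _ ≤ _ := by gcongr
  rw [exp_add, mul_assoc]
  refine h1.trans (le_mul_of_one_le_right bp ?_)
  rw [exp_neg] at h2
  rw [inv_le_iff_one_le_mul₀ bp] at h2
  linarith
end
set_option maxHeartbeats 1000000 in
lemma low_free (C C1 : ℝ) (hC : 0 < C) (hC1 : 0 < C1) : ∃ c0 : ℝ, 0 < c0 ∧ ∃ V0 : ℝ, ∀ (K : Type) [Field K] [NumberField K],
    1 < dg K → V0 ≤ log dsc K → ∀ H, HB K C1 H →
    (∀ ρ, H ρ = 0 → 1 - 1 / (2 * ell K ^ C) < ρ.re → |ρ.im| ≤ 1 → |ρ.im| ≤ (1 + 4 * log dsc K)⁻¹ ∧ ρ.im ≠ 0) →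
    ∀ ρ, H ρ = 0 → |ρ.im| ≤ 1 → ρ.re ≤ 1 - c0 / ell K ^ (C + 1) := by
  set a : ℝ := 1 + C + log (66 + 4 * C1) with ha
  have hla : 0 ≤ log (66 + 4 * C1) := log_nonneg bl
  set b : ℝ := a + 7 with hb
  have hb0 : 8 ≤ b := by rw [hb, ha]; linarith
  have hlit := (isLittleO_log_rpow_rpow_atTop (s := 1 / 2) (C + 1) bn).bound (c := (320 * b)⁻¹) bp
  obtain ⟨x0, hx0⟩ := Filter.eventually_atTop.mp hlit
  refine ⟨1 / (320 * b), by positivity, max x0 1, fun K _ _ h2 hV H hH hz ρ h0 him => ?_⟩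
  set ℓ := ell K with hℓ
  have hℓ1 : 1 ≤ ℓ := ell_ge K h2
  set v := log dsc K with hv
  set d : ℝ := (dg K : ℝ) with hd
  have hd2 : 2 ≤ d := by rw [hd]; exact_mod_cast h2
  have hv1 : 1 ≤ v := logD_ge K h2
  have hp : 1 ≤ ℓ ^ C := one_le_rpow hℓ1 hC.le
  have hp1 : ℓ ^ (C + 1) = ℓ ^ C * ℓ := by rw [rpow_add bl, rpow_one]
  have hsm : 320 * b * ℓ ^ (C + 1) ≤ 4 * v := by
    have h1 := hx0 (6 * v ^ 2) (by nlinarith [le_max_left x0 1])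
    have h3 : ℓ ≤ log (6 * v ^ 2) := by
      rw [hℓ, ← exp_le_exp, exp_ell K h2, exp_log bp, log3D K h2]
      have h4 := d_le_logD K h2
      have h5 : log 3 ≤ v := log_le_log bn (discr_three K h2)
      have := log_three_ge
      calc d * (log 3 + v) ≤ (3 * v) * (v + v) := by gcongr
        _ = _ := by ring
    rw [norm_of_nonneg (by have := hℓ1.trans h3; positivity), norm_of_nonneg bp] at h1
    have h6 : (6 * v ^ 2) ^ (1 / 2 : ℝ) ≤ 4 * v := by
      rw [← sqrt_eq_rpow]
      refine sqrt_le_iff.mpr ⟨by linarith, by nlinarith⟩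
    have h7 : ℓ ^ (C + 1) ≤ log (6 * v ^ 2) ^ (C + 1) := by gcongr
    rw [inv_mul_eq_div, le_div_iff₀ bp] at h1
    nlinarith
  set r : ℝ := 1 / (32 * ℓ ^ C) with hr
  have hr0 : 0 < r := by positivity
  have hr1 : r ≤ 1 / 32 := by
    rw [hr]; refine one_div_le_one_div_of_le bn bl
  have hr16 : 1 / (2 * ℓ ^ C) = 16 * r := by rw [hr]; field_simp; norm_num
  by_contra! hcon
  set M : ℝ := d + v + C1 * d * (1 + 3) + 2 * d / r with hM
  have hM0 : 0 < M := by positivity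
  have hMle : M ≤ exp (a * ℓ) := by
    have e1 := d_le_exp K h2
    have e2 := logD_le_exp K h2
    have e3 : M ≤ exp ℓ * ((66 + 4 * C1) * ℓ ^ C) := by
      have : 2 * d / r = 64 * d * ℓ ^ C := by rw [hr]; field_simp; norm_num
      rw [hM, this]
      have h1 : v ≤ exp ℓ * ℓ ^ C := e2.trans (le_mul_of_one_le_right bp hp)
      have h3 : d * ℓ ^ C ≤ exp ℓ * ℓ ^ C := by gcongr
      have h4 : d ≤ exp ℓ * ℓ ^ C := e1.trans (le_mul_of_one_le_right bp hp)
      have h5 : C1 * d ≤ C1 * (exp ℓ * ℓ ^ C) := by gcongr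
      linarith
    refine e3.trans ?_
    have e4 : ℓ ^ C ≤ exp (C * ℓ) := by
      rw [rpow_def_of_pos bl, mul_comm]
      have : log ℓ ≤ ℓ := (log_le_sub_one_of_pos bl).trans bl
      gcongr
    have e5 : 66 + 4 * C1 ≤ exp (log (66 + 4 * C1) * ℓ) := by
      conv_lhs => rw [← exp_log (show 0 < 66 + 4 * C1 by linarith)]
      exact exp_le_exp.mpr (le_mul_of_one_le_right hla hℓ1)
    calc _ ≤ exp ℓ * (exp (log (66 + 4 * C1) * ℓ) * exp (C * ℓ)) := by gcongr
      _ = exp (a * ℓ) := by rw [← exp_add, ← exp_add, ha]; congr 1; ring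
  set k : ℕ := ⌈(a + 5) * ℓ⌉₊ with hk
  have ha0 : 0 ≤ a := by rw [ha]; linarith
  have hk1 : (a + 5) * ℓ ≤ k := Nat.le_ceil _
  have hk2 : (k:ℝ) + 1 ≤ b * ℓ := by
    have := Nat.ceil_lt_add_one (a := (a + 5) * ℓ) bp
    rw [← hk] at this
    rw [hb]; linarith
  have hMk : 14 * M * (1 / 6) ^ k ≤ 1 / 10 := by
    have h1 : exp ((a + 5) * ℓ) ≤ 6 ^ k := by
      refine (exp_le_exp.mpr hk1).trans ?_
      rw [← mul_one (k:ℝ), exp_nat_mul]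
      gcongr
      linarith [exp_one_lt_d9]
    have h3 : 140 * M ≤ exp ((a + 5) * ℓ) := by
      have h4 : (140:ℝ) ≤ exp (5 * ℓ) := by
        have : exp 5 ≤ exp (5 * ℓ) := exp_le_exp.mpr bl
        refine le_trans ?_ this
        rw [show (5:ℝ) = ((5:ℕ):ℝ) * 1 by norm_num, exp_nat_mul]
        have h5 : (2.7182818283:ℝ) ^ 5 ≤ exp 1 ^ 5 := by gcongr; exact exp_one_gt_d9.le
        refine le_trans ?_ h5
        norm_num
      rw [add_mul, exp_add, mul_comm]
      gcongr
    rw [div_pow, one_pow, ← mul_div_assoc, mul_one, div_le_iff₀ bp]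
    linarith
  have hg0 : (0:ℝ) ≤ (1 + 4 * v)⁻¹ := by positivity
  have hgk : ((k:ℝ) + 1) * (1 + 4 * v)⁻¹ ≤ r / 10 := by
    rw [← div_eq_mul_inv, div_le_iff₀ bl]
    refine hk2.trans ?_
    have : r * (320 * b * ℓ ^ (C + 1)) = 10 * (b * ℓ) := by rw [hr, hp1]; field_simp; norm_num
    nlinarith
  have hcc : 1 / (320 * b) / ℓ ^ (C + 1) ≤ 1 / (2 * ℓ ^ C) := by
    rw [div_div]
    refine one_div_le_one_div_of_le bp ?_
    rw [hp1]
    have : ℓ ^ C ≤ ℓ ^ C * ℓ := le_mul_of_one_le_right bp hℓ1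
    nlinarith
  obtain ⟨him1, him2⟩ := hz ρ h0 bl him
  have hball : ∀ (t : ℝ), t ≤ 16 → ∀ z ∈ Metric.closedBall (1 + r : ℂ) (t * r), 1 + r - t * r ≤ z.re ∧ z.re ≤ 1 + r + t * r ∧ |z.im| ≤ t * r ∧ ‖z‖ ≤ 3 := by
    intro t ht z hz
    rw [Metric.mem_closedBall, dist_eq_norm] at hz
    have h1 := abs_le.mp ((Complex.abs_re_le_norm _).trans hz)
    have h3 := (Complex.abs_im_le_norm _).trans hz
    simp only [Complex.sub_re, Complex.add_re, Complex.one_re, Complex.ofReal_re, Complex.sub_im, Complex.add_im, Complex.one_im, Complex.ofReal_im, add_zero, sub_zero] at h1 h3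
    refine ⟨by linarith, by linarith, h3, ?_⟩
    have h4 := norm_le_norm_add_norm_sub (1 + r : ℂ) z
    have h5 : ‖(1 + r : ℂ)‖ = 1 + r := by
      rw [show (1 + r : ℂ) = ((1 + r : ℝ) : ℂ) by push_cast; rfl, Complex.norm_real, norm_of_nonneg bl]
    have h6 : t * r ≤ 16 * r := by gcongr
    rw [norm_sub_rev] at hz
    rw [norm_sub_rev] at h4
    first | linarith | (rw [norm_sub_rev] at h4; linarith)
  have key := low_zero K H hH.1 hH.2.1 r M hr0 hM0 k (by
      intro z hz
      obtain ⟨h1, h3, h4, h5⟩ := hball 16 le_rfl z hz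
      exact H_ratio K C1 hC1 H hH z (1 + r) 3 r hr0 bl bl bl h5 (by simp)) ((1 + 4 * v)⁻¹) (by
      intro q hq hq0
      obtain ⟨h1, h3, h4, h5⟩ := hball 8 bn q hq
      exact (hz q hq0 (by rw [hr16]; linarith) bl).1) hgk hMk ρ h0 him2 (by
      refine him1.trans ?_
      have : (0:ℝ) ≤ k := Nat.cast_nonneg k
      nlinarith)
  have h8 : ((k:ℝ) + 1) * (1 - ρ.re) ≤ b * ℓ * (1 / (320 * b) / ℓ ^ (C + 1)) := by
    have hlt : ρ.re < 1 := by
      by_contra! h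
      exact H_ne K H hH.1 hH.2.1 ρ h h0
    refine mul_le_mul hk2 bl bl bp
  have h9 : b * ℓ * (1 / (320 * b) / ℓ ^ (C + 1)) = r / 10 := by rw [hr, hp1]; field_simp; norm_num
  linarith
end
section
open Complex (continuous_re)
lemma H_uniq (K : Type*) [Field K] [NumberField K] (H H' : ℂ → ℂ) (hd : Differentiable ℂ H) (hd' : Differentiable ℂ H')
    (h : ∀ s : ℂ, 1 < s.re → H s = (s - 1) * dedekindZeta K s) (h' : ∀ s : ℂ, 1 < s.re → H' s = (s - 1) * dedekindZeta K s) :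
    H = H' := by
  refine AnalyticOnNhd.eq_of_eventuallyEq (𝕜 := ℂ) (z₀ := 2) (fun z _ => hd.analyticAt z) (fun z _ => hd'.analyticAt z) ?_
  filter_upwards [isOpen_re.mem_nhds (show (2:ℂ) ∈ {s : ℂ | 1 < s.re} by simp)] with s hs
  rw [h s hs, h' s hs]
lemma one_field (K : Type*) [Field K] [NumberField K] (C1 : ℝ) : ∃ c : ℝ, 0 < c ∧ ∀ H, HB K C1 H → ∀ ρ, H ρ = 0 → |ρ.im| ≤ 1 → ρ.re ≤ 1 - c := by
  by_cases hex : ∃ H, HB K C1 H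
  swap
  · exact ⟨1, one_pos, fun H hH => (hex ⟨H, hH⟩).elim⟩
  obtain ⟨H, hd, hz, -⟩ := hex
  set Z : Set ℂ := {ρ | H ρ = 0 ∧ |ρ.im| ≤ 1 ∧ 0 ≤ ρ.re ∧ ρ.re ≤ 1} with hZ
  have hc : IsCompact Z := by
    refine (isCompact_closedBall (0:ℂ) 2).of_isClosed_subset ?_ ?_
    · refine (isClosed_eq hd.continuous continuous_const).inter ((isClosed_le Complex.continuous_im.abs continuous_const).inter
        ((isClosed_le continuous_const continuous_re).inter (isClosed_le continuous_re continuous_const)))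
    · rintro ρ ⟨-, h1, h2, h3⟩
      rw [mem_closedBall_zero_iff]
      have := Complex.norm_le_abs_re_add_abs_im ρ
      rw [abs_of_nonneg h2] at this
      linarith
  have key : ∃ c : ℝ, 0 < c ∧ ∀ ρ ∈ Z, ρ.re ≤ 1 - c := by
    rcases Z.eq_empty_or_nonempty with h | h
    · exact ⟨1, one_pos, by simp [h]⟩
    · obtain ⟨ρ, hρ, hm⟩ := hc.exists_isMaxOn h continuous_re.continuousOn
      refine ⟨1 - ρ.re, ?_, fun s hs => by have : s.re ≤ ρ.re := hm hs
                                           linarith⟩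
      by_contra hcon
      exact H_ne K H hd hz ρ bl hρ.1
  obtain ⟨c, hc0, hcc⟩ := key
  refine ⟨min c 1, by positivity, fun H' hH' ρ h0 him => ?_⟩
  have : H' = H := H_uniq K H' H hH'.1 hd hH'.2.1 hz
  subst this
  have h1 : ρ.re ≤ 1 := by
    by_contra hcon
    exact H_ne K H' hd hz ρ bl h0
  by_cases h2 : 0 ≤ ρ.re
  · grind
  · have := min_le_right c 1
    linarith
lemma small_fields (N : ℕ) (C1 : ℝ) : ∃ c : ℝ, 0 < c ∧ ∀ (F : IntermediateField ℚ ℂ) [NumberField F], (discr F).natAbs ≤ N →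
    ∀ H, HB F C1 H → ∀ ρ, H ρ = 0 → |ρ.im| ≤ 1 → ρ.re ≤ 1 - c := by
  have hfin := NumberField.finite_of_discr_bdd ℂ N
  set S := {K : { F : IntermediateField ℚ ℂ // FiniteDimensional ℚ F} |
      haveI :  NumberField K := @NumberField.mk _ _ inferInstance K.prop
      |discr K| ≤ N } with hS
  have : ∀ K : { F : IntermediateField ℚ ℂ // FiniteDimensional ℚ F}, ∃ c : ℝ, 0 < c ∧
      haveI :  NumberField K := @NumberField.mk _ _ inferInstance K.prop
      ∀ H, HB K C1 H → ∀ ρ, H ρ = 0 → |ρ.im| ≤ 1 → ρ.re ≤ 1 - c := fun K => by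
    haveI :  NumberField K := @NumberField.mk _ _ inferInstance K.prop
    exact one_field K C1
  choose c hc hcc using this
  have : ∃ c0 : ℝ, 0 < c0 ∧ ∀ K ∈ S, c0 ≤ c K := by
    rcases S.eq_empty_or_nonempty with h | h
    · exact ⟨1, one_pos, by simp [h]⟩
    · obtain ⟨K, hK, hm⟩ := exists_min_image S c hfin h
      exact ⟨c K, hc K, hm⟩
  obtain ⟨c0, h0, h1⟩ := this
  refine ⟨c0, h0, fun F _ hF H hH ρ hρ him => ?_⟩
  have hfd : FiniteDimensional ℚ F := inferInstance
  have hm : (⟨F, hfd⟩ : { F : IntermediateField ℚ ℂ // FiniteDimensional ℚ F}) ∈ S := by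
    show |discr F| ≤ N
    rw [Int.abs_eq_natAbs]; exact_mod_cast hF
  have := hcc ⟨F, hfd⟩ H hH ρ hρ him
  have := h1 _ hm
  linarith
lemma zfree (C C1 : ℝ) (hC : 4 < C) (hC1 : 0 < C1) (hM : MDZH C) : ∃ c0 : ℝ, 0 < c0 ∧ c0 ≤ 1 / 4 ∧
    ∀ (F : IntermediateField ℚ ℂ) [NumberField F], 1 < dg F → ∀ H, HB F C1 H → ∀ T : ℝ, 0 ≤ T →
    ∀ s : ℂ, 1 - c0 / (ell F ^ (C + 1) * log (T + 3)) < s.re → |s.im| ≤ T + 1 → H s ≠ 0 := by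
  obtain ⟨c1, hc1, V0, hlow⟩ := low_free C C1 bl hC1
  obtain ⟨c2, hc2, hsm⟩ := small_fields ⌊exp V0⌋₊ C1
  have hl3 := log_three_ge
  have hl32 : log 3 < 2 := by
    have := log_lt_sub_one_of_pos (x := 3) bn bn
    linarith
  set c0 := min (1 / 4) (min c1 c2) with hc0
  have e1 : c0 ≤ 1 / 4 := min_le_left _ _
  have e2 : c0 ≤ c1 := (min_le_right _ _).trans (min_le_left _ _)
  have e3 : c0 ≤ c2 := (min_le_right _ _).trans (min_le_right _ _)
  have e0 : 0 < c0 := by positivity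
  refine ⟨c0, e0, e1, fun F _ h2 H hH T hT s hs him h0 => ?_⟩
  have hl := ell_ge F h2
  have hlC : 1 ≤ ell F ^ C := one_le_rpow hl bl
  have hlC1 : ell F ^ C ≤ ell F ^ (C + 1) := rpow_le_rpow_of_exponent_le hl bl
  have hlT : 1 ≤ log (T + 3) := hl3.trans (log_le_log bn bl)
  have hs1 : s.re < 1 := by
    by_contra hcon
    exact H_ne F H hH.1 hH.2.1 s bl h0
  obtain ⟨hz1, hz2⟩ := hM F h2 (fun s => H s / (s - 1)) ⟨by
      refine hH.1.differentiableOn.div bf fun s hs => sub_ne_zero.2 hs, fun s hs => by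
      have hne : s - 1 ≠ 0 := sub_ne_zero.2 (by rintro rfl; simp at hs)
      simp only [hH.2.1 s hs]
      rw [mul_div_cancel_left₀ _ hne]
      exact (zeta_ideal F s hs).2.tsum_eq.symm⟩
  have hz1' : ∀ ρ, H ρ = 0 → 0 < ρ.re → ρ.re < 1 → (1 + 4 * log dsc F)⁻¹ ≤ |ρ.im| →
      ρ.re < 1 - (ell F ^ C * log (|ρ.im| + 2))⁻¹ := fun ρ h0 hp h1 hi => by
    by_contra hcon
    exact hz1 ρ (by simp [h0]) hp h1 ⟨hi, not_lt.1 hcon⟩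
  have hz2' : ∀ ρ : ℂ, H ρ = 0 → 0 < ρ.re → ρ.re < 1 → ρ.im = 0 → ρ.re ≤ 1 - (ell F ^ C)⁻¹ := fun ρ h0 hp h1 hi => by
    by_contra hcon
    have hρ : ((ρ.re : ℝ) : ℂ) = ρ := by apply Complex.ext <;> simp [hi]
    refine hz2 ρ.re (by simp [hρ, h0]) hp h1 ?_
    rw [rpow_neg bp]
    exact not_le.1 hcon
  have hinv1 : (ell F ^ C)⁻¹ ≤ 1 := inv_le_one_of_one_le₀ hlC
  have hdiv : c0 / (ell F ^ (C + 1) * log (T + 3)) ≤ c0 / ell F ^ (C + 1) := by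
    apply div_le_div_of_nonneg_left e0.le bl
    nlinarith
  have hdiv1 : c0 / ell F ^ (C + 1) ≤ c0 := div_le_self e0.le bl
  by_cases him1 : |s.im| ≤ 1
  ·
    by_cases hV : V0 ≤ log dsc F
    · have := hlow F h2 hV H hH (fun ρ h0 hre hi => ?_) s h0 him1
      · have : c0 / ell F ^ (C + 1) ≤ c1 / ell F ^ (C + 1) := by gcongr
        linarith
      · have hρ1 : ρ.re < 1 := by
          by_contra hcon
          exact H_ne F H hH.1 hH.2.1 ρ bl h0
        have e4 : 1 / (2 * ell F ^ C) = (ell F ^ C)⁻¹ / 2 := by ring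
        have hρ0 : 0 < ρ.re := by linarith
        refine ⟨?_, fun him0 => ?_⟩
        · by_contra hcon
          have := hz1' ρ h0 hρ0 hρ1 (not_le.1 hcon).le
          have h5 : (ell F ^ C)⁻¹ / 2 ≤ (ell F ^ C * log (|ρ.im| + 2))⁻¹ := by
            rw [mul_inv, div_eq_mul_inv]
            gcongr
            · exact log_pos (by linarith [abs_nonneg ρ.im])
            · have : log (|ρ.im| + 2) ≤ log 3 := log_le_log bp bl
              linarith
          linarith
        · have := hz2' ρ h0 hρ0 hρ1 him0
          linarith
    · have := hsm F (Nat.le_floor ?_) H hH s h0 him1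
      · linarith
      · have hD := discr_three F h2
        rw [← exp_log (show (0:ℝ) < (discr F).natAbs by linarith)]
        exact exp_le_exp.2 (not_le.1 hV).le
  · have hp : 0 < s.re := by linarith
    have hD := logD_ge F h2
    have := hz1' s h0 hp hs1 ((inv_le_one_of_one_le₀ bl).trans (not_le.1 him1).le)
    have h6 : c0 / (ell F ^ (C + 1) * log (T + 3)) ≤ (ell F ^ C * log (|s.im| + 2))⁻¹ := by
      rw [← one_div]
      have : 0 < log (|s.im| + 2) := log_pos bl
      have : log (|s.im| + 2) ≤ log (T + 3) := log_le_log bp bl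
      gcongr
      linarith
    linarith
end
section
open Finset (range)
section
variable (K : Type*) [Field K] [NumberField K]
lemma strip (C1 : ℝ) (hC1 : 0 < C1) (H : ℂ → ℂ) (hH : HB K C1 H) (η T : ℝ) (hη : 0 < η) (hη1 : η ≤ 1 / 4) (hT : 1 ≤ T)
    (hD : 0 ≤ log dsc K)
    (hne : ∀ s : ℂ, 1 - η < s.re → |s.im| ≤ T + 1 → H s ≠ 0) (s : ℂ) (h1 : 1 - η / 2 ≤ s.re) (h2 : s.re ≤ 1 + η) (h3 : |s.im| ≤ T) :
    H s ≠ 0 ∧ ‖logDeriv H s‖ ≤ 56 * (dg K + log dsc K + 6 * C1 * dg K + 2 * dg K / η) / η * T := by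
  refine ⟨hne s bl bl, ?_⟩
  have hd1 : (1:ℝ) ≤ dg K := by exact_mod_cast (finrank_pos : 0 < dg K)
  set c : ℂ := ⟨1 + η, s.im⟩ with hc
  have hball : ∀ z ∈ Metric.ball c (2 * η), 1 - η < z.re ∧ z.re < 1 + 3 * η ∧ |z.im| ≤ T + 1 := fun z hz => by
    rw [Metric.mem_ball, dist_eq_norm] at hz
    have e1 := (Complex.abs_re_le_norm (z - c)).trans_lt hz
    have e2 := (Complex.abs_im_le_norm (z - c)).trans_lt hz
    simp only [Complex.sub_re, Complex.sub_im, hc, abs_lt] at e1 e2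
    rw [abs_le] at h3 ⊢
    refine ⟨?_, ?_, ?_, ?_⟩ <;> linarith
  set M := (dg K + log dsc K + C1 * dg K * (1 + (T + 4)) + 2 * dg K / η) with hM
  have hMp : 0 < M := by positivity
  have := logDeriv_bound H c (2 * η) M bl hH.1.differentiableOn
    (fun z hz => hne z (hball z hz).1 (hball z hz).2.2) hMp (fun z hz => by
      obtain ⟨e1, e2, e3⟩ := hball z hz
      refine H_ratio K C1 hC1 H hH z c (T + 4) η hη bl bl bl ?_ rfl
      have := Complex.norm_le_abs_re_add_abs_im z
      rw [abs_of_nonneg (by linarith : 0 ≤ z.re)] at this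
      linarith) s ?_
  · refine this.trans ?_
    have e : M ≤ (dg K + log dsc K + 6 * C1 * dg K + 2 * dg K / η) * T := by
      have a1 : (0:ℝ) ≤ C1 * dg K := by positivity
      have a2 : (0:ℝ) ≤ 2 * dg K / η := by positivity
      nlinarith
    rw [div_mul_eq_mul_div, div_le_div_iff₀ bl hη]
    nlinarith
  · rw [Metric.mem_closedBall, dist_eq_norm]
    have : s - c = ((s.re - (1 + η) : ℝ) : ℂ) := by apply Complex.ext <;> simp [hc]
    rw [this, Complex.norm_real, norm_eq_abs, abs_le]
    constructor <;> linarith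
lemma psi1_fin (x : ℝ) (hx : 0 < x) (N : ℕ) (hN : ⌊x⌋₊ ≤ N) : psi1 K x = ∑ n ∈ range (N + 1), lam K n * max (log (x / n)) 0 := by
  refine tsum_eq_sum fun n hn => ?_
  have h1 : ⌊x⌋₊ < n := by simp at hn; omega
  have h2 : x < n := (Nat.floor_lt hx.le).1 h1
  rw [max_eq_right (log_nonpos bp ((div_le_one (hx.trans h2)).2 h2.le)), mul_zero]
lemma psi_diff (X κ : ℝ) (hκ : 0 ≤ κ) : psi1 K (exp X) - psi1 K (exp (X - κ)) ≤ κ * ∑ n ∈ range (⌊exp X⌋₊ + 1), lam K n := by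
  rw [psi1_fin K (exp X) (exp_pos _) ⌊exp X⌋₊ le_rfl, psi1_fin K (exp (X - κ)) (exp_pos _) ⌊exp X⌋₊
    (Nat.floor_le_floor (exp_le_exp.2 bl)), ← Finset.sum_sub_distrib, Finset.mul_sum]
  refine Finset.sum_le_sum fun n _ => ?_
  rw [← mul_sub, mul_comm κ]
  refine mul_le_mul_of_nonneg_left ?_ (lam_nonneg K n)
  rcases n.eq_zero_or_pos with rfl | hn
  · simpa using hκ
  · have : (0:ℝ) < n := by exact_mod_cast hn
    rw [log_div (exp_pos _).ne' this.ne', log_div (exp_pos _).ne' this.ne', log_exp, log_exp]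
    rw [sub_le_iff_le_add, max_le_iff]
    constructor
    · grind
    · positivity
set_option maxHeartbeats 1000000 in
lemma psi_lower (C1 : ℝ) (hC1 : 0 < C1) (H : ℂ → ℂ) (hH : HB K C1 H) (η X Y : ℝ) (hη : 0 < η) (hη1 : η ≤ 1 / 4)
    (hY : 1 ≤ Y) (hX : 4 * Y ≤ η * (X - 1)) (hD : 0 ≤ log dsc K)
    (hne : ∀ s : ℂ, 1 - η < s.re → |s.im| ≤ exp Y + 1 → H s ≠ 0) :
    exp X * (1 - (2 + 4 * (56 * (dg K + log dsc K + 6 * C1 * dg K + 2 * dg K / η) / η)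
      + 10 * dg K * X ^ 2) * exp (-(Y / 2))) ≤ ∑ n ∈ range (⌊exp X⌋₊ + 1), lam K n := by
  set B0 := 56 * (dg K + log dsc K + 6 * C1 * dg K + 2 * dg K / η) / η with hB0
  set d : ℝ := (dg K : ℝ) with hd
  have hX1 : 16 * Y ≤ X - 1 := by nlinarith
  set q := exp (-(Y / 2)) with hq
  have hq0 : 0 < q := exp_pos _
  have hq1 : q ≤ 1 := exp_le_one_iff.2 bl
  have hqq : exp (-Y) = q * q := by rw [hq, ← exp_add]; ring_nf
  have hT : 1 ≤ exp Y := one_le_exp bl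
  have hTi : exp (-Y) = 1 / exp Y := by rw [exp_neg, one_div]
  have main : ∀ X', X - 1 ≤ X' → X' ≤ X → |exp X' - 1 - X' - psi1 K (exp X')| ≤ exp X * ((2 * B0 + 5 * d * X ^ 2) * (q * q)) := fun X' h1 h2 => by
    have h := psi1_err K H hH.1 hH.2.1 X' η (exp Y) (B0 * exp Y) bl hη hη1 (by
      rw [div_le_iff₀ bl]
      nlinarith) hT bp (fun s a1 a2 a3 => strip K C1 hC1 H hH η (exp Y) hη hη1 hT hD hne s a1 a2 a3)
    refine h.trans ?_
    have b1 : B0 * exp Y * exp (-(η / 2 * X')) ≤ B0 * exp (-Y) := by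
      rw [mul_assoc, ← exp_add]
      gcongr
      nlinarith
    have b2 : B0 * exp Y / exp Y ^ 2 = B0 * exp (-Y) := by
      rw [hTi]; field_simp
    have b3 : 5 * d * X' ^ 2 / exp Y ≤ 5 * d * X ^ 2 * exp (-Y) := by
      rw [hTi, mul_one_div]
      gcongr
      linarith
    rw [b2, ← hqq]
    calc _ ≤ exp X * (B0 * exp Y * exp (-(η / 2 * X')) + B0 * exp (-Y) + 5 * d * X' ^ 2 / exp Y) := by
            gcongr
      _ ≤ _ := by
        gcongr
        linarith
  have m1 := abs_le.1 (main X bl le_rfl)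
  have m2 := abs_le.1 (main (X - q) bl bl)
  have m3 := psi_diff K X q hq0.le
  have m4 : exp (X - q) ≤ exp X * (1 - q + q ^ 2 / 2) := by
    rw [sub_eq_add_neg, exp_add]
    gcongr
    have h8 : 1 + q + q ^ 2 / 2 ≤ exp q := quadratic_le_exp_of_nonneg hq0.le
    rw [exp_neg, inv_le_iff_one_le_mul₀ (exp_pos _)]
    have h9 : 0 ≤ 1 - q + q ^ 2 / 2 := by nlinarith
    nlinarith [mul_le_mul_of_nonneg_left h8 h9, pow_nonneg hq0.le 4]
  have m5 : 1 ≤ exp X * q := by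
    rw [hq, ← exp_add]
    exact one_le_exp bl
  nlinarith
end
end
section
open Finset (range)
section
variable (K : Type*) [Field K] [NumberField K]
lemma lam_prime_pos (p : ℕ) (hp : p.Prime) (h : lam K p ≠ 0) : ∃ P : PS K, nP P = p := by
  by_contra hcon
  push Not at hcon
  refine h ?_
  rw [lam, lamE]
  have : ∀ (P : PS K) (k : ℕ), nP P ^ (k + 1) ≠ p := fun P k hk => by
    rcases k.eq_zero_or_pos with rfl | hk0
    · exact hcon P (by simpa using hk)
    · refine Nat.Prime.not_prime_pow (x := nP P) (n := k + 1) (by omega) (hk ▸ hp)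
  simp [this]
lemma prime_sum (x : ℝ) (hx : 1 ≤ x) : ∑ n ∈ range (⌊x⌋₊ + 1), lam K n ≤
    dg K * log x * ((range (⌊x⌋₊ + 1)).filter (fun p => p.Prime ∧ ∃ P : PS K, nP P = p)).card
      + dg K * (2 * √x * log x) := by
  have h1 : ∑ n ∈ (range (⌊x⌋₊ + 1)) with ¬ n.Prime, lam K n ≤ dg K * (2 * √x * log x) := by
    have := Chebyshev.psi_sub_theta_le hx
    rw [Chebyshev.psi_sub_theta_eq_sum_not_prime] at this
    refine le_trans ?_ (mul_le_mul_of_nonneg_left this bp)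
    rw [Finset.mul_sum]
    refine (Finset.sum_le_sum fun n _ => lam_le K n).trans (le_of_eq ?_)
    symm
    refine Finset.sum_subset (fun n hn => ?_) fun n hn hn' => ?_
    · aesop
    · aesop
  have h2 : ∑ n ∈ (range (⌊x⌋₊ + 1)) with n.Prime, lam K n ≤ dg K * log x * ((range (⌊x⌋₊ + 1)).filter (fun p => p.Prime ∧ ∃ P : PS K, nP P = p)).card := by
    rw [← Finset.filter_filter, Finset.card_filter, Nat.cast_sum, Finset.mul_sum]
    refine Finset.sum_le_sum fun n hn => ?_
    simp only [Finset.mem_filter, Finset.mem_range] at hn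
    by_cases h : ∃ P : PS K, nP P = n
    · rw [if_pos h, Nat.cast_one, mul_one]
      refine (lam_le_log K n).trans ?_
      gcongr
      · exact_mod_cast hn.2.pos
      · exact (Nat.le_floor_iff bl).1 (by omega)
    · rw [if_neg h, Nat.cast_zero, mul_zero]
      by_contra hc
      exact h (lam_prime_pos K n hn.2 (fun h0 => hc h0.le))
  rw [← Finset.sum_filter_add_sum_filter_not _ (fun n => n.Prime)]
  exact add_le_add h2 h1
end
end
section
open scoped Matrix
open Algebra (discr)
open Finset (sum_congr)
open Fintype (card_fin)
open Polynomial (aeval)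
section
variable (K : Type*) [Field K] [NumberField K]
lemma root_mod (f : Polynomial ℤ) (α : K) (hα : aeval α f = 0) (p : ℕ) (hp : p.Prime) (P : PS K) (hP : nP P = p)
    (ha : ¬ (p : ℤ) ∣ f.leadingCoeff) : ∃ r : ZMod p, aeval r f = 0 := by
  haveI : Fact p.Prime := ⟨hp⟩
  set a := f.leadingCoeff with had
  set β : 𝓞 K := ⟨a • α, isIntegral_leadingCoeff_smul f α hα⟩ with hβ
  have hcard : Nat.card (𝓞 K ⧸ P.asIdeal) = p := by
    aesop
  haveI := Fintype.ofFinite (𝓞 K ⧸ P.asIdeal)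
  let e := ZMod.ringEquivOfPrime (𝓞 K ⧸ P.asIdeal) hp (by aesop)
  let φ : 𝓞 K →+* ZMod p := e.symm.toRingHom.comp (Ideal.Quotient.mk P.asIdeal)
  have h1 : ∑ i ∈ Finset.range (f.natDegree + 1), (f.coeff i : 𝓞 K) * (β ^ i * (a : 𝓞 K) ^ (f.natDegree - i)) = 0 := by
    apply RingOfIntegers.coe_injective
    have h2 : ∀ i ∈ Finset.range (f.natDegree + 1), algebraMap (𝓞 K) K ((f.coeff i : 𝓞 K) * (β ^ i * (a : 𝓞 K) ^ (f.natDegree - i))) = ((a : K) ^ f.natDegree * (f.coeff i • α ^ i) : K) := fun i hi => by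
      have hi' : i ≤ f.natDegree := by aesop
      have : algebraMap (𝓞 K) K β = a * α := by simp [*]
      simp only [map_mul, map_pow, map_intCast]
      rw [this, mul_pow, zsmul_eq_mul, ← Nat.add_sub_cancel' hi', pow_add, Nat.add_sub_cancel' hi']
      ring
    rw [map_sum, sum_congr rfl h2, ← Finset.mul_sum, ← Polynomial.aeval_eq_sum_range, hα, mul_zero, map_zero]
  have h3 := congrArg φ h1
  rw [map_sum, map_zero] at h3
  have ha0 : (a : ZMod p) ≠ 0 := fun h => ha ((ZMod.intCast_zmod_eq_zero_iff_dvd a p).1 h)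
  refine ⟨φ β / a, ?_⟩
  have h4 : (a : ZMod p) ^ f.natDegree * aeval (φ β / a) f = 0 := by
    rw [Polynomial.aeval_eq_sum_range, Finset.mul_sum, ← h3]
    refine sum_congr rfl fun i hi => ?_
    have hi' : i ≤ f.natDegree := by simp at hi; omega
    simp only [map_mul, map_pow, map_intCast, zsmul_eq_mul, div_pow]
    rw [pow_sub₀ _ ha0 hi']
    field_simp
  exact (mul_eq_zero.1 h4).resolve_left (pow_ne_zero _ ha0)
lemma discr_le_pb (pb : PowerBasis ℚ K) (hi : IsIntegral ℤ pb.gen) (B : ℝ) (hB1 : 1 ≤ 2 * B) (hB : ∀ φ : K →ₐ[ℚ] ℂ, ‖φ pb.gen‖ ≤ B) :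
    dsc K ≤ (2 * B) ^ (2 * pb.dim ^ 2) := by
  have hcard : Fintype.card (Free.ChooseBasisIndex ℤ (𝓞 K)) = Fintype.card (Fin pb.dim) := by
    rw [← finrank_eq_card_basis (integralBasis K), card_fin, pb.finrank]
  let e0 := Fintype.equivOfCardEq hcard
  let v := pb.basis.reindex e0.symm
  have hv : ∀ i, IsIntegral ℤ (v i) := fun i => by
    simp only [v, Basis.reindex_apply, PowerBasis.coe_basis]
    exact hi.pow _
  let P' : Matrix (Free.ChooseBasisIndex ℤ (𝓞 K)) (Free.ChooseBasisIndex ℤ (𝓞 K)) ℤ :=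
    fun i j => (RingOfIntegers.basis K).repr ⟨v j, hv j⟩ i
  have hP : P'.map (algebraMap ℤ ℚ) = (integralBasis K).toMatrix v := by
    ext i j
    rw [Matrix.map_apply, Basis.toMatrix_apply]
    exact (integralBasis_repr_apply K ⟨v j, hv j⟩ i).symm
  have h1 : discr ℚ v = ((P'.det : ℤ) : ℚ) ^ 2 * (discr K : ℚ) := by
    have h2 : (v : _ → K) = (integralBasis K) ᵥ* ((integralBasis K).toMatrix v).map (algebraMap ℚ K) := by
      ext j
      rw [Matrix.vecMul, dotProduct]
      rw [← (integralBasis K).sum_toMatrix_smul_self v j]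
      refine sum_congr rfl fun i _ => ?_
      rw [Matrix.map_apply, Algebra.smul_def, mul_comm]
    conv_lhs => rw [h2]
    rw [Algebra.discr_of_matrix_vecMul, coe_discr, ← hP]
    congr 2
    exact (RingHom.map_det (algebraMap ℤ ℚ) P').symm
  have h3 : discr ℚ v = discr ℚ pb.basis := by
    have := Algebra.discr_reindex ℚ pb.basis e0.symm
    rw [← this]
    congr 1
    ext i
    simp [v]
  have h4 : discr ℚ v ≠ 0 := Algebra.discr_not_zero_of_basis ℚ v
  have h5 : 1 ≤ (P'.det) ^ 2 := by
    have : P'.det ≠ 0 := fun h => h4 (by rw [h1, h]; simp)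
    have : 0 < P'.det ^ 2 := by positivity
    omega
  have e : Fin pb.dim ≃ (K →ₐ[ℚ] ℂ) := Fintype.equivOfCardEq (by
    rw [card_fin, AlgHom.card, pb.finrank])
  have h6 := Algebra.discr_powerBasis_eq_prod ℚ ℂ pb e
  have h7 : ‖(algebraMap ℚ ℂ (discr ℚ pb.basis))‖ ≤ (2 * B) ^ (2 * pb.dim ^ 2) := by
    rw [h6, norm_prod]
    have : ∀ i ∈ (Finset.univ : Finset (Fin pb.dim)), ‖∏ j ∈ Finset.Ioi i, (e j pb.gen - e i pb.gen) ^ 2‖ ≤ (2 * B) ^ (2 * pb.dim) := fun i _ => by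
      rw [norm_prod]
      refine (Finset.prod_le_prod (g := fun _ => (2 * B) ^ 2) (fun _ _ => norm_nonneg _) fun j _ => ?_).trans ?_
      · rw [norm_pow]
        gcongr
        have := norm_sub_le (e j pb.gen) (e i pb.gen)
        linarith [hB (e j), hB (e i)]
      · rw [Finset.prod_const, ← pow_mul]
        refine pow_le_pow_right₀ hB1 ?_
        have := Finset.card_le_univ (Finset.Ioi i)
        rw [card_fin] at this
        omega
    refine (Finset.prod_le_prod (fun _ _ => norm_nonneg _) this).trans ?_
    rw [Finset.prod_const, ← pow_mul, Finset.card_univ, card_fin]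
    exact le_of_eq (by ring_nf)
  rw [← h3, h1] at h7
  refine le_trans ?_ h7
  simp only [map_mul, map_pow, map_intCast, norm_mul, norm_pow, Complex.norm_intCast]
  rw [Nat.cast_natAbs, Int.cast_abs]
  have h8 : (1:ℝ) ≤ |(P'.det : ℝ)| ^ 2 := by rw [sq_abs]; exact_mod_cast h5
  nlinarith [abs_nonneg ((discr K : ℤ) : ℝ)]
end
end
section
open scoped IntermediateField
open Finset (range)
open Int (castRingHom)
open Polynomial (aeval leadingCoeff_ne_zero)
lemma root_bound (f : Polynomial ℤ) (hf : f ≠ 0) (σ : ℕ) (hc : ∀ i, |f.coeff i| ≤ 2 ^ σ) (z : ℂ) (hz : aeval z f = 0) :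
    ‖(f.leadingCoeff : ℂ) * z‖ ≤ 2 ^ (σ + 1) := by
  set g := f.map (castRingHom ℂ) with hg
  have hinj : Function.Injective (castRingHom ℂ) := RingHom.injective_int _
  have hg0 : g ≠ 0 := (Polynomial.map_ne_zero_iff hinj).2 hf
  have hr : g.IsRoot z := by
    rw [Polynomial.IsRoot, hg, Polynomial.eval_map, ← hz]; rfl
  have h1 : ‖z‖ < (g.cauchyBound : ℝ) := by exact_mod_cast hr.norm_lt_cauchyBound hg0
  have hlc : g.leadingCoeff = (f.leadingCoeff : ℂ) := by
    rw [hg, Polynomial.leadingCoeff_map_of_injective hinj]; rfl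
  have hcn : ∀ i, ‖g.coeff i‖ ≤ 2 ^ σ := fun i => by
    rw [hg, Polynomial.coeff_map, eq_intCast, Complex.norm_intCast]
    exact_mod_cast hc i
  have ha : (0:ℝ) < ‖g.leadingCoeff‖ := norm_pos_iff.2 (leadingCoeff_ne_zero.2 hg0)
  have h2 : (g.cauchyBound : ℝ) ≤ 2 ^ σ / ‖g.leadingCoeff‖ + 1 := by
    rw [Polynomial.cauchyBound]
    push_cast
    gcongr
    have : (Finset.sup (range g.natDegree) fun x => ‖g.coeff x‖₊) ≤ (2:NNReal) ^ σ :=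
      Finset.sup_le fun i _ => by aesop
    exact_mod_cast this
  rw [norm_mul, ← hlc]
  have h3 : ‖g.leadingCoeff‖ * ‖z‖ ≤ ‖g.leadingCoeff‖ * (2 ^ σ / ‖g.leadingCoeff‖ + 1) := by gcongr; linarith
  have h4 : ‖g.leadingCoeff‖ * (2 ^ σ / ‖g.leadingCoeff‖ + 1) = 2 ^ σ + ‖g.leadingCoeff‖ := by field_simp
  have h5 : ‖g.leadingCoeff‖ ≤ 2 ^ σ := hcn _
  rw [pow_succ]
  linarith
lemma bad_primes (a : ℤ) (ha : a ≠ 0) (σ : ℕ) (h : |a| ≤ 2 ^ σ) (S : Finset ℕ) (hS : ∀ p ∈ S, p.Prime ∧ (p : ℤ) ∣ a) : S.card ≤ σ := by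
  have h1 : S ⊆ a.natAbs.primeFactors := fun p hp => by
    rw [Nat.mem_primeFactors]
    exact ⟨(hS p hp).1, Int.natCast_dvd.1 (hS p hp).2, Int.natAbs_ne_zero.2 ha⟩
  have h2 : 2 ^ S.card ≤ 2 ^ σ := by
    calc 2 ^ S.card ≤ 2 ^ a.natAbs.primeFactors.card := Nat.pow_le_pow_right bn (Finset.card_le_card h1)
      _ ≤ ∏ p ∈ a.natAbs.primeFactors, p := Finset.pow_card_le_prod _ _ _ fun p hp => (Nat.prime_of_mem_primeFactors hp).two_le
      _ ≤ a.natAbs := Nat.le_of_dvd (Int.natAbs_pos.2 ha) (Nat.prod_primeFactors_dvd _)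
      _ ≤ 2 ^ σ := by zify; exact h
  exact (Nat.pow_le_pow_iff_right bn).1 h2
lemma setup (f : Polynomial ℤ) (d σ : ℕ) (hf : Irreducible f) (hd : f.natDegree = d) (hd2 : 2 ≤ d) (hσ : 0 < σ) (hc : ∀ i, |f.coeff i| ≤ 2 ^ σ) :
    ∃ (F : IntermediateField ℚ ℂ) (_ : NumberField F), dg F = d ∧ log dsc F ≤ 6 * ((d:ℝ) ^ 2 * σ) ∧
      ∀ x : ℝ, ((range (⌊x⌋₊ + 1)).filter (fun p => p.Prime ∧ ∃ P : PS F, nP P = p)).card ≤ piPoly f x + σ := by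
  have hf0 : f ≠ 0 := hf.ne_zero
  set a := f.leadingCoeff with had
  have ha : a ≠ 0 := leadingCoeff_ne_zero.2 hf0
  have hdeg : f.degree ≠ 0 := fun h => by
    have : f.natDegree = 0 := Polynomial.natDegree_eq_of_degree_eq_some h
    omega
  obtain ⟨α, hα⟩ := IsAlgClosed.exists_aeval_eq_zero ℂ f hdeg
  set β : ℂ := (a : ℂ) * α with hβ
  have hintα : IsIntegral ℤ β := by
    have := isIntegral_leadingCoeff_smul f α hα
    rwa [zsmul_eq_mul] at this
  have hint : IsIntegral ℚ β := hintα.tower_top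
  have hα' : α ∈ ℚ⟮β⟯ := by
    have h1 : α = (a : ℂ)⁻¹ * β := by simp [*]
    rw [h1]
    exact mul_mem (inv_mem (intCast_mem _ a)) (IntermediateField.mem_adjoin_simple_self ℚ β)
  have hF : ℚ⟮β⟯ = ℚ⟮α⟯ := by
    apply le_antisymm
    · rw [IntermediateField.adjoin_simple_le_iff]
      exact mul_mem (intCast_mem _ a) (IntermediateField.mem_adjoin_simple_self ℚ α)
    · aesop
  have hprim : f.IsPrimitive := hf.isPrimitive (by omega)
  have hirr := (Polynomial.IsPrimitive.Int.irreducible_iff_irreducible_map_cast hprim).1 hf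
  set g := f.map (castRingHom ℚ) with hg
  have hgα : aeval α g = 0 := by
    rw [← hα, hg, ← algebraMap_int_eq, Polynomial.aeval_map_algebraMap]
  have hαi : IsIntegral ℚ α := isAlgebraic_iff_isIntegral.1 ⟨g, hirr.ne_zero, hgα⟩
  have hmin : (minpoly ℚ α).natDegree = d := by
    rw [← minpoly.eq_of_irreducible hirr hgα, Polynomial.natDegree_mul_C (inv_ne_zero (leadingCoeff_ne_zero.2 hirr.ne_zero)),
      hg, Polynomial.natDegree_map_eq_of_injective (RingHom.injective_int _), hd]
  have hfin : dg ℚ⟮β⟯ = d := by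
    rw [hF, IntermediateField.adjoin.finrank hαi, hmin]
  haveI : FiniteDimensional ℚ ℚ⟮β⟯ := IntermediateField.adjoin.finiteDimensional hint
  haveI hNF : NumberField ℚ⟮β⟯ := @NumberField.mk _ _ inferInstance inferInstance
  refine ⟨ℚ⟮β⟯, hNF, hfin, ?_, fun x => ?_⟩
  · set pb := IntermediateField.adjoin.powerBasis hint with hpb
    have hdim : pb.dim = d := by rw [← pb.finrank, hfin]
    have hroot : aeval (⟨α, hα'⟩ : ℚ⟮β⟯) f = 0 := by
      have := Polynomial.aeval_algebraMap_apply ℂ (⟨α, hα'⟩ : ℚ⟮β⟯) f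
      simpa using this.symm.trans hα
    have hga : pb.gen = a • (⟨α, hα'⟩ : ℚ⟮β⟯) := by
      apply Subtype.coe_injective
      show β = ((a • (⟨α, hα'⟩ : ℚ⟮β⟯) : ℚ⟮β⟯) : ℂ)
      simp [hβ]
    have h1 := discr_le_pb ℚ⟮β⟯ pb (by rw [hga]; exact isIntegral_leadingCoeff_smul f _ hroot) (2 ^ (σ + 1)) (by
        have : (1:ℝ) ≤ 2 ^ (σ + 1) := one_le_pow₀ bn
        linarith) (fun φ => by
        have hr : aeval (φ ⟨α, hα'⟩) f = 0 := by
          have := Polynomial.aeval_algHom_apply (φ.restrictScalars ℤ) (⟨α, hα'⟩ : ℚ⟮β⟯) f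
          rw [hroot, map_zero] at this
          exact this
        rw [hga, map_zsmul, zsmul_eq_mul]
        exact root_bound f hf0 σ hc _ hr)
    rw [hdim] at h1
    have hD0 : (0:ℝ) < (discr ℚ⟮β⟯).natAbs := by
      have := discr_ne_zero ℚ⟮β⟯
      exact_mod_cast Int.natAbs_pos.2 this
    have h2 := log_le_log hD0 h1
    rw [← pow_succ', ← pow_mul, log_pow] at h2
    refine h2.trans ?_
    have hl2 : log 2 ≤ 1 := by
      have := log_le_sub_one_of_pos (x := 2) bn
      linarith
    have hσ1 : (1:ℝ) ≤ σ := by exact_mod_cast hσ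
    push_cast
    calc ((σ:ℝ) + 1 + 1) * (2 * (d:ℝ) ^ 2) * log 2 ≤ ((σ:ℝ) + 1 + 1) * (2 * (d:ℝ) ^ 2) * 1 := by gcongr
      _ ≤ _ := by nlinarith
  · set S := (range (⌊x⌋₊ + 1)).filter (fun p => p.Prime ∧ ∃ P : PS ℚ⟮β⟯, nP P = p) with hS
    have h1 := bad_primes a ha σ (hc _) (S.filter fun p : ℕ => (p : ℤ) ∣ a) (fun p hp => by
      simp only [hS, Finset.mem_filter] at hp
      exact ⟨hp.1.2.1, hp.2⟩)
    have h2 : (S.filter fun p : ℕ => ¬ (p : ℤ) ∣ a).card ≤ piPoly f x := by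
      refine Finset.card_le_card fun p hp => ?_
      simp only [hS, Finset.mem_filter] at hp ⊢
      obtain ⟨⟨h3, h4, P, hP⟩, h5⟩ := hp
      refine ⟨h3, h4, root_mod ℚ⟮β⟯ f ⟨α, hα'⟩ ?_ p h4 P hP h5⟩
      have := Polynomial.aeval_algebraMap_apply ℂ (⟨α, hα'⟩ : ℚ⟮β⟯) f
      simpa using this.symm.trans hα
    have := Finset.card_filter_add_card_filter_not (s := S) (fun p : ℕ => (p : ℤ) ∣ a)
    omega
end
lemma end_real (C3 : ℝ) (hC3 : 0 ≤ C3) (X Y D L A d s P C : ℝ) (hC : 4 < C) (hL2 : 2 ≤ L) (hDL : D = exp L) (hYX : Y ^ 4 = X)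
    (hY : (C3 + 3) * 362880 * (16 / 5) ^ 9 ≤ Y) (hY16 : 16 * L ≤ Y) (hd1 : 1 ≤ d) (hs : s ≤ D)
    (hA : A ≤ C3 * D * X ^ 2)
    (hP : exp X * (1 - A * exp (-(Y / 2))) ≤ d * X * (P + s) + d * (2 * √(exp X) * X)) :
    exp X * (1 / (d * X) - exp (-X ^ (1 / C) / L ^ C)) ≤ P := by
  have hY1 : 32 ≤ Y := by linarith
  have hXY : Y ≤ X := by
    rw [← hYX]
    calc Y = Y ^ 1 := (pow_one Y).symm
      _ ≤ Y ^ 4 := pow_le_pow_right₀ bl bn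
  have hX1 : 1 ≤ X := by linarith
  have hdX : 1 ≤ d * X := by nlinarith
  have hDY : D ≤ exp (Y / 16) := by rw [hDL]; exact exp_le_exp.2 bl
  have h1 : C3 * Y ^ 8 + 3 ≤ exp (5 / 16 * Y) := by
    have e1 := pow_div_factorial_le_exp (5 / 16 * Y) bl 9
    refine le_trans ?_ e1
    rw [le_div_iff₀ bn]
    have e2 : (1:ℝ) ≤ Y ^ 8 := one_le_pow₀ bl
    calc (C3 * Y ^ 8 + 3) * 362880 ≤ (C3 + 3) * Y ^ 8 * 362880 := by linarith
      _ = ((C3 + 3) * 362880 * (16 / 5) ^ 9) * ((5 / 16) ^ 9 * Y ^ 8) := by ring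
      _ ≤ Y * ((5 / 16) ^ 9 * Y ^ 8) := by gcongr
      _ = (5 / 16 * Y) ^ 9 := by ring
  have hsq : √(exp X) = exp (X / 2) := by
    rw [sqrt_eq_iff_mul_self_eq (exp_pos _).le (exp_pos _).le, ← exp_add]; ring_nf
  have h2 : s + 2 * exp (X / 2) ≤ exp X * (3 * exp (-(7 / 16 * Y))) := by
    have e1 : D ≤ exp (X / 2) := hDY.trans (exp_le_exp.2 bl)
    have e2 : exp (X / 2) ≤ exp X * exp (-(7 / 16 * Y)) := by
      rw [← exp_add]; exact exp_le_exp.2 bl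
    linarith
  have h3 : A * exp (-(Y / 2)) ≤ C3 * Y ^ 8 * exp (-(7 / 16 * Y)) := by
    have e1 : exp (-(7 / 16 * Y)) = exp (Y / 16) * exp (-(Y / 2)) := by rw [← exp_add]; ring_nf
    calc A * exp (-(Y / 2)) ≤ C3 * D * X ^ 2 * exp (-(Y / 2)) := by gcongr
      _ ≤ C3 * exp (Y / 16) * X ^ 2 * exp (-(Y / 2)) := by gcongr
      _ = _ := by rw [e1, ← hYX]; ring
  have h4 : exp (-(Y / 8)) ≤ exp (-X ^ (1 / C) / L ^ C) := by
    apply exp_le_exp.2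
    have e1 : X ^ (1 / C) ≤ Y := by
      have : X ^ (1 / C) ≤ X ^ (1 / 4 : ℝ) := rpow_le_rpow_of_exponent_le hX1 (by
        gcongr)
      refine this.trans (le_of_eq ?_)
      rw [← hYX, ← rpow_natCast, ← rpow_mul bl]
      norm_num
    have e2 : 8 ≤ L ^ C := by
      calc (8:ℝ) ≤ L ^ 4 := by
            calc (8:ℝ) ≤ 2 ^ 4 := by norm_num
              _ ≤ L ^ 4 := by gcongr
        _ = L ^ (4:ℝ) := by simp
        _ ≤ L ^ C := rpow_le_rpow_of_exponent_le bl hC.le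
    rw [neg_div, neg_le_neg_iff]
    gcongr
  have h5 : exp X * (A * exp (-(Y / 2))) + s + 2 * exp (X / 2) ≤ exp X * exp (-X ^ (1 / C) / L ^ C) := by
    have e1 : exp X * (A * exp (-(Y / 2))) ≤ exp X * (C3 * Y ^ 8 * exp (-(7 / 16 * Y))) := by gcongr
    have e2 : exp X * (C3 * Y ^ 8 * exp (-(7 / 16 * Y))) + exp X * (3 * exp (-(7 / 16 * Y))) ≤ exp X * exp (-(Y / 8)) := by
      have : exp (-(Y / 8)) = exp (5 / 16 * Y) * exp (-(7 / 16 * Y)) := by rw [← exp_add]; ring_nf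
      rw [← mul_add, ← add_mul, this]
      gcongr
    have e3 : exp X * exp (-(Y / 8)) ≤ exp X * exp (-X ^ (1 / C) / L ^ C) := by gcongr
    linarith
  set G := exp (-X ^ (1 / C) / L ^ C)
  set E := exp X
  set R := exp (X / 2)
  set W := A * exp (-(Y / 2)) with hW
  have hdX0 : 0 < d * X := by linarith
  have h6 : E * (1 / (d * X)) = E / (d * X) := by ring
  rw [mul_sub, h6, sub_le_iff_le_add, div_le_iff₀ hdX0]
  by_cases hWs : 0 ≤ W
  · have : E * W ≤ E * W * (d * X) := le_mul_of_one_le_right bp hdX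
    nlinarith
  · have hE := exp_pos X
    have h8 : s + 2 * R ≤ E * G := by
      refine h2.trans ?_
      have e2 : 3 * exp (-(7 / 16 * Y)) ≤ exp (-(Y / 8)) := by
        have : exp (-(Y / 8)) = exp (5 / 16 * Y) * exp (-(7 / 16 * Y)) := by rw [← exp_add]; ring_nf
        rw [this]
        have : 0 ≤ C3 * Y ^ 8 := by positivity
        gcongr
        linarith
      have : 3 * exp (-(7 / 16 * Y)) ≤ G := e2.trans h4
      exact mul_le_mul_of_nonneg_left this hE.le
    nlinarith
set_option maxHeartbeats 1000000 in
theorem mrh_main (C : ℝ) (hC : 4 < C) (hmdzh : MDZH C) :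
    ∃ c : ℝ, 0 < c ∧
      ∀ (f : Polynomial ℤ) (d σ : ℕ), Irreducible f → f.natDegree = d → 2 ≤ d → 0 < σ →
        (∀ i, |f.coeff i| ≤ 2 ^ σ) →
        ∀ x : ℝ,
          exp (c * log ((d : ℝ) ^ 2 * σ + (d : ℝ) ^ 3) ^ (2 + C ^ 2)) ≤ x →
          (piPoly f x : ℝ) ≥
            x * (1 / (d * log x) -
              exp (-(log x) ^ (1 / C) /
                log ((d : ℝ) ^ 2 * σ + (d : ℝ) ^ 3) ^ C)) := by
  have hC2 : 4 * C ≤ C ^ 2 := by nlinarith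
  obtain ⟨C1, hC1, hhecke⟩ := hecke
  obtain ⟨c0, hc0, hc04, hzf⟩ := zfree C C1 hC hC1 hmdzh
  set C3 := 12 + 224 * (9 + 6 * C1) with hC3
  set c3 := 24 / c0 * 3 ^ (C + 1) with hc3
  set m := max 16 (max ((C3 + 3) * 362880 * (16 / 5) ^ 9) c3) with hm
  have m1 : 16 ≤ m := le_max_left _ _
  have m2 : (C3 + 3) * 362880 * (16 / 5) ^ 9 ≤ m := (le_max_left _ _).trans (le_max_right _ _)
  have m3 : c3 ≤ m := (le_max_right _ _).trans (le_max_right _ _)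
  have hc30 : 0 < c3 := by positivity
  clear_value m
  refine ⟨m ^ 4, by positivity, fun f d σ hf hd hd2 hσ hcf x hx => ?_⟩
  obtain ⟨F, hNF, hfin, hDisc, hcard⟩ := setup f d σ hf hd hd2 hσ hcf
  obtain ⟨H, hH⟩ := hhecke F
  replace hH : HB F C1 H := hH
  have h2 : 1 < dg F := by omega
  set D : ℝ := (d:ℝ) ^ 2 * σ + (d:ℝ) ^ 3 with hD
  have hd2' : (2:ℝ) ≤ d := by exact_mod_cast hd2
  have hσ1 : (1:ℝ) ≤ σ := by exact_mod_cast hσ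
  have hdd : (4:ℝ) ≤ (d:ℝ) ^ 2 := by nlinarith
  have hddd : 2 * (d:ℝ) ^ 2 ≤ (d:ℝ) ^ 3 := by nlinarith [sq_nonneg (d:ℝ)]
  have hd22 : (d:ℝ) ≤ (d:ℝ) ^ 2 := by nlinarith
  have hds : (d:ℝ) ^ 2 ≤ (d:ℝ) ^ 2 * σ := le_mul_of_one_le_right bp hσ1
  have hD12 : 12 ≤ D := by linarith
  have hdD : (d:ℝ) ≤ D := by linarith [hd22]
  have hσD : (σ:ℝ) ≤ D := by linarith [le_mul_of_one_le_left (by positivity : (0:ℝ) ≤ σ) (by linarith : (1:ℝ) ≤ (d:ℝ) ^ 2)]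
  have hdsD : (d:ℝ) ^ 2 * σ ≤ D := by rw [hD]; linarith
  set L := log D with hL
  have hDL : D = exp L := (exp_log bl).symm
  have hL2 : 2 ≤ L := by
    rw [hL, le_log_iff_exp_le bl]
    have := exp_one_lt_d9
    have e : exp 2 = exp 1 * exp 1 := by rw [← exp_add]; norm_num
    rw [e]
    have h3 : exp 1 ≤ 3 := by linarith
    linarith [mul_le_mul h3 h3 (exp_pos 1).le bn]
  clear_value L D
  have hx0 : 0 < x := (exp_pos _).trans_le hx
  set X := log x with hX
  have hxX : x = exp X := (exp_log hx0).symm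
  have hXL : m ^ 4 * L ^ (2 + C ^ 2) ≤ X := by rwa [hX, le_log_iff_exp_le hx0]
  rw [hxX]
  clear_value X
  have hX0 : 0 < X := lt_of_lt_of_le bp hXL
  set Y := X ^ (1 / 4 : ℝ) with hYd
  have hY0 : 0 < Y := by positivity
  have hYX : Y ^ 4 = X := by
    rw [hYd, ← rpow_natCast, ← rpow_mul hX0.le]; norm_num
  clear_value Y
  have hL1 : 1 ≤ L := by linarith
  have hY1 : m * L ≤ Y := by
    rw [← pow_le_pow_iff_left₀ bp hY0.le (n := 4) bn, hYX, mul_pow]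
    refine le_trans ?_ hXL
    gcongr
    rw [← rpow_natCast]
    refine rpow_le_rpow_of_exponent_le hL1 ?_
    push_cast
    linarith
  have hY2 : c3 * L ^ (C + 1) ≤ Y ^ 2 := by
    rw [← pow_le_pow_iff_left₀ bp bp (n := 2) bn, ← pow_mul, show 2 * 2 = 4 by norm_num, hYX, mul_pow]
    refine le_trans ?_ hXL
    have e1 : c3 ^ 2 ≤ m ^ 4 := by
      calc c3 ^ 2 ≤ m ^ 2 := by gcongr
        _ ≤ m ^ 4 := pow_le_pow_right₀ bl bn
    have e2 : (L ^ (C + 1)) ^ 2 ≤ L ^ (2 + C ^ 2) := by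
      rw [← rpow_natCast, ← rpow_mul bl]
      refine rpow_le_rpow_of_exponent_le hL1 ?_
      push_cast
      linarith
    gcongr
  have hYm : m ≤ Y := le_trans (le_mul_of_one_le_right bl hL1) hY1
  have hY16 : 16 * L ≤ Y := le_trans (by gcongr) hY1
  have hl1 := ell_ge F h2
  have hlD := logD_ge F h2
  have hDisc' : log dsc F ≤ 6 * D := by linarith
  have hl3 : ell F ≤ 3 * L := by
    rw [← exp_le_exp, exp_ell F h2, log3D F h2, hfin]
    have e1 : exp (3 * L) = D * (D * D) := by rw [hDL, ← exp_add, ← exp_add]; ring_nf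
    rw [e1]
    have e2 : log 3 ≤ 2 := by
      have := log_le_sub_one_of_pos (x := 3) bn
      linarith
    have e3 : log 3 + log dsc F ≤ D * D := by linarith [mul_le_mul_of_nonneg_right hD12 (by linarith : 0 ≤ D)]
    have := log_three_ge
    gcongr
  have hT1 : 1 ≤ exp Y := one_le_exp hY0.le
  have hlT : log (exp Y + 3) ≤ 3 * Y := by
    rw [log_le_iff_le_exp bp]
    have e1 : exp (3 * Y) = exp Y * exp (2 * Y) := by rw [← exp_add]; ring_nf
    have e2 : 4 ≤ exp (2 * Y) := by
      have := add_one_le_exp (2 * Y)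
      linarith
    rw [e1]
    linarith [mul_le_mul_of_nonneg_left e2 (exp_pos Y).le]
  have hlT1 : 1 ≤ log (exp Y + 3) := log_three_ge.trans (log_le_log bn bl)
  set η := c0 / (ell F ^ (C + 1) * log (exp Y + 3)) with hη
  have hlC : 1 ≤ ell F ^ (C + 1) := one_le_rpow hl1 bl
  have hη0 : 0 < η := by positivity
  have hη1 : η ≤ 1 / 4 := by
    exact le_trans (div_le_self hc0.le (one_le_mul_of_one_le_of_one_le hlC hlT1)) hc04
  have hX2 : 2 ≤ X := by
    rw [← hYX]
    calc (2:ℝ) ≤ Y ^ 1 := by linarith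
      _ ≤ Y ^ 4 := pow_le_pow_right₀ bl bn
  have hηX : 4 * Y ≤ η * (X - 1) := by
    rw [hη, div_mul_eq_mul_div, le_div_iff₀ bp]
    have e1 : ell F ^ (C + 1) ≤ 3 ^ (C + 1) * L ^ (C + 1) := by
      rw [← mul_rpow bn bl]
      exact rpow_le_rpow bl hl3 bl
    have e2 : c0 * c3 = 24 * 3 ^ (C + 1) := by rw [hc3]; field_simp
    calc 4 * Y * (ell F ^ (C + 1) * log (exp Y + 3)) ≤ 4 * Y * ((3 ^ (C + 1) * L ^ (C + 1)) * (3 * Y)) := by gcongr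
      _ = c0 * (Y ^ 2 * (c3 * L ^ (C + 1)) / 2) := by linear_combination (-(Y ^ 2 * L ^ (C + 1) / 2)) * e2
      _ ≤ c0 * (Y ^ 2 * Y ^ 2 / 2) := by gcongr
      _ = c0 * (X / 2) := by rw [← hYX]; ring
      _ ≤ c0 * (X - 1) := by gcongr; linarith
  have hw : 1 / η ≤ X := by
    rw [div_le_iff₀ hη0]
    linarith [mul_sub η X 1, mul_comm η X]
  have hpsi := psi_lower F C1 hC1 H hH η X Y hη0 hη1 bl hηX bl
    (fun s hs hs2 => hzf F h2 H hH (exp Y) bp s hs hs2)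
  have hps := prime_sum F (exp X) (one_le_exp hX0.le)
  rw [log_exp] at hps
  have hc := hcard (exp X)
  have hc' : (((Finset.range (⌊exp X⌋₊ + 1)).filter (fun p => p.Prime ∧ ∃ P : PS F, nP P = p)).card : ℝ) ≤ piPoly f (exp X) + σ := by
    exact_mod_cast hc
  rw [hfin] at hpsi hps
  have hfinal := end_real C3 bp X Y D L _ d σ (piPoly f (exp X)) C hC hL2 hDL hYX bl hY16 bl hσD ?_
    (hpsi.trans (hps.trans (by gcongr)))
  · exact hfinal
  · set lD := log dsc F
    have e1 : 56 * ((d:ℝ) + lD + 6 * C1 * d + 2 * d / η) / η ≤ 56 * (9 + 6 * C1) * (D * X ^ 2) := by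
      have e2 : 56 * ((d:ℝ) + lD + 6 * C1 * d + 2 * d / η) / η = 56 * ((d:ℝ) + lD + 6 * C1 * d + 2 * d * (1 / η)) * (1 / η) := by ring
      rw [e2]
      have e3 : (d:ℝ) + lD + 6 * C1 * d + 2 * d * (1 / η) ≤ (9 + 6 * C1) * D * X := by
        have a1 : 2 * (d:ℝ) * (1 / η) ≤ 2 * D * X := by gcongr
        have a2 : 6 * C1 * (d:ℝ) ≤ 6 * C1 * D := by gcongr
        have a3 : (7 + 6 * C1) * D ≤ (7 + 6 * C1) * D * X := le_mul_of_one_le_right bp bl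
        have a4 : (9 + 6 * C1) * D * X = (7 + 6 * C1) * D * X + 2 * D * X := by ring
        rw [a4]
        linarith
      calc 56 * ((d:ℝ) + lD + 6 * C1 * d + 2 * d * (1 / η)) * (1 / η) ≤ 56 * ((9 + 6 * C1) * D * X) * X := by gcongr
        _ = _ := by ring
    have e4 : 10 * (d:ℝ) * X ^ 2 ≤ 10 * D * X ^ 2 := by gcongr
    have e6 : (1:ℝ) ≤ X ^ 2 := one_le_pow₀ bl
    have e5 : (2:ℝ) ≤ 2 * (D * X ^ 2) := by
      have : 1 * 1 ≤ D * X ^ 2 := mul_le_mul bl e6 bn bl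
      linarith
    rw [hC3]
    have e7 : (12 + 224 * (9 + 6 * C1)) * D * X ^ 2 = 2 * (D * X ^ 2) + 4 * (56 * (9 + 6 * C1) * (D * X ^ 2)) + 10 * D * X ^ 2 := by ring
    rw [e7]
    linarith
end

/-- MDZH with a constant `C > 4` implies MRH with the same constant `C`. -/
theorem mdzh_implies_mrh (C : ℝ) (hC : 4 < C) (hmdzh : MDZH C) :
    ∃ c : ℝ, 0 < c ∧
      ∀ (f : Polynomial ℤ) (d σ : ℕ), Irreducible f → f.natDegree = d → 2 ≤ d → 0 < σ →
        (∀ i, |f.coeff i| ≤ 2 ^ σ) →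
        ∀ x : ℝ,
          Real.exp (c * Real.log ((d : ℝ) ^ 2 * σ + (d : ℝ) ^ 3) ^ (2 + C ^ 2)) ≤ x →
          (piPoly f x : ℝ) ≥
            x * (1 / (d * Real.log x) -
              Real.exp (-(Real.log x) ^ (1 / C) /
                Real.log ((d : ℝ) ^ 2 * σ + (d : ℝ) ^ 3) ^ C)) := by
  exact mrh_main C hC hmdzh

end
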